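/- Let n ≥ 2 and let α₁,…,α_n ∈ ℝ^n be linearly independent vectors all of whose coordinates are real algebraic numbers, and let ε > 0. Then the set of rational lines Λ = ℝq, with q ∈ ℤ^n a primitive integer vector, satisfying ∏_{i=1}^n δ(α_i, q^⊥) ≤ ξ(α₁,…,α_n)·‖q‖₂^{−n−ε} is contained in a finite union of proper rational linear subspaces of ℝ^n (i.e. proper subspaces of ℝ^n spanned by vectors of ℚ^n). -/

import Mathlib

open MeasureTheory Set

noncomputable section

/-- Euclidean norm on `ℝ^n`. -/
def euclNorm {n : ℕ} (x : Fin n → ℝ) : ℝ := Real.sqrt (∑ i, x i ^ 2)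

/-- Scalar product on `ℝ^n`. -/
def dotp {n : ℕ} (x y : Fin n → ℝ) : ℝ := ∑ i, x i * y i

/-- Real vector obtained from an integer vector. -/
def zCast {n : ℕ} (q : Fin n → ℤ) : Fin n → ℝ := fun i => (q i : ℝ)

section
namespace SST
open MvPolynomial

/-- product of binomial coefficients -/
def mbin {m : ℕ} (e I : Fin m →₀ ℕ) : ℕ := ∏ i, (e i).choose (I i)

/-- Hasse derivative. -/
def hD {m : ℕ} {R : Type*} [CommRing R] (I : Fin m →₀ ℕ) :
    MvPolynomial (Fin m) R →ₗ[R] MvPolynomial (Fin m) R :=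
  (basisMonomials (Fin m) R).constr R (fun e => monomial (e - I) ((mbin e I : ℕ) : R))

lemma hD_monomial {m : ℕ} {R : Type*} [CommRing R] (I e : Fin m →₀ ℕ) (c : R) :
    hD I (monomial e c) = monomial (e - I) (c * (mbin e I : R)) := by
  have h1 : (monomial e c : MvPolynomial (Fin m) R) = c • (basisMonomials (Fin m) R e) := by
    simp [coe_basisMonomials, smul_monomial]
  rw [h1, map_smul, hD, Module.Basis.constr_basis, smul_monomial, smul_eq_mul]

lemma coeff_hD {m : ℕ} {R : Type*} [CommRing R] (I d : Fin m →₀ ℕ) (f : MvPolynomial (Fin m) R) :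
    coeff d (hD I f) = (mbin (d + I) I : R) * coeff (d + I) f := by
  classical
  induction f using MvPolynomial.induction_on' with
  | monomial e c =>
    rw [hD_monomial, coeff_monomial, coeff_monomial]
    by_cases h : I ≤ e
    · have : (e - I = d) ↔ (e = d + I) := by
        constructor
        · rintro rfl; rw [tsub_add_cancel_of_le h]
        · rintro rfl; simp
      by_cases h2 : e = d + I
      · rw [if_pos (this.2 h2), if_pos h2, h2]; ring
      · rw [if_neg (fun h3 => h2 (this.1 h3)), if_neg h2]; ring
    · have h0 : mbin e I = 0 := by
        have : ∃ i, ¬ I i ≤ e i := by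
          by_contra hh; push Not at hh; exact h hh
        obtain ⟨i, hi⟩ := this
        exact Finset.prod_eq_zero (Finset.mem_univ i) (Nat.choose_eq_zero_of_lt (by omega))
      have h2 : e ≠ d + I := by rintro rfl; exact h (by simp)
      rw [if_neg h2, h0]; simp
  | add p q hp hq => rw [map_add, coeff_add, hp, hq, coeff_add]; ring

lemma hD_zero {m : ℕ} {R : Type*} [CommRing R] (f : MvPolynomial (Fin m) R) : hD 0 f = f := by
  ext d; rw [coeff_hD]; simp [mbin]

lemma mbin_succ {m : ℕ} (d I : Fin m →₀ ℕ) (i : Fin m) :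
    mbin (d + Finsupp.single i 1 + I) I * (d i + 1) =
      (I i + 1) * mbin (d + (I + Finsupp.single i 1)) (I + Finsupp.single i 1) := by
  classical
  unfold mbin
  rw [← Finset.mul_prod_erase _ _ (Finset.mem_univ i), ← Finset.mul_prod_erase _ _ (Finset.mem_univ i)]
  have : ∏ x ∈ Finset.univ.erase i, ((d + Finsupp.single i 1 + I : Fin m →₀ ℕ) x).choose (I x) =
      ∏ x ∈ Finset.univ.erase i, ((d + (I + Finsupp.single i 1) : Fin m →₀ ℕ) x).choose
        ((I + Finsupp.single i 1 : Fin m →₀ ℕ) x) := by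
    refine Finset.prod_congr rfl fun x hx => ?_
    have : i ≠ x := (Finset.ne_of_mem_erase hx).symm
    simp [this]
  rw [this]
  generalize (∏ x ∈ Finset.univ.erase i, _ : ℕ) = P
  simp only [Finsupp.coe_add, Pi.add_apply, Finsupp.single_eq_same]
  have h := Nat.choose_succ_right_eq (d i + 1 + I i) (I i)
  have h2 : d i + 1 + I i - I i = d i + 1 := by omega
  rw [h2] at h
  have h3 : d i + (I i + 1) = d i + 1 + I i := by ring
  rw [h3]
  calc _ = ((d i + 1 + I i).choose (I i) * (d i + 1)) * P := by ring
    _ = _ := by rw [← h]; ring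

lemma pderiv_hD {m : ℕ} {R : Type*} [CommRing R] (I : Fin m →₀ ℕ) (i : Fin m)
    (f : MvPolynomial (Fin m) R) :
    pderiv i (hD I f) = ((I i + 1 : ℕ) : R) • hD (I + Finsupp.single i 1) f := by
  ext d
  rw [coeff_pderiv, coeff_hD, coeff_smul, coeff_hD, smul_eq_mul]
  have h := mbin_succ d I i
  have h' : d + Finsupp.single i 1 + I = d + (I + Finsupp.single i 1) := by abel
  rw [← h']
  have h'' : ((mbin (d + Finsupp.single i 1 + I) I * (d i + 1) : ℕ) : R) = 
      (((I i + 1) * mbin (d + (I + Finsupp.single i 1)) (I + Finsupp.single i 1) : ℕ) : R) := by rw [h]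
  rw [← h'] at h''
  push_cast at h'' ⊢
  linear_combination coeff (d + Finsupp.single i 1 + I) f * h''

/-- translation -/
def shift {m : ℕ} {R : Type*} [CommRing R] (ξ : Fin m → R) :
    MvPolynomial (Fin m) R →ₐ[R] MvPolynomial (Fin m) R :=
  aeval (fun i => X i + C (ξ i))

lemma shift_shift {m : ℕ} {R : Type*} [CommRing R] (ξ : Fin m → R) (f : MvPolynomial (Fin m) R) :
    shift (-ξ) (shift ξ f) = f := by
  have : (shift (-ξ)).comp (shift ξ) = AlgHom.id R _ := by
    ext i; simp [shift]
  exact congrArg (fun g => g f) this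

lemma shift_injective {m : ℕ} {R : Type*} [CommRing R] (ξ : Fin m → R) :
    Function.Injective (shift ξ) := fun f g h => by
  rw [← shift_shift ξ f, h, shift_shift]

lemma pderiv_shift {m : ℕ} {R : Type*} [CommRing R] (ξ : Fin m → R) (i : Fin m)
    (f : MvPolynomial (Fin m) R) : pderiv i (shift ξ f) = shift ξ (pderiv i f) := by
  induction f using MvPolynomial.induction_on with
  | C a => simp [shift]
  | add p q hp hq => simp [hp, hq]
  | mul_X p j hp =>
    rw [map_mul, Derivation.leibniz, Derivation.leibniz, hp]
    simp only [shift, aeval_X, map_add, pderiv_C, add_zero, smul_eq_mul, map_mul]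
    congr 1
    simp only [pderiv_X]
    congr 1
    by_cases h : i = j
    · subst h; simp
    · simp [h]

lemma finsupp_ind {m : ℕ} (p : (Fin m →₀ ℕ) → Prop) (h0 : p 0)
    (hs : ∀ I i, p I → p (I + Finsupp.single i 1)) : ∀ I, p I := by
  intro I
  induction I using Finsupp.induction_linear with
  | zero => exact h0
  | single i n => 
    induction n with
    | zero => simpa using h0
    | succ n ih => rw [Finsupp.single_add]; exact hs _ _ ih
  | add f g hf hg => 
    clear hg
    induction g using Finsupp.induction with
    | zero => simpa using hf
    | single_add a b g _ _ ih =>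
      rw [add_comm (Finsupp.single a b) g, ← add_assoc]
      clear * - ih hs
      induction b with
      | zero => simpa using ih
      | succ n ih2 => rw [Finsupp.single_add, ← add_assoc]; exact hs _ _ ih2

lemma hD_shift {m : ℕ} (ξ : Fin m → ℚ) (f : MvPolynomial (Fin m) ℚ) (I : Fin m →₀ ℕ) :
    hD I (shift ξ f) = shift ξ (hD I f) := by
  refine finsupp_ind (fun I => hD I (shift ξ f) = shift ξ (hD I f)) ?_ ?_ I
  · simp only [hD_zero]
  · intro I i h
    have h1 := pderiv_hD I i (shift ξ f)
    rw [h, pderiv_shift, pderiv_hD, map_smul] at h1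
    have h2 : ((I i + 1 : ℕ) : ℚ) ≠ 0 := by positivity
    exact (smul_right_injective _ h2 h1).symm

lemma eq_zero_of_eval_hD {m : ℕ} (p : Fin m → ℚ) (g : MvPolynomial (Fin m) ℚ)
    (h : ∀ I, eval p (hD I g) = 0) : g = 0 := by
  apply shift_injective p
  rw [map_zero]
  ext I
  have h1 : coeff 0 (hD I (shift p g)) = coeff I (shift p g) := by
    rw [coeff_hD]; simp [mbin]
  rw [← h1, hD_shift, coeff_zero, ← h I]
  have : (eval (0 : Fin m → ℚ)).comp ((shift p : _ →ₐ[ℚ] _) : _ →+* MvPolynomial (Fin m) ℚ) = eval p := by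
    apply MvPolynomial.ringHom_ext
    · intro a; simp [shift]
    · intro i; simp [shift]
  rw [← this]
  simp [← constantCoeff_eq, eval_zero]

section wr
variable {m k : ℕ} (f : Fin k → MvPolynomial (Fin m) ℚ)

/-- row of Hasse derivatives -/
def hrow (J : Fin m →₀ ℕ) : Fin k → MvPolynomial (Fin m) ℚ := fun j => hD J (f j)

/-- saturation predicate -/
def inSat (Z : Submodule (MvPolynomial (Fin m) ℚ) (Fin k → MvPolynomial (Fin m) ℚ))
    (x : Fin k → MvPolynomial (Fin m) ℚ) : Prop :=
  ∃ d : MvPolynomial (Fin m) ℚ, d ≠ 0 ∧ d • x ∈ Z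

variable {Z : Submodule (MvPolynomial (Fin m) ℚ) (Fin k → MvPolynomial (Fin m) ℚ)}

lemma inSat_of_mem {x : Fin k → MvPolynomial (Fin m) ℚ} (h : x ∈ Z) : inSat Z x :=
  ⟨1, one_ne_zero, by simpa using h⟩

lemma inSat.add {x y : Fin k → MvPolynomial (Fin m) ℚ} (hx : inSat Z x) (hy : inSat Z y) :
    inSat Z (x + y) := by
  obtain ⟨d, hd, hx⟩ := hx
  obtain ⟨e, he, hy⟩ := hy
  refine ⟨d * e, mul_ne_zero hd he, ?_⟩
  have : (d * e) • (x + y) = e • (d • x) + d • (e • y) := by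
    rw [smul_add, smul_smul, smul_smul, mul_comm e d]
  rw [this]
  exact Z.add_mem (Z.smul_mem _ hx) (Z.smul_mem _ hy)

lemma inSat.smul {x : Fin k → MvPolynomial (Fin m) ℚ} (hx : inSat Z x) (a : MvPolynomial (Fin m) ℚ) :
    inSat Z (a • x) := by
  obtain ⟨d, hd, hx⟩ := hx
  refine ⟨d, hd, ?_⟩
  rw [smul_comm]; exact Z.smul_mem _ hx

lemma inSat.of_smul {x : Fin k → MvPolynomial (Fin m) ℚ} {a : MvPolynomial (Fin m) ℚ} (ha : a ≠ 0)
    (hx : inSat Z (a • x)) : inSat Z x := by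
  obtain ⟨d, hd, hx⟩ := hx
  exact ⟨d * a, mul_ne_zero hd ha, by rwa [mul_smul]⟩

/-- componentwise derivative -/
def pdv (i : Fin m) (x : Fin k → MvPolynomial (Fin m) ℚ) : Fin k → MvPolynomial (Fin m) ℚ :=
  fun j => pderiv i (x j)

lemma pdv_add (i : Fin m) (x y : Fin k → MvPolynomial (Fin m) ℚ) :
    pdv i (x + y) = pdv i x + pdv i y := by
  funext j; simp [pdv]

lemma pdv_smul (i : Fin m) (a : MvPolynomial (Fin m) ℚ) (x : Fin k → MvPolynomial (Fin m) ℚ) :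
    pdv i (a • x) = pderiv i a • x + a • pdv i x := by
  funext j; simp [pdv, Derivation.leibniz]; ring

lemma pdv_hrow (i : Fin m) (J : Fin m →₀ ℕ) :
    pdv i (hrow f J) = (C ((J i + 1 : ℕ) : ℚ) : MvPolynomial (Fin m) ℚ) • hrow f (J + Finsupp.single i 1) := by
  funext j
  simp only [pdv, hrow, pderiv_hD, Pi.smul_apply, smul_eq_mul, smul_eq_C_mul]

lemma wronskian_step (hf : LinearIndependent ℚ f) (s : ℕ) (hs : s < k) (I : Fin s → (Fin m →₀ ℕ))
    (hI : ∀ t, (I t).degree ≤ t) (hli : LinearIndependent (MvPolynomial (Fin m) ℚ) (fun t => hrow f (I t))) :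
    ∃ J : Fin m →₀ ℕ, J.degree ≤ s ∧
      LinearIndependent (MvPolynomial (Fin m) ℚ) (fun t : Fin (s+1) => hrow f (Fin.snoc (α := fun _ => Fin m →₀ ℕ) I J t)) := by
  classical
  by_contra hcon
  push Not at hcon
  set Z := Submodule.span (MvPolynomial (Fin m) ℚ) (Set.range (fun t => hrow f (I t))) with hZ
  have h1 : ∀ J : Fin m →₀ ℕ, J.degree ≤ s → inSat Z (hrow f J) := by
    intro J hJ
    have h := hcon J hJ
    rw [Fintype.not_linearIndependent_iff] at h
    obtain ⟨g, hg, i, hi⟩ := h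
    rw [Fin.sum_univ_castSucc] at hg
    simp only [Fin.snoc_castSucc, Fin.snoc_last] at hg
    by_cases h0 : g (Fin.last s) = 0
    · exfalso
      rw [h0, zero_smul, add_zero] at hg
      have := Fintype.linearIndependent_iff.1 hli _ hg
      refine Fin.lastCases (motive := fun i => g i ≠ 0 → False) (fun h => h h0) (fun i h => h (this i)) i hi
    · refine ⟨g (Fin.last s), h0, ?_⟩
      rw [add_comm] at hg
      rw [eq_neg_of_add_eq_zero_left hg]
      exact Z.neg_mem (Z.sum_mem fun t _ => Z.smul_mem _ (Submodule.subset_span ⟨t, rfl⟩))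
  have h2 : ∀ i x, x ∈ Z → inSat Z (pdv i x) := by
    intro i x hx
    induction hx using Submodule.span_induction with
    | mem x hx =>
      obtain ⟨t, rfl⟩ := hx
      simp only
      rw [pdv_hrow]
      refine (h1 _ ?_).smul _
      have := hI t
      have ht := t.2
      rw [map_add, Finsupp.degree_single]
      omega
    | zero => 
      have : pdv i (0 : Fin k → MvPolynomial (Fin m) ℚ) = 0 := by funext j; simp [pdv]
      rw [this]; exact inSat_of_mem Z.zero_mem
    | add x y _ _ hx hy => rw [pdv_add]; exact hx.add hy
    | smul a x hx0 hx => rw [pdv_smul]; exact ((inSat_of_mem hx0).smul _).add (hx.smul _)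
  have h3 : ∀ J, inSat Z (hrow f J) := by
    refine finsupp_ind _ (h1 _ (by simp)) ?_
    intro J i hJ
    obtain ⟨d, hd, hJ'⟩ := hJ
    have h4 := h2 i _ hJ'
    rw [pdv_smul, pdv_hrow, smul_smul] at h4
    have h5 : inSat Z (pderiv i d • hrow f J) := inSat.smul ⟨d, hd, hJ'⟩ _
    have h6 := h4.add (h5.smul (-1))
    have h7 : (d * C ((J i + 1 : ℕ) : ℚ)) ≠ 0 := by
      refine mul_ne_zero hd ?_
      rw [Ne, C_eq_zero]; positivity
    refine inSat.of_smul h7 ?_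
    convert h6 using 1
    module
  -- functional
  have h8 : ∃ w : Fin k → MvPolynomial (Fin m) ℚ, w ≠ 0 ∧ ∀ t, ∑ j, w j * hrow f (I t) j = 0 := by
    by_contra hc
    push Not at hc
    have hinj : Function.Injective (Matrix.mulVecLin (Matrix.of fun t j => hrow f (I t) j)) := by
      rw [← LinearMap.ker_eq_bot, LinearMap.ker_eq_bot']
      intro w hw
      by_contra hw0
      obtain ⟨t, ht⟩ := hc w hw0
      apply ht
      have := congrFun hw t
      simp only [Matrix.mulVecLin_apply, Matrix.mulVec, dotProduct, Matrix.of_apply, Pi.zero_apply] at this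
      rw [← this]
      exact Finset.sum_congr rfl fun _ _ => mul_comm _ _
    have := le_of_fin_injective (R := MvPolynomial (Fin m) ℚ) _ hinj
    omega
  obtain ⟨w, hw, hwI⟩ := h8
  have h9 : ∀ x ∈ Z, ∑ j, w j * x j = 0 := by
    intro x hx
    induction hx using Submodule.span_induction with
    | mem x hx => obtain ⟨t, rfl⟩ := hx; exact hwI t
    | zero => simp
    | add x y _ _ hx hy => simp [mul_add, Finset.sum_add_distrib, hx, hy]
    | smul a x hx0 hx => 
      have : ∑ j, w j * (a • x) j = a * ∑ j, w j * x j := by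
        rw [Finset.mul_sum]; refine Finset.sum_congr rfl fun j _ => ?_
        simp only [Pi.smul_apply, smul_eq_mul]; ring
      rw [this, hx, mul_zero]
  have h10 : ∀ J, ∑ j, w j * hD J (f j) = 0 := by
    intro J
    obtain ⟨d, hd, hJ⟩ := h3 J
    have := h9 _ hJ
    have h' : ∑ j, w j * (d • hrow f J) j = d * ∑ j, w j * hD J (f j) := by
        rw [Finset.mul_sum]; refine Finset.sum_congr rfl fun j _ => ?_
        simp only [Pi.smul_apply, smul_eq_mul, hrow]; ring
    rw [h'] at this
    exact (mul_eq_zero.1 this).resolve_left hd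
  obtain ⟨j0, hj0⟩ := Function.ne_iff.1 hw
  have : ∃ p : Fin m → ℚ, eval p (w j0) ≠ 0 := by
    by_contra hp
    push Not at hp
    exact hj0 (MvPolynomial.funext (fun p => by simpa using hp p))
  obtain ⟨p, hp⟩ := this
  have hg : ∑ j, eval p (w j) • f j = 0 := by
    apply eq_zero_of_eval_hD p
    intro J
    have := congrArg (eval p) (h10 J)
    simp only [map_sum, map_mul, map_zero, map_smul, smul_eval] at this ⊢
    exact this
  exact hp (Fintype.linearIndependent_iff.1 hf _ hg j0)

theorem wronskian (hf : LinearIndependent ℚ f) :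
    ∃ I : Fin k → (Fin m →₀ ℕ), (∀ s, (I s).degree ≤ s) ∧
      (Matrix.of fun s j => hD (I s) (f j)).det ≠ 0 := by
  have key : ∀ s ≤ k, ∃ I : Fin s → (Fin m →₀ ℕ), (∀ t, (I t).degree ≤ t) ∧
      LinearIndependent (MvPolynomial (Fin m) ℚ) (fun t => hrow f (I t)) := by
    intro s
    induction s with
    | zero => intro _; exact ⟨fun _ => 0, fun t => t.elim0, linearIndependent_empty_type⟩
    | succ s ih =>
      intro hs
      obtain ⟨I, hI, hli⟩ := ih (by omega)
      obtain ⟨J, hJ, hli'⟩ := wronskian_step f hf s (by omega) I hI hli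
      refine ⟨Fin.snoc I J, ?_, hli'⟩
      intro t
      refine Fin.lastCases ?_ (fun t => ?_) t
      · simpa using hJ
      · simpa using hI t
  obtain ⟨I, hI, hli⟩ := key k le_rfl
  refine ⟨I, hI, ?_⟩
  intro h0
  obtain ⟨v, hv, hv0⟩ := Matrix.exists_vecMul_eq_zero_iff.2 h0
  apply hv
  funext t
  refine Fintype.linearIndependent_iff.1 hli v ?_ t
  funext j
  have := congrFun hv0 j
  simpa [Matrix.vecMul, dotProduct, hrow] using this
end wr
end SST
end

section
namespace SST
open MvPolynomial

section pN
variable {R : Type*} [CommRing R] {σ : Type*} [Fintype σ] {τ : Type*} [Fintype τ]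

/-- value of the monomial `e` at `x` -/
def mev (x : σ → ℝ) (e : σ →₀ ℕ) : ℝ := ∏ i, x i ^ e i

lemma mev_add (x : σ → ℝ) (e d : σ →₀ ℕ) : mev x (e + d) = mev x e * mev x d := by
  simp [mev, pow_add, Finset.prod_mul_distrib]

lemma mev_zero (x : σ → ℝ) : mev x 0 = 1 := by simp [mev]

lemma mev_nonneg {x : σ → ℝ} (hx : ∀ i, 0 ≤ x i) (e : σ →₀ ℕ) : 0 ≤ mev x e :=
  Finset.prod_nonneg fun i _ => pow_nonneg (hx i) _

lemma mev_single (x : σ → ℝ) (i : σ) : mev x (Finsupp.single i 1) = x i := by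
  classical
  unfold mev
  rw [Finset.prod_eq_single i]
  · simp
  · intro b _ hb; rw [Finsupp.single_eq_of_ne hb]; simp
  · simp

/-- weighted ℓ1 norm of a polynomial -/
def pN (ν : RingSeminorm R) (x : σ → ℝ) (p : MvPolynomial σ R) : ℝ :=
  ∑ e ∈ p.support, ν (coeff e p) * mev x e

variable (ν : RingSeminorm R) (x : σ → ℝ)

lemma pN_eq_sum (p : MvPolynomial σ R) (S : Finset (σ →₀ ℕ)) (h : p.support ⊆ S) :
    pN ν x p = ∑ e ∈ S, ν (coeff e p) * mev x e := by
  refine Finset.sum_subset h fun e _ he => ?_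
  rw [notMem_support_iff.1 he, map_zero, zero_mul]

variable {x}

lemma pN_nonneg (hx : ∀ i, 0 ≤ x i) (p : MvPolynomial σ R) : 0 ≤ pN ν x p :=
  Finset.sum_nonneg fun e _ => mul_nonneg (apply_nonneg ν _) (mev_nonneg hx e)

lemma coeff_le_pN (hx : ∀ i, 0 ≤ x i) (p : MvPolynomial σ R) (e : σ →₀ ℕ) :
    ν (coeff e p) * mev x e ≤ pN ν x p := by
  by_cases he : e ∈ p.support
  · exact Finset.single_le_sum (f := fun e => ν (coeff e p) * mev x e)
      (fun e _ => mul_nonneg (apply_nonneg ν _) (mev_nonneg hx e)) he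
  · rw [notMem_support_iff.1 he, map_zero, zero_mul]; exact pN_nonneg ν hx p

lemma pN_add_le (hx : ∀ i, 0 ≤ x i) (p q : MvPolynomial σ R) : pN ν x (p + q) ≤ pN ν x p + pN ν x q := by
  classical
  rw [pN_eq_sum ν x p (p.support ∪ q.support) Finset.subset_union_left,
    pN_eq_sum ν x q (p.support ∪ q.support) Finset.subset_union_right,
    pN_eq_sum ν x (p + q) (p.support ∪ q.support) support_add, ← Finset.sum_add_distrib]
  refine Finset.sum_le_sum fun e _ => ?_
  rw [coeff_add, ← add_mul]
  exact mul_le_mul_of_nonneg_right (map_add_le_add ν _ _) (mev_nonneg hx e)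

lemma pN_zero : pN ν x (0 : MvPolynomial σ R) = 0 := by simp [pN]

lemma pN_sum_le (hx : ∀ i, 0 ≤ x i) {ι : Type*} (S : Finset ι) (f : ι → MvPolynomial σ R) :
    pN ν x (∑ i ∈ S, f i) ≤ ∑ i ∈ S, pN ν x (f i) := by
  classical
  induction S using Finset.induction_on with
  | empty => simp [pN_zero]
  | insert a S ha ih =>
    rw [Finset.sum_insert ha, Finset.sum_insert ha]
    exact (pN_add_le ν hx _ _).trans (by linarith)

lemma pN_monomial (e : σ →₀ ℕ) (c : R) : pN ν x (monomial e c) = ν c * mev x e := by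
  classical
  rw [pN_eq_sum ν x _ {e} support_monomial_subset]
  simp

lemma pN_monomial_mul_le (hx : ∀ i, 0 ≤ x i) (e : σ →₀ ℕ) (c : R) (q : MvPolynomial σ R) :
    pN ν x (monomial e c * q) ≤ ν c * mev x e * pN ν x q := by
  conv_lhs => rw [q.as_sum, Finset.mul_sum]
  refine (pN_sum_le ν hx _ _).trans ?_
  rw [pN, Finset.mul_sum]
  refine Finset.sum_le_sum fun d _ => ?_
  rw [monomial_mul, pN_monomial, mev_add]
  have := map_mul_le_mul ν c (coeff d q)
  have h1 := mul_nonneg (mev_nonneg hx e) (mev_nonneg hx d)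
  nlinarith [mul_le_mul_of_nonneg_right this h1]

lemma pN_mul_le (hx : ∀ i, 0 ≤ x i) (p q : MvPolynomial σ R) : pN ν x (p * q) ≤ pN ν x p * pN ν x q := by
  conv_lhs => rw [p.as_sum, Finset.sum_mul]
  refine (pN_sum_le ν hx _ _).trans ?_
  conv_rhs => rw [pN, Finset.sum_mul]
  exact Finset.sum_le_sum fun d _ => pN_monomial_mul_le ν hx _ _ _

lemma pN_C (c : R) : pN ν x (C c : MvPolynomial σ R) = ν c := by
  rw [← monomial_zero', pN_monomial, mev_zero, mul_one]

lemma pN_X (i : σ) : pN ν x (X i : MvPolynomial σ R) = ν 1 * x i := by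
  rw [X, pN_monomial, mev_single]

lemma pN_prod_le (hx : ∀ i, 0 ≤ x i) (h1 : ν 1 ≤ 1) {ι : Type*} (S : Finset ι) (f : ι → MvPolynomial σ R) :
    pN ν x (∏ i ∈ S, f i) ≤ ∏ i ∈ S, pN ν x (f i) := by
  classical
  induction S using Finset.induction_on with
  | empty => simp only [Finset.prod_empty]; rw [← C_1, pN_C]; exact h1
  | insert a S ha ih =>
    rw [Finset.prod_insert ha, Finset.prod_insert ha]
    exact (pN_mul_le ν hx _ _).trans (mul_le_mul_of_nonneg_left ih (pN_nonneg ν hx _))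

lemma pN_pow_le (hx : ∀ i, 0 ≤ x i) (h1 : ν 1 ≤ 1) (p : MvPolynomial σ R) (k : ℕ) :
    pN ν x (p ^ k) ≤ pN ν x p ^ k := by
  have := pN_prod_le ν hx h1 (Finset.range k) (fun _ => p)
  simpa using this

lemma pN_mono {x y : σ → ℝ} (hx : ∀ i, 0 ≤ x i) (hxy : ∀ i, x i ≤ y i) (p : MvPolynomial σ R) :
    pN ν x p ≤ pN ν y p :=
  Finset.sum_le_sum fun e _ => mul_le_mul_of_nonneg_left
    (Finset.prod_le_prod (fun i _ => pow_nonneg (hx i) _)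
      (fun i _ => pow_le_pow_left₀ (hx i) (hxy i) _)) (apply_nonneg ν _)

lemma pN_aeval_le (hx : ∀ i, 0 ≤ x i) (h1 : ν 1 ≤ 1) (g : τ → MvPolynomial σ R) (p : MvPolynomial τ R) :
    pN ν x (aeval g p) ≤ pN ν (fun i => pN ν x (g i)) p := by
  conv_lhs => rw [p.as_sum, map_sum]
  refine (pN_sum_le ν hx _ _).trans ?_
  rw [pN]
  refine Finset.sum_le_sum fun d _ => ?_
  rw [aeval_monomial]
  refine (pN_mul_le ν hx _ _).trans ?_
  rw [algebraMap_eq, pN_C]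
  refine mul_le_mul_of_nonneg_left ?_ (apply_nonneg ν _)
  rw [Finsupp.prod_fintype _ _ (by simp)]
  refine (pN_prod_le ν hx h1 _ _).trans ?_
  exact Finset.prod_le_prod (fun i _ => pN_nonneg ν hx _) fun i _ => pN_pow_le ν hx h1 _ _

lemma pN_det_le (hx : ∀ i, 0 ≤ x i) (h1 : ν 1 ≤ 1) {k : ℕ} (A : Matrix (Fin k) (Fin k) (MvPolynomial σ R)) (H : ℝ)
    (hA : ∀ i j, pN ν x (A i j) ≤ H) : pN ν x A.det ≤ ((k : ℝ) * H) ^ k := by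
  rw [Matrix.det_apply]
  refine (pN_sum_le ν hx _ _).trans ?_
  have h2 : ∀ s : Equiv.Perm (Fin k), pN ν x (Equiv.Perm.sign s • ∏ i, A (s i) i) ≤ H ^ k := by
    intro s
    have h3 : pN ν x (Equiv.Perm.sign s • ∏ i, A (s i) i) = pN ν x (∏ i, A (s i) i) := by
      rcases Int.units_eq_one_or (Equiv.Perm.sign s) with h | h
      · rw [h, one_smul]
      · rw [h, Units.neg_smul, one_smul]
        simp [pN, support_neg, coeff_neg]
    rw [h3]
    refine (pN_prod_le ν hx h1 _ _).trans ?_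
    calc ∏ i, pN ν x (A (s i) i) ≤ ∏ i : Fin k, H :=
          Finset.prod_le_prod (fun i _ => pN_nonneg ν hx _) fun i _ => hA _ _
      _ = H ^ k := by simp
  by_cases hk : k = 0
  · subst hk
    calc _ ≤ ∑ s : Equiv.Perm (Fin 0), H ^ 0 := Finset.sum_le_sum fun s _ => h2 s
      _ = _ := by simp
  have hH : 0 ≤ H := (pN_nonneg ν hx _).trans (hA ⟨0, by omega⟩ ⟨0, by omega⟩)
  calc _ ≤ ∑ s : Equiv.Perm (Fin k), H ^ k := Finset.sum_le_sum fun s _ => h2 s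
    _ = (Nat.factorial k : ℝ) * H ^ k := by
      simp [Fintype.card_perm]
    _ ≤ (k : ℝ) ^ k * H ^ k := by
      refine mul_le_mul_of_nonneg_right ?_ (pow_nonneg hH _)
      exact_mod_cast Nat.factorial_le_pow k
    _ = _ := by rw [mul_pow]

end pN
end SST
end

section
namespace SST
open MvPolynomial

section tens
variable {R : Type*} [CommRing R] {m : ℕ}

/-- product of a polynomial in the variable 0 and one in the other variables -/
def tens (ψ : MvPolynomial (Fin 1) R) (φ : MvPolynomial (Fin m) R) : MvPolynomial (Fin (m+1)) R :=
  rename (fun _ => 0) ψ * rename Fin.succ φ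

lemma mapDomain_cons (b : Fin 1 →₀ ℕ) (e : Fin m →₀ ℕ) :
    b.mapDomain (fun _ => (0 : Fin (m+1))) + e.mapDomain Fin.succ = Finsupp.cons (b 0) e := by
  have hb : b = Finsupp.single 0 (b 0) := by
    refine Finsupp.ext fun i => ?_; rw [Subsingleton.elim i 0]; simp
  ext i
  refine Fin.cases ?_ (fun i => ?_) i
  · rw [hb, Finsupp.mapDomain_single]
    have : (e.mapDomain Fin.succ) (0 : Fin (m+1)) = 0 :=
      Finsupp.mapDomain_of_notMem_range _ _ (by simp)
    simp [this]
  · rw [hb, Finsupp.mapDomain_single]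
    have : (e.mapDomain Fin.succ) i.succ = e i :=
      Finsupp.mapDomain_apply (Fin.succ_injective m) _ _
    simp [this]

lemma coeff_tens (ψ : MvPolynomial (Fin 1) R) (φ : MvPolynomial (Fin m) R) (d : Fin (m+1) →₀ ℕ) :
    coeff d (tens ψ φ) = coeff (Finsupp.single 0 (d 0)) ψ * coeff d.tail φ := by
  classical
  induction ψ using MvPolynomial.induction_on' with
  | add p q hp hq => rw [tens, map_add, add_mul, coeff_add, ← tens, ← tens, hp, hq, coeff_add, add_mul]
  | monomial b c =>
    induction φ using MvPolynomial.induction_on' with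
    | add p q hp hq => rw [tens, map_add, mul_add, coeff_add, ← tens, ← tens, hp, hq, coeff_add, mul_add]
    | monomial e a =>
      rw [tens, rename_monomial, rename_monomial, monomial_mul, mapDomain_cons, coeff_monomial,
        coeff_monomial, coeff_monomial]
      have h1 : (b = Finsupp.single 0 (d 0)) ↔ b 0 = d 0 := by
        constructor
        · intro h; rw [h]; simp
        · intro h; refine Finsupp.ext fun i => ?_; rw [Subsingleton.elim i 0]; simp [h]
      have h2 : (Finsupp.cons (b 0) e = d) ↔ (b 0 = d 0 ∧ e = d.tail) := by
        constructor
        · rintro rfl; simp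
        · rintro ⟨h, rfl⟩; rw [h, Finsupp.cons_tail]
      simp only [h1, h2]
      by_cases h3 : b 0 = d 0 <;> by_cases h4 : e = d.tail <;> simp [h3, h4]

lemma hD_tens (J : Fin 1 →₀ ℕ) (I : Fin m →₀ ℕ) (ψ : MvPolynomial (Fin 1) R)
    (φ : MvPolynomial (Fin m) R) :
    hD (Finsupp.cons (J 0) I) (tens ψ φ) = tens (hD J ψ) (hD I φ) := by
  ext d
  rw [coeff_hD, coeff_tens, coeff_tens, coeff_hD, coeff_hD]
  have h1 : (d + Finsupp.cons (J 0) I).tail = d.tail + I := by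
    ext i; simp [Finsupp.tail_apply]
  have h2 : Finsupp.single 0 ((d + Finsupp.cons (J 0) I) 0) = Finsupp.single 0 (d 0) + J := by
    refine Finsupp.ext fun i => ?_; rw [Subsingleton.elim i 0]; simp
  have h3 : mbin (d + Finsupp.cons (J 0) I) (Finsupp.cons (J 0) I) =
      mbin (Finsupp.single 0 (d 0) + J) J * mbin (d.tail + I) I := by
    simp [mbin, Fin.prod_univ_succ, Finsupp.tail_apply]
  rw [h1, h2, h3]
  push_cast; ring

lemma shift_tens (ξ : Fin (m+1) → R) (ψ : MvPolynomial (Fin 1) R) (φ : MvPolynomial (Fin m) R) :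
    shift ξ (tens ψ φ) = tens (shift (fun _ => ξ 0) ψ) (shift (fun h => ξ h.succ) φ) := by
  rw [tens, tens, map_mul]
  congr 1
  · have : (shift ξ).comp (rename (fun _ : Fin 1 => (0 : Fin (m+1)))) =
      (rename (fun _ : Fin 1 => (0 : Fin (m+1)))).comp (shift (fun _ => ξ 0)) := by
      ext i; simp [shift]
    exact congrArg (fun g => g ψ) this
  · have : (shift ξ).comp (rename Fin.succ) =
      (rename Fin.succ).comp (shift (fun h => ξ h.succ)) := by
      ext i; simp [shift]
    exact congrArg (fun g => g φ) this

end tens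

section index
variable {m : ℕ} (r : Fin m → ℕ)

/-- weighted degree of exponent -/
def wt (e : Fin m →₀ ℕ) : ℝ := ∑ h, (e h : ℝ) / r h

lemma wt_add (e d : Fin m →₀ ℕ) : wt r (e + d) = wt r e + wt r d := by
  simp [wt, add_div, Finset.sum_add_distrib]

lemma wt_nonneg (e : Fin m →₀ ℕ) : 0 ≤ wt r e :=
  Finset.sum_nonneg fun _ _ => by positivity

variable {R : Type*} [CommRing R]
/-- all monomials have weight at least θ -/
def ge (g : MvPolynomial (Fin m) R) (θ : ℝ) : Prop := ∀ e ∈ g.support, θ ≤ wt r e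

variable {r}
lemma ge_nonpos (g : MvPolynomial (Fin m) R) {θ : ℝ} (h : θ ≤ 0) : ge r g θ :=
  fun e _ => h.trans (wt_nonneg r e)

lemma ge.add {f g : MvPolynomial (Fin m) R} {θ : ℝ} (hf : ge r f θ) (hg : ge r g θ) :
    ge r (f + g) θ := by
  classical
  intro e he
  rcases Finset.mem_union.1 (support_add he) with h | h
  · exact hf e h
  · exact hg e h

lemma ge.sum {ι : Type*} (S : Finset ι) {f : ι → MvPolynomial (Fin m) R} {θ : ℝ}
    (hf : ∀ i ∈ S, ge r (f i) θ) : ge r (∑ i ∈ S, f i) θ := by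
  classical
  induction S using Finset.induction_on with
  | empty => intro e he; simp at he
  | insert a S ha ih =>
    rw [Finset.sum_insert ha]
    exact (hf a (Finset.mem_insert_self _ _)).add (ih fun i hi => hf i (Finset.mem_insert_of_mem hi))

lemma ge.mul {f g : MvPolynomial (Fin m) R} {θ η : ℝ} (hf : ge r f θ) (hg : ge r g η) :
    ge r (f * g) (θ + η) := by
  classical
  intro e he
  obtain ⟨a, ha, b, hb, rfl⟩ := Finset.mem_add.1 (support_mul f g he)
  rw [wt_add]
  exact add_le_add (hf a ha) (hg b hb)

lemma ge.prod {ι : Type*} (S : Finset ι) {f : ι → MvPolynomial (Fin m) R} {θ : ι → ℝ}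
    (hf : ∀ i ∈ S, ge r (f i) (θ i)) : ge r (∏ i ∈ S, f i) (∑ i ∈ S, θ i) := by
  classical
  induction S using Finset.induction_on with
  | empty => exact ge_nonpos _ (by simp)
  | insert a S ha ih =>
    rw [Finset.prod_insert ha, Finset.sum_insert ha]
    exact (hf a (Finset.mem_insert_self _ _)).mul (ih fun i hi => hf i (Finset.mem_insert_of_mem hi))

lemma ge.det {k : ℕ} {A : Matrix (Fin k) (Fin k) (MvPolynomial (Fin m) R)} {θ : Fin k → ℝ}
    (hA : ∀ i j, ge r (A i j) (θ i)) : ge r A.det (∑ i, θ i) := by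
  rw [Matrix.det_apply]
  refine ge.sum _ fun s _ => ?_
  have h : ge r (∏ i, A (s i) i) (∑ i, θ i) := by
    rw [← Equiv.sum_comp s θ]
    exact ge.prod _ fun i _ => hA _ _
  rcases Int.units_eq_one_or (Equiv.Perm.sign s) with h' | h'
  · rw [h', one_smul]; exact h
  · rw [h', Units.neg_smul, one_smul]
    intro e he; exact h e (by simpa [support_neg] using he)

lemma ge.hD {f : MvPolynomial (Fin m) R} {θ : ℝ} (hf : ge r f θ) (I : Fin m →₀ ℕ) :
    ge r (hD I f) (θ - wt r I) := by
  intro e he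
  rw [mem_support_iff, coeff_hD] at he
  have := hf (e + I) (mem_support_iff.2 (right_ne_zero_of_mul he))
  rw [wt_add] at this
  linarith

end index

section onevar
open Polynomial in
lemma int_pow_dvd_lead (g : ℤ[X]) (hg : g ≠ 0) (p q : ℤ) (hpq : IsCoprime p q) (hq : q ≠ 0) (l : ℕ)
    (h : (Polynomial.X - Polynomial.C ((p : ℚ) / q)) ^ l ∣ g.map (Int.castRingHom ℚ)) :
    q ^ l ∣ g.leadingCoeff := by
  have hprim : (Polynomial.C q * Polynomial.X - Polynomial.C p : ℤ[X]).IsPrimitive := by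
    intro c hc
    have h1 : c ∣ q := by
      have := (Polynomial.C_dvd_iff_dvd_coeff _ _).1 hc 1
      simpa [Polynomial.coeff_C, -map_intCast, -eq_intCast] using this
    have h0 : c ∣ p := by
      have := (Polynomial.C_dvd_iff_dvd_coeff _ _).1 hc 0
      simpa using this
    exact hpq.isUnit_of_dvd' h0 h1
  have hprim2 : ((Polynomial.C q * Polynomial.X - Polynomial.C p : ℤ[X])^l).IsPrimitive := by
    induction l with
    | zero => rw [pow_zero]; exact Polynomial.isPrimitive_one
    | succ l ih =>
      rw [pow_succ]; exact (ih ((pow_dvd_pow _ l.le_succ).trans h)).mul hprim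
  have hd : ((Polynomial.C q * Polynomial.X - Polynomial.C p : ℤ[X])^l) ∣ g := by
    apply (Polynomial.IsPrimitive.Int.dvd_iff_map_cast_dvd_map_cast _ _ hprim2).2
    have hq' : (q : ℚ) ≠ 0 := by exact_mod_cast hq
    have e1 : Polynomial.map (Int.castRingHom ℚ) ((Polynomial.C q * Polynomial.X - Polynomial.C p)^l) =
        Polynomial.C ((q : ℚ)^l) * (Polynomial.X - Polynomial.C ((p : ℚ) / q)) ^ l := by
      rw [Polynomial.map_pow, Polynomial.C_pow, ← mul_pow]
      congr 1
      rw [mul_sub, ← Polynomial.C_mul, mul_div_cancel₀ _ hq']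
      simp
    rw [e1]
    have hu : IsUnit (Polynomial.C ((q : ℚ)^l)) := Polynomial.isUnit_C.2 (IsUnit.mk0 _ (pow_ne_zero _ hq'))
    rw [hu.mul_left_dvd]
    exact h
  have := Polynomial.leadingCoeff_dvd_leadingCoeff hd
  rw [Polynomial.leadingCoeff_pow] at this
  have h3 : (Polynomial.C q * Polynomial.X - Polynomial.C p : ℤ[X]).leadingCoeff = q := by
    have : (Polynomial.C q * Polynomial.X - Polynomial.C p : ℤ[X]) =
      Polynomial.C q * Polynomial.X + Polynomial.C (-p) := by simp [sub_eq_add_neg]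
    rw [this, Polynomial.leadingCoeff_linear hq]
  rwa [h3] at this

lemma coeff_toPoly {R : Type*} [CommRing R] (g : MvPolynomial (Fin 1) R) (d : ℕ) :
    (aeval (fun _ => (Polynomial.X : Polynomial R)) g).coeff d = coeff (Finsupp.single 0 d) g := by
  classical
  induction g using MvPolynomial.induction_on' with
  | add p q hp hq => rw [map_add, Polynomial.coeff_add, hp, hq, coeff_add]
  | monomial b c =>
    rw [aeval_monomial, coeff_monomial, Finsupp.prod_fintype _ _ (by simp)]
    simp only [Fin.prod_univ_one, Polynomial.algebraMap_eq, Polynomial.coeff_C_mul,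
      Polynomial.coeff_X_pow]
    have h1 : (b = Finsupp.single 0 d) ↔ d = b 0 := by
      constructor
      · intro h; rw [h]; simp
      · intro h; refine Finsupp.ext fun i => ?_; rw [Subsingleton.elim i 0]; simp [h]
    simp only [h1]
    by_cases h : d = b 0 <;> simp [h]

lemma onevar (g : MvPolynomial (Fin 1) ℤ) (hg : g ≠ 0) (p q : ℤ) (hpq : IsCoprime p q) (hq : 0 < q)
    (H : ℝ) (hH : ∀ e, |((coeff e g : ℤ) : ℝ)| ≤ H) :
    ∃ e ∈ (shift (fun _ => (p : ℚ)/q) (map (Int.castRingHom ℚ) g)).support, (q : ℝ) ^ (e 0) ≤ H := by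
  set gs := shift (fun _ => (p : ℚ)/q) (map (Int.castRingHom ℚ) g) with hgs
  have hinj : Function.Injective (map (σ := Fin 1) (Int.castRingHom ℚ)) :=
    map_injective _ (RingHom.injective_int _)
  have hne : gs ≠ 0 := by
    intro h
    apply hg
    apply hinj
    apply shift_injective (fun _ => (p : ℚ)/q)
    rw [← hgs, h, map_zero, map_zero]
  obtain ⟨e, he, hmin⟩ := Finset.exists_min_image gs.support (fun e => e 0) (support_nonempty.2 hne)
  refine ⟨e, he, ?_⟩
  set φ := aeval (R := ℚ) (fun _ : Fin 1 => (Polynomial.X : Polynomial ℚ))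
  have h1 : Polynomial.X ^ (e 0) ∣ φ gs := by
    rw [Polynomial.X_pow_dvd_iff]
    intro d hd
    rw [coeff_toPoly]
    by_contra hc
    have := hmin _ (mem_support_iff.2 hc)
    simp at this
    omega
  have h2 : (φ gs).comp (Polynomial.X - Polynomial.C ((p : ℚ)/q)) = φ (map (Int.castRingHom ℚ) g) := by
    have e1 : φ gs = (φ (map (Int.castRingHom ℚ) g)).comp (Polynomial.X + Polynomial.C ((p : ℚ)/q)) := by
      have : φ.comp (shift (fun _ => (p : ℚ)/q)) =
          (Polynomial.compRingHom (Polynomial.X + Polynomial.C ((p : ℚ)/q)) |>.toAddMonoidHom,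
            ((Polynomial.aeval (Polynomial.X + Polynomial.C ((p : ℚ)/q)))).comp φ).2 := by
        ext i; simp [shift, φ]
      have := congrArg (fun F => F (map (Int.castRingHom ℚ) g)) this
      simpa [Polynomial.comp, Polynomial.aeval_def, Polynomial.algebraMap_eq] using this
    rw [e1, Polynomial.comp_assoc]; simp
  have h3 : (Polynomial.X - Polynomial.C ((p : ℚ)/q)) ^ (e 0) ∣ φ (map (Int.castRingHom ℚ) g) := by
    rw [← h2]
    obtain ⟨c, hc⟩ := h1
    rw [hc]; simp
  set G := aeval (R := ℤ) (fun _ : Fin 1 => (Polynomial.X : Polynomial ℤ)) g with hG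
  have h4 : φ (map (Int.castRingHom ℚ) g) = G.map (Int.castRingHom ℚ) := by
    ext d
    rw [coeff_toPoly, Polynomial.coeff_map, coeff_toPoly, coeff_map]
  have hG0 : G ≠ 0 := by
    intro h
    apply hg
    ext d
    have hd : d = Finsupp.single 0 (d 0) := by
      refine Finsupp.ext fun i => ?_; rw [Subsingleton.elim i 0]; simp
    rw [hd, ← coeff_toPoly, ← hG, h]; simp
  rw [h4] at h3
  have h5 := int_pow_dvd_lead G hG0 p q hpq hq.ne' _ h3
  have h6 := Int.le_of_dvd (abs_pos.2 (Polynomial.leadingCoeff_ne_zero.2 hG0)) ((dvd_abs _ _).2 h5)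
  have h7 := hH (Finsupp.single 0 G.natDegree)
  rw [← coeff_toPoly, ← hG] at h7
  refine le_trans ?_ h7
  rw [Polynomial.leadingCoeff] at h6
  exact_mod_cast h6

end onevar
end SST
end

section
namespace SST
open MvPolynomial

/-- absolute value on ℤ as ring seminorm -/
def nuZ : RingSeminorm ℤ := normRingSeminorm ℤ

lemma nuZ_apply (a : ℤ) : nuZ a = |(a : ℝ)| := by
  show ‖a‖ = _
  rw [Int.norm_eq_abs]

lemma nuZ_one : nuZ 1 ≤ 1 := by rw [nuZ_apply]; simp

lemma mev_one {σ : Type*} [Fintype σ] (e : σ →₀ ℕ) : mev (fun _ : σ => (1:ℝ)) e = 1 := by simp [mev]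

lemma card_support_le {m : ℕ} {R : Type*} [CommRing R] (f : MvPolynomial (Fin m) R) (r : Fin m → ℕ)
    (hr : ∀ h, f.degreeOf h ≤ r h) : (f.support.card : ℝ) ≤ 2 ^ (∑ h, r h) := by
  classical
  have h1 : f.support ⊆ Finset.Iic (Finsupp.equivFunOnFinite.symm r) := by
    intro e he
    rw [Finset.mem_Iic]
    intro h
    exact (degreeOf_le_iff.1 (hr h)) e he
  have h2 : (Finset.Iic (Finsupp.equivFunOnFinite.symm r)).card ≤ 2 ^ (∑ h, r h) := by
    rw [Finsupp.card_Iic, ← Finset.prod_pow_eq_pow_sum]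
    refine (Finset.prod_le_prod_of_subset_of_one_le' (Finset.subset_univ _) ?_).trans ?_
    · intro i _ _; simp
    · refine Finset.prod_le_prod' fun i _ => ?_
      simp only [Finsupp.equivFunOnFinite_symm_apply_apply, Nat.card_Iic]
      exact Nat.lt_two_pow_self
  exact_mod_cast (Finset.card_le_card h1).trans h2

lemma mbin_le {m : ℕ} (e I : Fin m →₀ ℕ) (r : Fin m → ℕ) (h : ∀ i, e i ≤ r i) :
    mbin e I ≤ 2 ^ (∑ h, r h) := by
  rw [← Finset.prod_pow_eq_pow_sum]
  refine Finset.prod_le_prod' fun i _ => ?_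
  exact (Nat.choose_le_two_pow _ _).trans (Nat.pow_le_pow_right (by norm_num) (h i))

lemma pN_hD_le {m : ℕ} (f : MvPolynomial (Fin m) ℤ) (r : Fin m → ℕ)
    (hr : ∀ h, f.degreeOf h ≤ r h) (H : ℝ) (hH : ∀ e, |((coeff e f : ℤ) : ℝ)| ≤ H) (I : Fin m →₀ ℕ) :
    pN nuZ (fun _ => 1) (hD I f) ≤ 4 ^ (∑ h, r h) * H := by
  have hH0 : 0 ≤ H := (abs_nonneg _).trans (hH 0)
  conv_lhs => rw [f.as_sum, map_sum]
  refine (pN_sum_le nuZ (fun _ => zero_le_one) _ _).trans ?_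
  have h1 : ∀ e ∈ f.support, pN nuZ (fun _ => (1:ℝ)) (hD I (monomial e (coeff e f))) ≤
      H * 2 ^ (∑ h, r h) := by
    intro e he
    rw [hD_monomial, pN_monomial, mev_one, mul_one, nuZ_apply]
    push_cast
    rw [abs_mul]
    refine mul_le_mul (hH e) ?_ (abs_nonneg _) hH0
    rw [abs_of_nonneg (by positivity)]
    exact_mod_cast mbin_le e I r fun i => degreeOf_le_iff.1 (hr i) e he
  refine (Finset.sum_le_sum h1).trans ?_
  rw [Finset.sum_const, nsmul_eq_mul]
  calc (f.support.card : ℝ) * (H * 2 ^ (∑ h, r h)) ≤ 2 ^ (∑ h, r h) * (H * 2 ^ (∑ h, r h)) :=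
        mul_le_mul_of_nonneg_right (card_support_le f r hr) (by positivity)
    _ = 4 ^ (∑ h, r h) * H := by
      rw [show (4:ℝ) = 2 * 2 by norm_num, mul_pow]; ring

/-- coefficient with respect to variable 0 -/
def fc {m : ℕ} {R : Type*} [CommRing R] (f : MvPolynomial (Fin (m+1)) R) (b : ℕ) :
  MvPolynomial (Fin m) R := (finSuccEquiv R m f).coeff b

lemma coeff_fc {m : ℕ} {R : Type*} [CommRing R] (f : MvPolynomial (Fin (m+1)) R) (b : ℕ) (e) :
    coeff e (fc f b) = coeff (Finsupp.cons b e) f := finSuccEquiv_coeff_coeff _ _ _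

lemma degreeOf_hD_le {m : ℕ} {R : Type*} [CommRing R] (f : MvPolynomial (Fin m) R) (I h) (r : ℕ)
    (hr : f.degreeOf h ≤ r) : (hD I f).degreeOf h ≤ r := by
  rw [degreeOf_le_iff] at *
  intro e he
  rw [mem_support_iff, coeff_hD] at he
  have := hr (e + I) (mem_support_iff.2 (right_ne_zero_of_mul he))
  simp at this; omega

lemma degreeOf_fc_le {m : ℕ} {R : Type*} [CommRing R] (f : MvPolynomial (Fin (m+1)) R) (b h) (r : ℕ)
    (hr : f.degreeOf h.succ ≤ r) : (fc f b).degreeOf h ≤ r := by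
  rw [degreeOf_le_iff] at *
  intro e he
  rw [mem_support_iff, coeff_fc] at he
  have := hr _ (mem_support_iff.2 he)
  simpa using this

lemma degreeOf_det_le {m k : ℕ} {R : Type*} [CommRing R] [Nontrivial R]
    (A : Matrix (Fin k) (Fin k) (MvPolynomial (Fin m) R)) (h) (r : ℕ)
    (hr : ∀ i j, (A i j).degreeOf h ≤ r) : A.det.degreeOf h ≤ k * r := by
  rw [Matrix.det_apply]
  refine (degreeOf_sum_le _ _ _).trans (Finset.sup_le fun s _ => ?_)
  have h1 : (∏ i, A (s i) i).degreeOf h ≤ k * r := by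
    refine (degreeOf_prod_le _ _ _).trans ?_
    refine (Finset.sum_le_sum fun i _ => hr (s i) i).trans ?_
    simp
  rcases Int.units_eq_one_or (Equiv.Perm.sign s) with h' | h'
  · rw [h', one_smul]; exact h1
  · rw [h', Units.neg_smul, one_smul]
    rw [degreeOf_le_iff] at *
    intro e he; exact h1 e (by simpa [support_neg] using he)

lemma map_hD {m : ℕ} (f : MvPolynomial (Fin m) ℤ) (I) :
    map (Int.castRingHom ℚ) (hD I f) = hD I (map (Int.castRingHom ℚ) f) := by
  ext d; simp [coeff_map, coeff_hD]

lemma decomp {m : ℕ} (f : MvPolynomial (Fin (m+1)) ℤ) (hf : f ≠ 0) (r0 : ℕ)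
    (hr : f.degreeOf 0 ≤ r0) : ∃ (k : ℕ) (a : Fin k → ℕ) (ψ : Fin k → MvPolynomial (Fin 1) ℚ),
      0 < k ∧ k ≤ r0 + 1 ∧ LinearIndependent ℚ ψ ∧
      LinearIndependent ℚ (fun i => map (Int.castRingHom ℚ) (fc f (a i))) ∧
      map (Int.castRingHom ℚ) f = ∑ i, tens (ψ i) (map (Int.castRingHom ℚ) (fc f (a i))) := by
  classical
  obtain ⟨κ, a, ha, hspan, hli⟩ := exists_linearIndependent' ℚ
    (fun b : Fin (r0 + 1) => map (Int.castRingHom ℚ) (fc f b))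
  haveI : Finite κ := Finite.of_injective a ha
  haveI : Fintype κ := Fintype.ofFinite κ
  let E := Fintype.equivFin κ
  let φ : Fin (Fintype.card κ) → MvPolynomial (Fin m) ℚ :=
    fun i => map (Int.castRingHom ℚ) (fc f (a (E.symm i)))
  have hφ : LinearIndependent ℚ φ := hli.comp E.symm E.symm.injective
  have hex : ∀ b : Fin (r0+1), ∃ c : Fin (Fintype.card κ) → ℚ,
      ∑ i, c i • φ i = map (Int.castRingHom ℚ) (fc f b) := by
    intro b
    rw [← Submodule.mem_span_range_iff_exists_fun ℚ]
    have h1 : map (Int.castRingHom ℚ) (fc f b) ∈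
      Submodule.span ℚ (range fun b : Fin (r0 + 1) => map (Int.castRingHom ℚ) (fc f b)) :=
      Submodule.subset_span ⟨b, rfl⟩
    rw [← hspan] at h1
    refine Submodule.span_mono ?_ h1
    rintro _ ⟨x, rfl⟩
    exact ⟨E x, by simp [φ]⟩
  choose c hc using hex
  let ψ : Fin (Fintype.card κ) → MvPolynomial (Fin 1) ℚ :=
    fun i => ∑ b : Fin (r0+1), monomial (Finsupp.single 0 (b : ℕ)) (c b i)
  have hψ : ∀ i (b : Fin (r0+1)), coeff (Finsupp.single 0 (b : ℕ)) (ψ i) = c b i := by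
    intro i b
    simp only [ψ, coeff_sum, coeff_monomial]
    rw [Finset.sum_eq_single b]
    · simp
    · intro b' _ hb'
      rw [if_neg]
      intro h
      exact hb' (Fin.ext (Finsupp.single_injective _ h))
    · simp
  have hψ' : ∀ i (b : ℕ), r0 < b → coeff (Finsupp.single 0 b) (ψ i) = 0 := by
    intro i b hb
    simp only [ψ, coeff_sum, coeff_monomial]
    refine Finset.sum_eq_zero fun b' _ => ?_
    rw [if_neg]
    intro h
    have := Finsupp.single_injective _ h
    have := b'.2
    omega
  have hδ : ∀ i j, c (a (E.symm j)) i = if i = j then 1 else 0 := by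
    intro i j
    have h1 := hc (a (E.symm j))
    have h2 : ∑ i, (c (a (E.symm j)) i - if i = j then 1 else 0) • φ i = 0 := by
      simp only [sub_smul, Finset.sum_sub_distrib, h1]
      simp [φ]
    have := Fintype.linearIndependent_iff.1 hφ _ h2 i
    linarith
  have hdec : map (Int.castRingHom ℚ) f = ∑ i, tens (ψ i) (φ i) := by
    ext d
    rw [coeff_sum]
    simp only [coeff_tens]
    by_cases hd : d 0 ≤ r0
    · have h1 := hc ⟨d 0, by omega⟩
      have h2 := congrArg (coeff d.tail) h1
      rw [coeff_sum] at h2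
      simp only [coeff_smul, smul_eq_mul] at h2
      rw [coeff_map, coeff_fc] at h2
      simp only [Finsupp.cons_tail] at h2
      rw [coeff_map, ← h2]
      refine Finset.sum_congr rfl fun i _ => ?_
      rw [← hψ]
    · rw [Finset.sum_eq_zero]
      · rw [coeff_map, notMem_support_iff.1, map_zero]
        intro h
        exact hd (degreeOf_le_iff.1 hr d h)
      · intro i _
        rw [hψ' _ _ (by omega), zero_mul]
  refine ⟨Fintype.card κ, fun i => a (E.symm i), ψ, ?_, ?_, ?_, hφ, hdec⟩
  · rw [Nat.pos_iff_ne_zero]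
    intro h0
    apply hf
    apply map_injective _ (RingHom.injective_int (Int.castRingHom ℚ))
    rw [hdec, map_zero]
    refine Finset.sum_eq_zero fun i _ => ?_
    have := i.2; omega
  · simpa using Fintype.card_le_of_injective a ha
  · rw [Fintype.linearIndependent_iff]
    intro g hg j
    have h1 := congrArg (coeff (Finsupp.single 0 ((a (E.symm j) : Fin (r0+1)) : ℕ))) hg
    rw [coeff_sum] at h1
    simp only [coeff_smul, hψ, hδ] at h1
    simpa using h1

lemma sum_max_ge (σ : ℝ) (h0 : 0 < σ) (h1 : σ ≤ 1) (r k : ℕ) (hr : 0 < r) (hk : 0 < k) (hkr : k ≤ r + 1) :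
    k * σ ^ 2 / 8 ≤ ∑ s : Fin k, max 0 (σ - (s : ℕ) / r) := by
  rw [Fin.sum_univ_eq_sum_range (fun s : ℕ => max 0 (σ - (s : ℝ) / r)) k]
  have hr' : (0:ℝ) < r := by exact_mod_cast hr
  set n0 := ⌊σ * r / 2⌋₊ with hn0
  have hf1 : σ * r / 2 < n0 + 1 := Nat.lt_floor_add_one _
  have hf2 : (n0 : ℝ) ≤ σ * r / 2 := Nat.floor_le (by positivity)
  have hsub : Finset.range (min k (n0+1)) ⊆ Finset.range k :=
    Finset.range_mono (min_le_left _ _)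
  refine le_trans ?_ (Finset.sum_le_sum_of_subset_of_nonneg hsub fun _ _ _ => le_max_left _ _)
  have h2 : ∀ s ∈ Finset.range (min k (n0+1)), σ / 2 ≤ max 0 (σ - (s : ℝ) / r) := by
    intro s hs
    refine le_trans ?_ (le_max_right _ _)
    have : s < n0 + 1 := (Finset.mem_range.1 hs).trans_le (min_le_right _ _)
    have : (s : ℝ) ≤ n0 := by exact_mod_cast Nat.lt_succ_iff.1 this
    have : (s : ℝ) / r ≤ σ / 2 := by rw [div_le_iff₀ hr']; linarith
    linarith
  have h3 := Finset.sum_le_sum h2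
  rw [Finset.sum_const, Finset.card_range, nsmul_eq_mul] at h3
  refine le_trans ?_ h3
  have h4 : (k : ℝ) * σ / 4 ≤ ((min k (n0+1) : ℕ) : ℝ) := by
    push_cast
    have hk1 : (1:ℝ) ≤ k := by exact_mod_cast hk
    have hkr' : (k : ℝ) ≤ r + 1 := by exact_mod_cast hkr
    refine le_min (by nlinarith) ?_
    rcases Nat.lt_or_ge 1 k with h | h
    · have : (2:ℝ) ≤ k := by exact_mod_cast h
      have : (k:ℝ)/2 ≤ r := by linarith
      nlinarith
    · have : (k:ℝ) ≤ 1 := by exact_mod_cast h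
      have : (0:ℝ) ≤ n0 := by positivity
      nlinarith
  nlinarith
end SST
end

section
namespace SST
open MvPolynomial

/-- rational point -/
def rpt {m : ℕ} (p : Fin m → ℤ) (q : Fin m → ℤ) : Fin m → ℚ := fun h => (p h : ℚ) / q h

lemma eight_le : (8:ℝ) ≤ Real.exp 3 := by
  have := Real.add_one_le_exp (1:ℝ)
  have h : Real.exp 3 = Real.exp 1 ^ 3 := by rw [← Real.exp_nat_mul]; norm_num
  rw [h]
  have : (2:ℝ) ^ 3 ≤ Real.exp 1 ^ 3 := pow_le_pow_left₀ (by norm_num) (by linarith) 3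
  linarith

lemma det_bound {m k : ℕ} (A : Matrix (Fin k) (Fin k) (MvPolynomial (Fin m) ℤ)) (S r0 : ℕ) (B : ℝ)
    (hk : k ≤ r0 + 1) (hS : r0 ≤ S)
    (hA : ∀ i j, pN nuZ (fun _ => 1) (A i j) ≤ 4 ^ S * Real.exp B) (e) :
    |((coeff e A.det : ℤ) : ℝ)| ≤ Real.exp (k * (B + 3 * S)) := by
  have h1 := pN_det_le nuZ (fun _ => zero_le_one) nuZ_one A _ hA
  have h2 := coeff_le_pN nuZ (x := fun _ => (1:ℝ)) (fun _ => zero_le_one) A.det e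
  rw [mev_one, mul_one, nuZ_apply] at h2
  refine (h2.trans h1).trans ?_
  rw [Real.exp_nat_mul]
  refine pow_le_pow_left₀ (by positivity) ?_ k
  have h3 : (k : ℝ) ≤ 2 ^ S := by
    have : k ≤ 2 ^ S := by
      have : S < 2 ^ S := Nat.lt_two_pow_self
      omega
    exact_mod_cast this
  calc (k : ℝ) * (4 ^ S * Real.exp B) ≤ 2 ^ S * (4 ^ S * Real.exp B) :=
        mul_le_mul_of_nonneg_right h3 (by positivity)
    _ = 8 ^ S * Real.exp B := by rw [show (8:ℝ) = 2 * 4 by norm_num, mul_pow]; ring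
    _ ≤ Real.exp 3 ^ S * Real.exp B :=
        mul_le_mul_of_nonneg_right (pow_le_pow_left₀ (by norm_num) eight_le S) (by positivity)
    _ = Real.exp (B + 3 * S) := by rw [Real.exp_add, ← Real.exp_nat_mul]; ring_nf

theorem roth (m : ℕ) : ∀ ε : ℝ, 0 < ε → ∃ ω : ℝ, 0 < ω ∧ ω ≤ 1 ∧
    ∀ (r : Fin m → ℕ) (p q : Fin m → ℤ) (B : ℝ) (f : MvPolynomial (Fin m) ℤ),
      (∀ h, 0 < r h) → (∀ h h', h < h' → (r h : ℝ) ≤ ω * r h') →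
      (∀ h, 0 < q h) → (∀ h, IsCoprime (p h) (q h)) → f ≠ 0 → (∀ h, f.degreeOf h ≤ r h) →
      0 ≤ B → (∀ e, |((coeff e f : ℤ) : ℝ)| ≤ Real.exp B) →
      (∀ h, B + ∑ h', (r h' : ℝ) ≤ ω * (r h * Real.log (q h))) →
      ∃ e ∈ (shift (rpt p q) (map (Int.castRingHom ℚ) f)).support, wt r e ≤ ε := by
  induction m with
  | zero =>
    intro ε hε
    refine ⟨1, one_pos, le_rfl, ?_⟩
    intro r p q B f _ _ _ _ hf _ _ _ _
    have hne : shift (rpt p q) (map (Int.castRingHom ℚ) f) ≠ 0 := by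
      intro h
      apply hf
      apply map_injective _ (RingHom.injective_int (Int.castRingHom ℚ))
      apply shift_injective (rpt p q)
      rw [h, map_zero, map_zero]
    obtain ⟨e, he⟩ := support_nonempty.2 hne
    exact ⟨e, he, by simp [wt, hε.le]⟩
  | succ m ih =>
    intro ε0 hε0
    set ε := min ε0 1 with hεdef
    have hε : 0 < ε := lt_min hε0 one_pos
    have hε1 : ε ≤ 1 := min_le_right _ _
    obtain ⟨ω', hω', hω'1, IH⟩ := ih (ε^2/20) (by positivity)
    set ω := min (ω'/4) (ε^2/1000) with hωdef
    have hω : 0 < ω := lt_min (by positivity) (by positivity)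
    have hωa : ω ≤ ω'/4 := min_le_left _ _
    have hωb : ω ≤ ε^2/1000 := min_le_right _ _
    refine ⟨ω, hω, by linarith, ?_⟩
    intro r p q B f hr hgap hq hpq hf hdeg hB hcoef hlog
    by_contra hcon
    push Not at hcon
    set fQ := map (Int.castRingHom ℚ) f with hfQ
    have hge : ge r (shift (rpt p q) fQ) ε := fun e he =>
      (min_le_left _ _).trans (hcon e he).le
    obtain ⟨k, a, ψ, hk0, hk, hψ, hφ, hdec⟩ := decomp f hf (r 0) (hdeg 0)
    set φ : Fin k → MvPolynomial (Fin m) ℤ := fun i => fc f (a i) with hφdef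
    obtain ⟨J, hJ, hWψ⟩ := wronskian ψ hψ
    obtain ⟨I, hI, hU⟩ := wronskian _ hφ
    set S := ∑ h, r h with hS
    have hr0S : r 0 ≤ S := Finset.single_le_sum (f := r) (fun _ _ => Nat.zero_le _) (Finset.mem_univ 0)
    -- the determinants
    set UM : Matrix (Fin k) (Fin k) (MvPolynomial (Fin m) ℤ) :=
      Matrix.of fun s j => hD (I s) (φ j) with hUM
    set WM : Matrix (Fin k) (Fin k) (MvPolynomial (Fin (m+1)) ℤ) :=
      Matrix.of fun s t => hD (Finsupp.cons (J s 0) (I t)) f with hWM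
    set PM : Matrix (Fin k) (Fin k) (MvPolynomial (Fin 1) ℚ) :=
      Matrix.of fun s j => hD (J s) (ψ j) with hPM
    have hUQ : map (Int.castRingHom ℚ) UM.det =
        (Matrix.of fun s j => hD (I s) (map (Int.castRingHom ℚ) (φ j))).det := by
      rw [RingHom.map_det]
      congr 1
      ext s j
      simp [hUM, map_hD]
    have hU0 : UM.det ≠ 0 := by
      intro h; apply hU; rw [← hUQ, h, map_zero]
    have hWQ : map (Int.castRingHom ℚ) WM.det = tens PM.det (map (Int.castRingHom ℚ) UM.det) := by
      have h1 : (map (Int.castRingHom ℚ)).mapMatrix WM =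
          ((rename (fun _ : Fin 1 => (0 : Fin (m+1)))).toRingHom.mapMatrix PM) *
          ((rename (Fin.succ : Fin m → Fin (m+1))).toRingHom.mapMatrix
            ((map (Int.castRingHom ℚ)).mapMatrix UM)).transpose := by
        refine Matrix.ext fun s t => ?_
        rw [Matrix.mul_apply]
        simp only [RingHom.mapMatrix_apply, Matrix.map_apply, hWM, Matrix.of_apply, map_hD,
          Matrix.transpose_apply, hUM, hPM]
        rw [hdec, map_sum]
        refine Finset.sum_congr rfl fun i _ => ?_
        rw [hD_tens]
        rfl
      rw [RingHom.map_det, h1, Matrix.det_mul, Matrix.det_transpose, ← RingHom.map_det,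
        ← RingHom.map_det, ← RingHom.map_det]
      rfl
    -- bound on coefficients
    have hUc := fun e => det_bound UM S (r 0) B hk hr0S (by
      intro i j
      have h1 := pN_hD_le (φ j) (fun h => r h.succ) (fun h => degreeOf_fc_le f _ h _ (hdeg h.succ))
        (Real.exp B) (fun e => by rw [hφdef]; simp only; rw [coeff_fc]; exact hcoef _) (I i)
      refine h1.trans ?_
      refine mul_le_mul_of_nonneg_right ?_ (Real.exp_pos _).le
      refine pow_le_pow_right₀ (by norm_num) ?_
      rw [hS, Fin.sum_univ_succ]; omega) e
    have hWc := fun e => det_bound WM S (r 0) B hk hr0S (by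
      intro i j
      exact pN_hD_le f r hdeg (Real.exp B) hcoef _) e
    have hSr : (S : ℝ) = ∑ h, (r h : ℝ) := by rw [hS]; push_cast; rfl
    have hk0' : (0:ℝ) < k := by exact_mod_cast hk0
    -- the induction hypothesis
    obtain ⟨e', he', hwe'⟩ := IH (fun h => k * r h.succ) (fun h => p h.succ) (fun h => q h.succ)
      (k * (B + 3 * S)) UM.det (fun h => Nat.mul_pos hk0 (hr _))
      (by
        intro h h' hh
        push_cast
        have := hgap h.succ h'.succ (Fin.succ_lt_succ_iff.2 hh)
        have h3 : (r h.succ : ℝ) ≤ ω' * r h'.succ := this.trans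
          (mul_le_mul_of_nonneg_right (by linarith) (by positivity))
        nlinarith)
      (fun h => hq _) (fun h => hpq _) hU0
      (fun h => degreeOf_det_le _ _ _ fun i j => degreeOf_hD_le _ _ _ _
        (degreeOf_fc_le f _ h _ (hdeg h.succ)))
      (by positivity) hUc
      (by
        intro h
        have h1 := hlog h.succ
        have h2 : ∑ h' : Fin m, ((k * r h'.succ : ℕ) : ℝ) ≤ k * S := by
          push_cast
          rw [← Finset.mul_sum]
          refine mul_le_mul_of_nonneg_left ?_ hk0'.le
          rw [hSr, Fin.sum_univ_succ]
          have : (0:ℝ) ≤ r 0 := by positivity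
          linarith
        rw [← hSr] at h1
        push_cast at h2 ⊢
        have hL : 0 ≤ Real.log (q h.succ) := by
          apply Real.log_nonneg; exact_mod_cast hq h.succ
        have h4 : ω * (r h.succ * Real.log (q h.succ)) ≤ ω'/4 * (r h.succ * Real.log (q h.succ)) :=
          mul_le_mul_of_nonneg_right hωa (by positivity)
        have h5 : (k:ℝ) * (4 * (B + S)) ≤ k * (ω' * (r h.succ * Real.log (q h.succ))) :=
          mul_le_mul_of_nonneg_left (by linarith) hk0'.le
        nlinarith [mul_nonneg hk0'.le hB])
    -- the one variable polynomial
    obtain ⟨e1, he1⟩ : ∃ e1, coeff e1 UM.det ≠ 0 := by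
      obtain ⟨e1, he1⟩ := support_nonempty.2 hU0
      exact ⟨e1, mem_support_iff.1 he1⟩
    set g : MvPolynomial (Fin 1) ℤ := ∑ d ∈ WM.det.support,
      if d.tail = e1 then monomial (Finsupp.single 0 (d 0)) (coeff d WM.det) else 0 with hg
    have hgc : ∀ l : ℕ, coeff (Finsupp.single 0 l) g = coeff (Finsupp.cons l e1) WM.det := by
      classical
      intro l
      rw [hg, coeff_sum, Finset.sum_eq_single (Finsupp.cons l e1)]
      · simp [coeff_monomial]
      · intro d _ hd
        by_cases h : d.tail = e1
        · rw [if_pos h, coeff_monomial, if_neg]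
          intro h2
          apply hd
          rw [← Finsupp.single_injective _ h2, ← h, Finsupp.cons_tail]
        · rw [if_neg h, coeff_zero]
      · intro h
        simp [notMem_support_iff.1 h]
    have hfin1 : ∀ d : Fin 1 →₀ ℕ, d = Finsupp.single 0 (d 0) := by
      intro d
      refine Finsupp.ext fun i => ?_; rw [Subsingleton.elim i 0]; simp
    have hgQ : map (Int.castRingHom ℚ) g = ((coeff e1 UM.det : ℤ) : ℚ) • PM.det := by
      ext d
      rw [hfin1 d, coeff_map, hgc, coeff_smul, ← coeff_map, hWQ, coeff_tens, coeff_map]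
      simp [mul_comm]
    have hc0 : ((coeff e1 UM.det : ℤ) : ℚ) ≠ 0 := by exact_mod_cast he1
    have hg0 : g ≠ 0 := by
      intro h
      rw [h, map_zero] at hgQ
      rcases smul_eq_zero.1 hgQ.symm with h1 | h1
      · exact hc0 h1
      · exact hWψ h1
    obtain ⟨l, hl, hql⟩ := onevar g hg0 (p 0) (q 0) (hpq 0) (hq 0) _ (fun e => by
      rw [hfin1 e, hgc]; exact hWc _)
    have hl' : coeff l (shift (fun _ => (p 0 : ℚ) / q 0) PM.det) ≠ 0 := by
      rw [hgQ, map_smul, mem_support_iff, coeff_smul] at hl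
      exact right_ne_zero_of_mul hl
    have hlb : (l 0 : ℝ) ≤ 3 * k * ω * r 0 := by
      have hq0 : (1:ℝ) ≤ q 0 := by exact_mod_cast hq 0
      have h1 := Real.log_le_log (by positivity) hql
      rw [Real.log_pow, Real.log_exp] at h1
      have h2 := hlog 0
      rw [← hSr] at h2
      have hr0 : (0:ℝ) < r 0 := by exact_mod_cast hr 0
      have hS0 : (r 0:ℝ) ≤ S := by exact_mod_cast hr0S
      have hL0 : 0 ≤ Real.log (q 0) := Real.log_nonneg hq0
      have hL : 0 < Real.log (q 0) := by
        rcases hL0.lt_or_eq with h | h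
        · exact h
        · rw [← h] at h2; simp at h2; linarith
      have h3 : (l 0 : ℝ) * Real.log (q 0) ≤ (3 * k * ω * r 0) * Real.log (q 0) := by
        have h4 : (k:ℝ) * (3 * (B + S)) ≤ k * (3 * (ω * (r 0 * Real.log (q 0)))) :=
          mul_le_mul_of_nonneg_left (by linarith) hk0'.le
        nlinarith [mul_nonneg hk0'.le hB]
      exact le_of_mul_le_mul_right h3 hL
    -- lower bound for the index of W
    have hωε : ω < ε := by nlinarith
    have hWge : ge r (shift (rpt p q) (map (Int.castRingHom ℚ) WM.det))
        (∑ s : Fin k, max 0 (ε - ω - (s : ℕ) / r 0)) := by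
      have h1 : shift (rpt p q) (map (Int.castRingHom ℚ) WM.det) =
          ((shift (rpt p q)).toRingHom.mapMatrix ((map (Int.castRingHom ℚ)).mapMatrix WM)).det := by
        rw [RingHom.map_det, ← RingHom.map_det (shift (rpt p q)).toRingHom]; rfl
      rw [h1]
      refine ge.det fun s t => ?_
      have h2 : ((shift (rpt p q)).toRingHom.mapMatrix ((map (Int.castRingHom ℚ)).mapMatrix WM)) s t =
          hD (Finsupp.cons (J s 0) (I t)) (shift (rpt p q) fQ) := by
        rw [hD_shift]
        simp only [RingHom.mapMatrix_apply, Matrix.map_apply, hWM, Matrix.of_apply, map_hD]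
        rfl
      rw [h2]
      rcases max_cases 0 (ε - ω - (s : ℕ) / r 0) with ⟨h3, _⟩ | ⟨h3, _⟩
      · rw [h3]; exact ge_nonpos _ le_rfl
      · rw [h3]
        intro e he
        have h4 := hge.hD (Finsupp.cons (J s 0) (I t)) e he
        refine le_trans ?_ h4
        have hr0 : (0:ℝ) < r 0 := by exact_mod_cast hr 0
        have h5 : wt r (Finsupp.cons (J s 0) (I t)) ≤ (s : ℕ) / r 0 + ω := by
          rw [wt, Fin.sum_univ_succ]
          simp only [Finsupp.cons_zero, Finsupp.cons_succ]
          have h6 : ((J s 0 : ℕ) : ℝ) ≤ (s : ℕ) := by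
            have := hJ s
            rw [Finsupp.degree_eq_sum] at this
            simp at this
            exact_mod_cast this
          have h7 : ∑ h : Fin m, ((I t h : ℕ) : ℝ) / r h.succ ≤ ω := by
            have h8 : ∀ h : Fin m, ((I t h : ℕ) : ℝ) / r h.succ ≤ (I t h : ℝ) * (ω / r 0) := by
              intro h
              rw [div_eq_mul_inv]
              refine mul_le_mul_of_nonneg_left ?_ (by positivity)
              have hrs : (0:ℝ) < r h.succ := by exact_mod_cast hr _
              rw [le_div_iff₀ hr0, inv_mul_le_iff₀ hrs]
              linarith [hgap 0 h.succ (Fin.succ_pos h)]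
            refine (Finset.sum_le_sum fun h _ => h8 h).trans ?_
            rw [← Finset.sum_mul]
            have h9 : ∑ h : Fin m, ((I t h : ℕ) : ℝ) ≤ r 0 := by
              have := hI t
              rw [Finsupp.degree_eq_sum] at this
              have h10 : ∑ h : Fin m, I t h ≤ r 0 := by
                have := t.2; omega
              exact_mod_cast h10
            calc _ ≤ (r 0 : ℝ) * (ω / r 0) := mul_le_mul_of_nonneg_right h9 (by positivity)
              _ = ω := by field_simp
          exact add_le_add (div_le_div_of_nonneg_right h6 hr0.le) h7
        linarith
    have hmem : (Finsupp.cons (l 0) e' : Fin (m+1) →₀ ℕ) ∈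
        (shift (rpt p q) (map (Int.castRingHom ℚ) WM.det)).support := by
      rw [mem_support_iff, hWQ, shift_tens, coeff_tens]
      refine mul_ne_zero ?_ ?_
      · rw [Finsupp.cons_zero, ← hfin1]; exact hl'
      · rw [Finsupp.tail_cons]; exact mem_support_iff.1 he'
    have hfinal := hWge _ hmem
    have hlow := sum_max_ge (ε - ω) (by linarith) (by linarith) (r 0) k (hr 0) hk0 hk
    have hup : wt r (Finsupp.cons (l 0) e') ≤ 3 * k * ω + k * (ε^2/20) := by
      rw [wt, Fin.sum_univ_succ]
      simp only [Finsupp.cons_zero, Finsupp.cons_succ]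
      have hr0 : (0:ℝ) < r 0 := by exact_mod_cast hr 0
      refine add_le_add ?_ ?_
      · rw [div_le_iff₀ hr0]; exact hlb
      · have : wt (fun h => k * r h.succ) e' * k = ∑ h : Fin m, (e' h : ℝ) / r h.succ := by
          rw [wt, Finset.sum_mul]
          refine Finset.sum_congr rfl fun h _ => ?_
          have hrs : (0:ℝ) < r h.succ := by exact_mod_cast hr _
          push_cast
          field_simp
        rw [← this, mul_comm]
        exact mul_le_mul_of_nonneg_left hwe' hk0'.le
    have h10 : (k:ℝ) * ((ε - ω)^2/8) ≤ k * (3 * ω + ε^2/20) := by linarith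
    have h11 := le_of_mul_le_mul_left h10 hk0'
    nlinarith
end SST
end

section
namespace SST

/-- An order containing integer multiples of a family of real numbers, with a norm. -/
structure AlgData {ι : Type} (x : ι → ℝ) where
  O : Type
  [ring : CommRing O]
  φ : O →+* ℝ
  inj : Function.Injective φ
  ν : RingSeminorm O
  ν1 : ν 1 ≤ 1
  D : ℕ
  c : Fin D → O →+ ℤ
  c_inj : ∀ y, (∀ t, c t y = 0) → y = 0
  K : ℝ
  hK : 0 ≤ K
  c_le : ∀ t y, |((c t y : ℤ) : ℝ)| ≤ K * ν y
  s : ℕ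
  hs : 0 < s
  x' : ι → O
  hx' : ∀ i, φ (x' i) = s * x i
  κ : ℝ
  hκ : 0 < κ
  liou : ∀ y, y ≠ 0 → κ ≤ |φ y| * (max 1 (ν y)) ^ D

attribute [instance] AlgData.ring

section
attribute [local instance] Matrix.linftyOpNormedRing Matrix.linftyOpNormedAddCommGroup

/-- the operator norm of multiplication -/
def opNu {O : Type} [CommRing O] {D : ℕ} (b : Module.Basis (Fin D) ℤ O) : RingSeminorm O where
  toFun y := ‖Algebra.leftMulMatrix b y‖
  map_zero' := by simp
  add_le' a b := by rw [map_add]; exact norm_add_le _ _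
  neg' a := by rw [map_neg, norm_neg]
  mul_le' a b := by rw [map_mul]; exact norm_mul_le _ _

lemma opNu_apply {O : Type} [CommRing O] {D : ℕ} (b : Module.Basis (Fin D) ℤ O) (y : O) :
    opNu b y = ‖Algebra.leftMulMatrix b y‖ := rfl

lemma entry_le_opNorm {D : ℕ} (A : Matrix (Fin D) (Fin D) ℤ) (i j) : |(A i j : ℝ)| ≤ ‖A‖ := by
  have h : ‖A i j‖₊ ≤ ‖A‖₊ := by
    rw [Matrix.linfty_opNNNorm_def]
    refine le_trans ?_ (Finset.le_sup (f := fun i => ∑ j, ‖A i j‖₊) (Finset.mem_univ i))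
    exact Finset.single_le_sum (f := fun j => ‖A i j‖₊) (fun _ _ => zero_le) (Finset.mem_univ j)
  have : ‖A i j‖ ≤ ‖A‖ := h
  rwa [Int.norm_eq_abs] at this

lemma opNu_one {O : Type} [CommRing O] {D : ℕ} (b : Module.Basis (Fin D) ℤ O) : opNu b 1 ≤ 1 := by
  rw [opNu_apply, map_one]
  have h : ‖(1 : Matrix (Fin D) (Fin D) ℤ)‖₊ ≤ 1 := by
    rw [Matrix.linfty_opNNNorm_def]
    refine Finset.sup_le fun i _ => ?_
    rw [Finset.sum_eq_single i]
    · simp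
    · intro j _ hj; simp [Matrix.one_apply_ne hj.symm]
    · simp
  exact h
end

theorem exists_algData {ι : Type} [Finite ι] (x : ι → ℝ) (hx : ∀ i, IsAlgebraic ℚ (x i)) :
    Nonempty (AlgData x) := by
  classical
  haveI := Fintype.ofFinite ι
  have h1 : ∀ i, ∃ s : ℤ, s ≠ 0 ∧ IsIntegral ℤ (s • x i) := by
    intro i
    have h2 : IsAlgebraic ℤ (x i) := (IsFractionRing.isAlgebraic_iff ℤ ℚ ℝ).2 (hx i)
    obtain ⟨y, hy, h⟩ := h2.exists_integral_multiple
    exact ⟨y, hy, h⟩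
  choose s0 hs0 hsint using h1
  set s : ℕ := (∏ i, s0 i).natAbs with hs
  have hspos : 0 < s := by
    rw [hs, Int.natAbs_pos]; exact Finset.prod_ne_zero_iff.2 fun i _ => hs0 i
  have hint2 : ∀ i, IsIntegral ℤ ((s : ℝ) * x i) := by
    intro i
    obtain ⟨u, hu⟩ : s0 i ∣ (s : ℤ) := by
      rw [hs, Int.dvd_natAbs]; exact Finset.dvd_prod_of_mem _ (Finset.mem_univ i)
    have : (s : ℝ) * x i = ((u : ℤ) : ℝ) * (s0 i • x i) := by
      have : ((s : ℤ) : ℝ) = ((s0 i * u : ℤ) : ℝ) := by rw [hu]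
      push_cast at this
      rw [this, zsmul_eq_mul]; ring
    rw [this]
    exact IsIntegral.mul (isIntegral_algebraMap (R := ℤ) (A := ℝ) (x := u)) (hsint i)
  set A := Algebra.adjoin ℤ (Set.range fun i => (s : ℝ) * x i) with hA
  have hfg : A.toSubmodule.FG := by
    refine fg_adjoin_of_finite (Set.finite_range _) ?_
    rintro _ ⟨i, rfl⟩
    exact hint2 i
  haveI : Module.Finite ℤ A := Module.Finite.iff_fg.2 hfg
  haveI : Module.IsTorsionFree ℤ A := inferInstance
  haveI : Module.Free ℤ A := inferInstance
  set D := Module.finrank ℤ A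
  let b : Module.Basis (Fin D) ℤ A := Module.finBasis ℤ A
  -- Liouville constant
  let w : Fin D → ℝ := fun t => (b t : ℝ)
  have hbr : ∀ y : A, (y : ℝ) = ∑ t, (b.repr y t : ℝ) * w t := by
    intro y
    have := congrArg (Subtype.val) (b.sum_repr y)
    rw [← this]
    push_cast
    simp [w]
  have hw : ∃ t, w t ≠ 0 := by
    by_contra hcon
    push Not at hcon
    have := hbr 1
    simp [hcon] at this
  obtain ⟨t0, ht0⟩ := hw
  have heig : ∀ y : A, ∀ t, ∑ u, w u * ((Algebra.leftMulMatrix b y u t : ℤ) : ℝ) = (y : ℝ) * w t := by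
    intro y t
    have := hbr (y * b t)
    simp only [Algebra.leftMulMatrix_eq_repr_mul]
    rw [show (y : ℝ) * w t = ((y * b t : A) : ℝ) by simp [w], this]
    exact Finset.sum_congr rfl fun _ _ => mul_comm _ _
  set K1 : ℝ := (∑ u, |w u|) * (Nat.factorial D) with hK1
  refine ⟨{ O := A, φ := A.val.toRingHom, inj := Subtype.val_injective, ν := opNu b, ν1 := opNu_one b
            D := D, c := fun t => (b.coord t).toAddMonoidHom, c_inj := ?_
            K := ∑ u, |(b.repr 1 u : ℝ)|
            hK := Finset.sum_nonneg fun _ _ => abs_nonneg _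
            c_le := ?_, s := s, hs := hspos
            x' := fun i => ⟨(s:ℝ) * x i, Algebra.subset_adjoin ⟨i, rfl⟩⟩
            hx' := fun i => rfl
            κ := |w t0| / (K1 + 1)
            hκ := by positivity
            liou := ?_ }⟩
  · intro y hy
    apply b.repr.injective
    ext t
    simpa using hy t
  · intro t y
    have h := congrFun (Algebra.leftMulMatrix_mulVec_repr b y 1) t
    rw [mul_one] at h
    show |((b.repr y t : ℤ) : ℝ)| ≤ _
    rw [← h, Matrix.mulVec, dotProduct]
    push_cast
    refine (Finset.abs_sum_le_sum_abs _ _).trans ?_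
    rw [Finset.sum_mul]
    refine Finset.sum_le_sum fun u _ => ?_
    rw [abs_mul, mul_comm, opNu_apply]
    exact mul_le_mul_of_nonneg_left (entry_le_opNorm _ _ _) (abs_nonneg _)
  · intro y hy
    show |w t0| / (K1 + 1) ≤ |(y : ℝ)| * _
    set L := Algebra.leftMulMatrix b y with hL
    have hdet : L.det ≠ 0 := by
      intro h0
      obtain ⟨v, hv, hv0⟩ := Matrix.exists_mulVec_eq_zero_iff.2 h0
      obtain ⟨z, hz⟩ : ∃ z : A, ∀ t, b.repr z t = v t :=
        ⟨b.equivFun.symm v, fun t => by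
          have := congrFun (b.equivFun.apply_symm_apply v) t
          simpa [Module.Basis.equivFun_apply] using this⟩
      have h3 : b.repr (y * z) = 0 := by
        have h4 := Algebra.leftMulMatrix_mulVec_repr b y z
        have h5 : (b.repr z : Fin D → ℤ) = v := funext hz
        rw [h5, ← hL, hv0] at h4
        ext t; exact (congrFun h4 t).symm
      have h6 : y * z = 0 := b.repr.injective (by rw [h3, map_zero])
      rcases mul_eq_zero.1 h6 with h | h
      · exact hy h
      · apply hv; funext t; rw [← hz, h]; simp
    -- w L = y w
    set Mx := max 1 (opNu b y) with hMx
    have hadj : ∀ u t, |((L.adjugate u t : ℤ) : ℝ)| ≤ Nat.factorial D * Mx ^ D := by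
      intro u t
      rw [Matrix.adjugate_apply]
      have hc : ((Matrix.det (L.updateRow t (Pi.single u 1)) : ℤ) : ℝ) =
          Matrix.det ((L.updateRow t (Pi.single u 1)).map (Int.castRingHom ℝ)) := by
        rw [← RingHom.mapMatrix_apply, ← RingHom.map_det]; rfl
      rw [hc]
      have := Matrix.det_le (A := (L.updateRow t (Pi.single u 1)).map (Int.castRingHom ℝ))
        (abv := AbsoluteValue.abs) (x := Mx) (by
          intro i j
          simp only [Matrix.map_apply, Matrix.updateRow_apply]
          by_cases hi : i = t
          · rw [if_pos hi]
            by_cases hj : j = u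
            · subst hj; simp [hMx]
            · simp [Pi.single_eq_of_ne hj, hMx]
          · rw [if_neg hi]
            exact (entry_le_opNorm _ _ _).trans (le_max_right _ _))
      simpa [nsmul_eq_mul] using this
    have key : ((L.det : ℤ) : ℝ) * w t0 = (y : ℝ) * ∑ u, w u * ((L.adjugate u t0 : ℤ) : ℝ) := by
      have h7 := Matrix.mul_adjugate L
      rw [Finset.mul_sum]
      have h8 : ∀ u, (y : ℝ) * (w u * ((L.adjugate u t0 : ℤ) : ℝ)) =
          ∑ u', w u' * ((L u' u : ℤ) : ℝ) * ((L.adjugate u t0 : ℤ) : ℝ) := by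
        intro u
        rw [← mul_assoc, ← heig y u, Finset.sum_mul]
      rw [Finset.sum_congr rfl fun u _ => h8 u, Finset.sum_comm]
      have h9 : ∀ u', ∑ u, w u' * ((L u' u : ℤ) : ℝ) * ((L.adjugate u t0 : ℤ) : ℝ) =
          w u' * (((L.det • (1 : Matrix (Fin D) (Fin D) ℤ)) u' t0 : ℤ) : ℝ) := by
        intro u'
        rw [← h7, Matrix.mul_apply]
        push_cast
        rw [Finset.mul_sum]
        exact Finset.sum_congr rfl fun _ _ => by ring
      rw [Finset.sum_congr rfl fun u _ => h9 u, Finset.sum_eq_single t0]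
      · simp [mul_comm]
      · intro u _ hu; simp [Matrix.one_apply_ne hu]
      · simp
    have hd1 : (1:ℝ) ≤ |((L.det : ℤ) : ℝ)| := by exact_mod_cast Int.one_le_abs hdet
    have h10 := congrArg abs key
    rw [abs_mul, abs_mul] at h10
    have h11 : |∑ u, w u * ((L.adjugate u t0 : ℤ) : ℝ)| ≤ K1 * Mx ^ D := by
      refine (Finset.abs_sum_le_sum_abs _ _).trans ?_
      rw [hK1, mul_assoc, Finset.sum_mul]
      refine Finset.sum_le_sum fun u _ => ?_
      rw [abs_mul]
      exact mul_le_mul_of_nonneg_left (hadj _ _) (abs_nonneg _)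
    have hK1' : 0 ≤ K1 := by positivity
    rw [div_le_iff₀ (by positivity)]
    have h12 : |w t0| ≤ |(y:ℝ)| * (K1 * Mx ^ D) := by
      calc |w t0| = 1 * |w t0| := (one_mul _).symm
        _ ≤ |((L.det : ℤ) : ℝ)| * |w t0| := mul_le_mul_of_nonneg_right hd1 (abs_nonneg _)
        _ = _ := h10
        _ ≤ _ := mul_le_mul_of_nonneg_left h11 (abs_nonneg _)
    have hM1 : 0 ≤ |(y:ℝ)| * Mx ^ D := by positivity
    nlinarith
end SST
end

section
namespace SST
open MvPolynomial

/-- compositions of `r` into `N` parts -/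
def comps (N r : ℕ) : Finset (Fin N → ℕ) := Finset.piAntidiag Finset.univ r

lemma mem_comps {N r : ℕ} (v : Fin N → ℕ) : v ∈ comps N r ↔ ∑ l, v l = r := by
  simp [comps]

lemma comps_mean {N r : ℕ} (k : Fin N) :
    (N : ℝ) * ∑ v ∈ comps N r, (v k : ℝ) = r * (comps N r).card := by
  have h1 : ∀ l : Fin N, ∑ v ∈ comps N r, (v l : ℝ) = ∑ v ∈ comps N r, (v k : ℝ) := by
    intro l
    refine Finset.sum_bij' (fun v _ => v ∘ Equiv.swap k l) (fun v _ => v ∘ Equiv.swap k l) ?_ ?_ ?_ ?_ ?_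
    · intro v hv; rw [mem_comps] at *
      rw [← hv]; exact Equiv.sum_comp (Equiv.swap k l) v
    · intro v hv; rw [mem_comps] at *
      rw [← hv]; exact Equiv.sum_comp (Equiv.swap k l) v
    · intro v _; funext x; simp
    · intro v _; funext x; simp
    · intro v _; simp
  have h2 : ∑ l : Fin N, ∑ v ∈ comps N r, (v l : ℝ) = r * (comps N r).card := by
    rw [Finset.sum_comm]
    rw [Finset.sum_congr rfl (g := fun _ => (r : ℝ)) ?_]
    · simp [mul_comm]
    · intro v hv
      rw [mem_comps] at hv
      rw [← hv]; push_cast; rfl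
  rw [Finset.sum_congr rfl fun l _ => h1 l] at h2
  simpa using h2

/-- second moment bound -/
lemma second_moment {m : ℕ} {α : Type*} [DecidableEq α] (S : Fin m → Finset α) (f : Fin m → α → ℝ)
    (h0 : ∀ h, ∑ v ∈ S h, f h v = 0) (h1 : ∀ h, ∀ v ∈ S h, |f h v| ≤ 1) :
    ∑ v ∈ Fintype.piFinset S, (∑ h, f h (v h)) ^ 2 ≤ m * (Fintype.piFinset S).card := by
  have hcross : ∀ h h' : Fin m, h ≠ h' → ∑ v ∈ Fintype.piFinset S, f h (v h) * f h' (v h') = 0 := by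
    intro h h' hh
    have e1 : ∀ v : Fin m → α, f h (v h) * f h' (v h') =
        ∏ i, (if i = h then f h (v i) else if i = h' then f h' (v i) else 1) := by
      intro v
      rw [← Finset.mul_prod_erase _ _ (Finset.mem_univ h),
        ← Finset.mul_prod_erase _ _ (Finset.mem_erase.2 ⟨hh.symm, Finset.mem_univ h'⟩)]
      rw [if_pos rfl, if_neg hh.symm, if_pos rfl, Finset.prod_eq_one, mul_one]
      intro i hi
      simp only [Finset.mem_erase] at hi
      rw [if_neg hi.2.1, if_neg hi.1]
    simp only [e1]
    rw [← Finset.prod_univ_sum S (fun i a => (if i = h then f h a else if i = h' then f h' a else 1))]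
    refine Finset.prod_eq_zero (Finset.mem_univ h) ?_
    simpa using h0 h
  have e2 : ∀ v : Fin m → α, (∑ h, f h (v h)) ^ 2 = ∑ h, ∑ h', f h (v h) * f h' (v h') := by
    intro v; rw [sq, Finset.sum_mul_sum]
  simp only [e2]
  rw [Finset.sum_comm]
  have e3 : ∀ h, ∑ v ∈ Fintype.piFinset S, ∑ h', f h (v h) * f h' (v h') ≤ (Fintype.piFinset S).card := by
    intro h
    rw [Finset.sum_comm, Finset.sum_eq_single h]
    · refine (Finset.sum_le_sum (g := fun _ => (1:ℝ)) ?_).trans (by simp)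
      intro v hv
      have := h1 h (v h) (Fintype.mem_piFinset.1 hv h)
      rw [← abs_mul_abs_self]
      nlinarith [abs_nonneg (f h (v h))]
    · intro h' _ hh; exact hcross h h' hh.symm
    · simp
  refine (Finset.sum_le_sum fun h _ => e3 h).trans ?_
  simp

/-- multi-compositions -/
def mcomps (m N : ℕ) (r : Fin m → ℕ) : Finset (Fin m → Fin N → ℕ) :=
  Fintype.piFinset fun h => comps N (r h)

lemma mem_mcomps {m N : ℕ} {r : Fin m → ℕ} (v : Fin m → Fin N → ℕ) :
    v ∈ mcomps m N r ↔ ∀ h, ∑ l, v h l = r h := by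
  simp [mcomps, mem_comps]

lemma cheb {m N : ℕ} (r : Fin m → ℕ) (hr : ∀ h, 0 < r h) (hm : 0 < m) (hN : 0 < N) (δ : ℝ) (hδ : 0 < δ)
    (k : Fin N) :
    (((mcomps m N r).filter fun v => δ * m < |∑ h, (v h k : ℝ) / r h - m / N|).card : ℝ) * (δ ^ 2 * m)
      ≤ (mcomps m N r).card := by
  classical
  have hm' : (0:ℝ) < m := by exact_mod_cast hm
  have hN' : (1:ℝ) ≤ N := by exact_mod_cast hN
  have h1 := second_moment (fun h => comps N (r h)) (fun h v => (v k : ℝ) / r h - 1 / N) (by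
    intro h
    have := comps_mean (r := r h) k
    have hr' : (0:ℝ) < r h := by exact_mod_cast hr h
    rw [Finset.sum_sub_distrib, ← Finset.sum_div]
    simp only [Finset.sum_const, nsmul_eq_mul]
    field_simp
    linarith) (by
    intro h v hv
    rw [mem_comps] at hv
    have hr' : (0:ℝ) < r h := by exact_mod_cast hr h
    have h2 : (v k : ℝ) ≤ r h := by
      rw [← hv]
      exact_mod_cast Finset.single_le_sum (f := v) (fun _ _ => Nat.zero_le _) (Finset.mem_univ k)
    have h3 : (v k : ℝ) / r h ≤ 1 := (div_le_one hr').2 h2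
    have h4 : 0 ≤ (v k : ℝ) / r h := by positivity
    have h5 : (1:ℝ) / N ≤ 1 := (div_le_one (by linarith)).2 hN'
    have h6 : 0 ≤ (1:ℝ) / N := by positivity
    rw [abs_le]; constructor <;> linarith)
  have h2 : ∀ v : Fin m → Fin N → ℕ, ∑ h, ((v h k : ℝ) / r h - 1 / N) =
      ∑ h, (v h k : ℝ) / r h - m / N := by
    intro v
    rw [Finset.sum_sub_distrib]; simp [div_eq_mul_inv]
  simp only [h2] at h1
  set F := (mcomps m N r).filter fun v => δ * m < |∑ h, (v h k : ℝ) / r h - m / N|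
  have h3 : (F.card : ℝ) * (δ * m) ^ 2 ≤ ∑ v ∈ F, (∑ h, (v h k : ℝ) / r h - m / N) ^ 2 := by
    rw [← nsmul_eq_mul, ← Finset.sum_const]
    refine Finset.sum_le_sum fun v hv => ?_
    have := (Finset.mem_filter.1 hv).2
    rw [← sq_abs (∑ h, (v h k : ℝ) / r h - m / N)]
    exact pow_le_pow_left₀ (by positivity) this.le 2
  have h4 : ∑ v ∈ F, (∑ h, (v h k : ℝ) / r h - m / N) ^ 2 ≤
      ∑ v ∈ mcomps m N r, (∑ h, (v h k : ℝ) / r h - m / N) ^ 2 :=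
    Finset.sum_le_sum_of_subset_of_nonneg (Finset.filter_subset _ _) fun _ _ _ => sq_nonneg _
  have h5 : ((F.card : ℝ) * (δ ^ 2 * m)) * m ≤ (mcomps m N r).card * m := by
    have := (h3.trans h4).trans h1
    rw [mcomps]
    nlinarith
  exact le_of_mul_le_mul_right h5 hm'

section lsub
variable {R : Type*} [CommRing R] {m N : ℕ}

/-- linear substitution in each block of variables -/
def lsub (G : Fin m → Matrix (Fin N) (Fin N) R) :
    MvPolynomial (Fin m × Fin N) R →ₐ[R] MvPolynomial (Fin m × Fin N) R :=
  aeval fun x => ∑ s, C (G x.1 x.2 s) * X (x.1, s)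

lemma lsub_X (G : Fin m → Matrix (Fin N) (Fin N) R) (x) :
    lsub G (X x) = ∑ s, C (G x.1 x.2 s) * X (x.1, s) := by simp [lsub]

lemma lsub_lsub (G H : Fin m → Matrix (Fin N) (Fin N) R) (P : MvPolynomial (Fin m × Fin N) R) :
    lsub G (lsub H P) = lsub (fun h => H h * G h) P := by
  have : (lsub G).comp (lsub H) = lsub (fun h => H h * G h) := by
    apply MvPolynomial.algHom_ext
    intro x
    rw [AlgHom.comp_apply, lsub_X, lsub_X, map_sum]
    have e1 : ∀ s, lsub G (C (H x.1 x.2 s) * X (x.1, s)) =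
        ∑ t, C (H x.1 x.2 s) * (C (G x.1 s t) * X (x.1, t)) := by
      intro s
      rw [map_mul, lsub_X, Finset.mul_sum]
      congr 1
      funext t
      congr 1
      exact (lsub G).commutes _
    rw [Finset.sum_congr rfl fun s _ => e1 s, Finset.sum_comm]
    refine Finset.sum_congr rfl fun t _ => ?_
    rw [Matrix.mul_apply, map_sum, Finset.sum_mul]
    refine Finset.sum_congr rfl fun s _ => ?_
    rw [map_mul]; ring
  exact congrArg (fun F => F P) this

lemma lsub_one (P : MvPolynomial (Fin m × Fin N) R) : lsub (fun _ => 1) P = P := by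
  have : lsub (fun _ : Fin m => (1 : Matrix (Fin N) (Fin N) R)) = AlgHom.id R _ := by
    apply MvPolynomial.algHom_ext
    intro x
    rw [lsub_X, Finset.sum_eq_single x.2]
    · simp
    · intro s _ hs; simp [Matrix.one_apply_ne hs.symm]
    · simp
  rw [this]; rfl

lemma map_lsub {S : Type*} [CommRing S] (φ : R →+* S) (G : Fin m → Matrix (Fin N) (Fin N) R)
    (P : MvPolynomial (Fin m × Fin N) R) :
    map φ (lsub G P) = lsub (fun h => (G h).map φ) (map φ P) := by
  induction P using MvPolynomial.induction_on with
  | C a => rw [← algebraMap_eq, AlgHom.commutes, algebraMap_eq, map_C, ← algebraMap_eq, AlgHom.commutes]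
  | add p q hp hq => rw [map_add, map_add, map_add, map_add, hp, hq]
  | mul_X p x hp =>
    rw [map_mul, map_mul, map_mul, map_mul, hp, lsub_X, map_X, lsub_X, map_sum]
    simp

/-- multihomogeneous -/
def mh (r : Fin m → ℕ) (P : MvPolynomial (Fin m × Fin N) R) : Prop :=
  ∀ d ∈ P.support, ∀ h, ∑ l, d (h, l) = r h

lemma mh.sum {ι : Type*} (S : Finset ι) {f : ι → MvPolynomial (Fin m × Fin N) R} {r : Fin m → ℕ}
    (hf : ∀ i ∈ S, mh r (f i)) : mh r (∑ i ∈ S, f i) := by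
  classical
  intro d hd h
  obtain ⟨i, hi, hd'⟩ := Finset.mem_biUnion.1 (support_sum hd)
  exact hf i hi d hd' h

lemma mh.mul {f g : MvPolynomial (Fin m × Fin N) R} {r s : Fin m → ℕ} (hf : mh r f) (hg : mh s g) :
    mh (r + s) (f * g) := by
  classical
  intro e he h
  obtain ⟨a, ha, b, hb, rfl⟩ := Finset.mem_add.1 (support_mul f g he)
  simp [Finset.sum_add_distrib, hf a ha, hg b hb]

lemma mh_C (a : R) : mh (0 : Fin m → ℕ) (C a : MvPolynomial (Fin m × Fin N) R) := by
  classical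
  intro d hd h
  rw [mem_support_iff, coeff_C] at hd
  have : 0 = d := by by_contra h; simp [h] at hd
  subst this; simp

lemma mh.prod {ι : Type*} (S : Finset ι) {f : ι → MvPolynomial (Fin m × Fin N) R} {r : ι → Fin m → ℕ}
    (hf : ∀ i ∈ S, mh (r i) (f i)) : mh (∑ i ∈ S, r i) (∏ i ∈ S, f i) := by
  classical
  induction S using Finset.induction_on with
  | empty => simpa using mh_C (1 : R)
  | insert a S ha ih =>
    rw [Finset.prod_insert ha, Finset.sum_insert ha]
    exact (hf a (Finset.mem_insert_self _ _)).mul (ih fun i hi => hf i (Finset.mem_insert_of_mem hi))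

lemma mh.pow {f : MvPolynomial (Fin m × Fin N) R} {r : Fin m → ℕ} (hf : mh r f) (k : ℕ) :
    mh (k • r) (f ^ k) := by
  have := mh.prod (Finset.range k) (f := fun _ => f) (r := fun _ => r) fun _ _ => hf
  simpa using this

lemma mh_X (x : Fin m × Fin N) : mh (Pi.single x.1 1) (X x : MvPolynomial (Fin m × Fin N) R) := by
  classical
  intro d hd h
  rw [mem_support_iff, coeff_X'] at hd
  have : Finsupp.single x 1 = d := by by_contra h; simp [h] at hd
  subst this
  by_cases hx : h = x.1
  · subst hx
    rw [Pi.single_eq_same, Finset.sum_eq_single x.2]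
    · simp
    · intro l _ hl
      rw [Finsupp.single_eq_of_ne]; intro h; exact hl (by rw [← h])
    · simp
  · rw [Pi.single_eq_of_ne hx]
    refine Finset.sum_eq_zero fun l _ => ?_
    rw [Finsupp.single_eq_of_ne]; intro h'; exact hx (by rw [← h'])

lemma mh.lsub {P : MvPolynomial (Fin m × Fin N) R} {r : Fin m → ℕ} (hP : mh r P)
    (G : Fin m → Matrix (Fin N) (Fin N) R) : mh r (lsub G P) := by
  rw [P.as_sum, map_sum]
  refine mh.sum _ fun d hd => ?_
  rw [SST.lsub, aeval_monomial, Finsupp.prod_fintype _ _ (by simp)]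
  have h1 : ∀ x : Fin m × Fin N, mh (Pi.single x.1 1) (∑ s, C (G x.1 x.2 s) * X (x.1, s)) := by
    intro x
    refine mh.sum _ fun s _ => ?_
    have := (mh_C (m := m) (N := N) (G x.1 x.2 s)).mul (mh_X (x.1, s))
    simpa using this
  have h2 := (mh_C (m := m) (N := N) (coeff d P)).mul
    (mh.prod Finset.univ fun x _ => (h1 x).pow (d x))
  have h3 : (0 : Fin m → ℕ) + ∑ x : Fin m × Fin N, d x • Pi.single x.1 1 = r := by
    funext h
    rw [zero_add, Finset.sum_apply, Fintype.sum_prod_type, Finset.sum_eq_single h]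
    · simp [hP d hd h]
    · intro h' _ hh
      refine Finset.sum_eq_zero fun l _ => ?_
      simp [Pi.single_eq_of_ne hh.symm]
    · simp
  rw [h3] at h2
  exact h2

/-- exponent from a double array -/
def ex (v : Fin m → Fin N → ℕ) : Fin m × Fin N →₀ ℕ := Finsupp.equivFunOnFinite.symm fun x => v x.1 x.2

lemma ex_apply (v : Fin m → Fin N → ℕ) (x) : ex v x = v x.1 x.2 := rfl

lemma ex_injective : Function.Injective (ex : (Fin m → Fin N → ℕ) → _) := by
  intro v w h
  funext a b
  exact congrArg (fun f => f (a, b)) h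

lemma ex_curry (d : Fin m × Fin N →₀ ℕ) : ex (fun h l => d (h, l)) = d := by
  ext x; simp [ex_apply]

end lsub
end SST
end

section
namespace SST
open MvPolynomial

section
attribute [local instance] Matrix.normedAddCommGroup

lemma siegel_int {α β : Type} [Fintype α] [Fintype β] [DecidableEq α] [DecidableEq β]
    (A : Matrix α β ℤ) (h : 2 * Fintype.card α ≤ Fintype.card β) (hβ : 0 < Fintype.card β)
    (H : ℝ) (hH : 1 ≤ H) (hA : ∀ i j, |((A i j : ℤ) : ℝ)| ≤ H) :
    ∃ t : β → ℤ, t ≠ 0 ∧ A.mulVec t = 0 ∧ ∀ j, |((t j : ℤ) : ℝ)| ≤ Fintype.card β * H := by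
  have hβ' : (1:ℝ) ≤ Fintype.card β := by exact_mod_cast hβ
  have hbig : (1:ℝ) ≤ Fintype.card β * H := by nlinarith
  rcases Nat.eq_zero_or_pos (Fintype.card α) with h0 | h0
  · obtain ⟨b⟩ := Fintype.card_pos_iff.1 hβ
    have := Fintype.card_eq_zero_iff.1 h0
    refine ⟨Pi.single b 1, ?_, ?_, ?_⟩
    · intro hh; have := congrFun hh b; simp at this
    · funext i; exact isEmptyElim i
    · intro j
      by_cases hj : j = b
      · subst hj; simpa using hbig
      · rw [Pi.single_eq_of_ne hj]; simp; linarith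
  · open Matrix in
    obtain ⟨t, ht0, ht, hn⟩ := Int.Matrix.exists_ne_zero_int_vec_norm_le A (by omega) h0
    refine ⟨t, ht0, ht, fun j => ?_⟩
    have h1 : |((t j : ℤ) : ℝ)| ≤ ‖t‖ := by
      rw [← Int.norm_eq_abs]; exact norm_le_pi_norm t j
    refine h1.trans (hn.trans ?_)
    have hAn : ‖A‖ ≤ H := by
      rw [Matrix.norm_le_iff (by linarith)]
      intro i j; rw [Int.norm_eq_abs]; exact hA i j
    have hmax : max 1 ‖A‖ ≤ H := max_le hH hAn
    have hbase : (1:ℝ) ≤ Fintype.card β * max 1 ‖A‖ := by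
      have := le_max_left 1 ‖A‖; nlinarith
    have hab : (2:ℝ) * Fintype.card α ≤ Fintype.card β := by exact_mod_cast h
    have ha : (0:ℝ) < Fintype.card α := by exact_mod_cast h0
    calc _ ≤ ((Fintype.card β : ℝ) * max 1 ‖A‖) ^ (1:ℝ) := by
          refine Real.rpow_le_rpow_of_exponent_le hbase ?_
          rw [div_le_one (by linarith)]; linarith
      _ ≤ _ := by
          rw [Real.rpow_one]
          exact mul_le_mul_of_nonneg_left hmax (by linarith)

end

lemma card_mcomps_le {m N : ℕ} (r : Fin m → ℕ) :
    ((mcomps m N r).card : ℝ) ≤ ((2:ℝ) ^ N) ^ (∑ h, r h) := by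
  have h1 : ∀ k, (comps N k).card ≤ (2 ^ N) ^ k := by
    intro k
    have hs : comps N k ⊆ Fintype.piFinset fun _ : Fin N => Finset.range (k+1) := by
      intro v hv
      rw [mem_comps] at hv
      rw [Fintype.mem_piFinset]
      intro l
      rw [Finset.mem_range, Nat.lt_succ_iff, ← hv]
      exact Finset.single_le_sum (f := v) (fun _ _ => Nat.zero_le _) (Finset.mem_univ l)
    refine (Finset.card_le_card hs).trans ?_
    rw [Fintype.card_piFinset]
    simp only [Finset.card_range, Finset.prod_const, Finset.card_univ, Fintype.card_fin]
    rw [← pow_mul, mul_comm N k, pow_mul]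
    exact Nat.pow_le_pow_left (Nat.lt_two_pow_self) _
  rw [mcomps, Fintype.card_piFinset, ← Finset.prod_pow_eq_pow_sum]
  push_cast
  refine Finset.prod_le_prod (fun _ _ => by positivity) fun h _ => ?_
  exact_mod_cast h1 (r h)

lemma lsub_scalar {R : Type*} [CommRing R] {m N : ℕ} (s : R) (P : MvPolynomial (Fin m × Fin N) R) (d) :
    coeff d (lsub (fun _ => s • (1 : Matrix (Fin N) (Fin N) R)) P) = s ^ (∑ x, d x) * coeff d P := by
  classical
  have h1 : ∀ x : Fin m × Fin N, (∑ t, C ((s • (1 : Matrix (Fin N) (Fin N) R)) x.2 t) * X (x.1, t) :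
      MvPolynomial (Fin m × Fin N) R) = C s * X x := by
    intro x
    rw [Finset.sum_eq_single x.2]
    · simp
    · intro t _ ht; simp [Matrix.one_apply_ne ht.symm]
    · simp
  have h2 : ∀ (e : Fin m × Fin N →₀ ℕ) (c : R), lsub (fun _ => s • (1 : Matrix (Fin N) (Fin N) R)) (monomial e c) =
      monomial e (c * s ^ (∑ x, e x)) := by
    intro e c
    rw [lsub, aeval_monomial, Finsupp.prod_fintype _ _ (by simp)]
    simp only [h1, mul_pow, Finset.prod_mul_distrib]
    rw [Finset.prod_pow_eq_pow_sum, ← C_pow, algebraMap_eq, ← mul_assoc, ← C_mul,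
      monomial_eq, Finsupp.prod_fintype _ _ (by simp)]
  induction P using MvPolynomial.induction_on' with
  | monomial e c =>
    rw [h2, coeff_monomial, coeff_monomial]
    split_ifs with h
    · subst h; ring
    · simp
  | add p q hp hq => rw [map_add, coeff_add, hp, hq, coeff_add]; ring

/-- The auxiliary polynomial. -/
lemma aux_poly {N : ℕ} (hN : 0 < N) (W : Matrix (Fin N) (Fin N) ℝ)
    (hW : ∀ i j, IsAlgebraic ℚ (W i j)) (ε : ℝ) (hε : 0 < ε) :
    ∃ m : ℕ, 0 < m ∧ ∃ Cc : ℝ, 1 ≤ Cc ∧ ∀ r : Fin m → ℕ, (∀ h, 0 < r h) →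
      ∃ P : MvPolynomial (Fin m × Fin N) ℤ, P ≠ 0 ∧ mh r P ∧
        (∀ d, |((coeff d P : ℤ) : ℝ)| ≤ Cc ^ (∑ h, r h)) ∧
        ∀ d ∈ (lsub (fun _ => W) (map (Int.castRingHom ℝ) P)).support, ∀ k,
          |∑ h, (d (h, k) : ℝ) / r h - m / N| ≤ ε * m := by
  classical
  obtain ⟨A⟩ := exists_algData (fun p : Fin N × Fin N => W p.1 p.2) (fun p => hW _ _)
  set W' : Matrix (Fin N) (Fin N) A.O := Matrix.of fun i j => A.x' (i, j) with hW'
  have hWmap : W'.map A.φ = W * ((A.s : ℝ) • (1 : Matrix (Fin N) (Fin N) ℝ)) := by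
    ext i j
    simp [hW', A.hx']
  obtain ⟨m, hm⟩ := exists_nat_gt ((2 * N * (A.D + 1)) / ε ^ 2)
  have hm0 : 0 < m := by
    have : (0:ℝ) < m := lt_of_le_of_lt (by positivity) hm
    exact_mod_cast this
  set B : ℝ := 1 + ∑ i, ∑ j, A.ν (W' i j) with hB
  have hB1 : 1 ≤ B := by
    have : 0 ≤ ∑ i, ∑ j, A.ν (W' i j) :=
      Finset.sum_nonneg fun _ _ => Finset.sum_nonneg fun _ _ => apply_nonneg _ _
    linarith
  have hrow : ∀ i, ∑ j, A.ν (W' i j) ≤ B := by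
    intro i
    have := Finset.single_le_sum (f := fun i => ∑ j, A.ν (W' i j))
      (fun _ _ => Finset.sum_nonneg fun _ _ => apply_nonneg _ _) (Finset.mem_univ i)
    linarith
  have hK := A.hK
  have h2N : (1:ℝ) ≤ 2 ^ N := one_le_pow₀ (by norm_num)
  refine ⟨m, hm0, 2 ^ N * ((1 + A.K) * B), by nlinarith [mul_le_mul (show (1:ℝ) ≤ 1 + A.K by linarith) hB1 (by norm_num) (by linarith)], ?_⟩
  intro r hr
  set bad : Finset (Fin m → Fin N → ℕ) := (mcomps m N r).filter
    fun v => ∃ k, ε * m < |∑ h, (v h k : ℝ) / r h - m / N| with hbad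
  have hm' : (0:ℝ) < m := by exact_mod_cast hm0
  have hcard : 2 * (bad.card * A.D) ≤ (mcomps m N r).card := by
    have h1 : bad ⊆ Finset.univ.biUnion fun k => (mcomps m N r).filter
        fun v => ε * m < |∑ h, (v h k : ℝ) / r h - m / N| := by
      intro v hv
      rw [hbad, Finset.mem_filter] at hv
      obtain ⟨hv, k, hk⟩ := hv
      exact Finset.mem_biUnion.2 ⟨k, Finset.mem_univ k, Finset.mem_filter.2 ⟨hv, hk⟩⟩
    have h2 : (bad.card : ℝ) * (ε ^ 2 * m) ≤ N * (mcomps m N r).card := by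
      have h3 : (bad.card : ℝ) ≤ ∑ k : Fin N, (((mcomps m N r).filter
        fun v => ε * m < |∑ h, (v h k : ℝ) / r h - m / N|).card : ℝ) := by
        exact_mod_cast (Finset.card_le_card h1).trans Finset.card_biUnion_le
      calc _ ≤ (∑ k : Fin N, (((mcomps m N r).filter
        fun v => ε * m < |∑ h, (v h k : ℝ) / r h - m / N|).card : ℝ)) * (ε ^ 2 * m) :=
            mul_le_mul_of_nonneg_right h3 (by positivity)
        _ ≤ ∑ k : Fin N, ((mcomps m N r).card : ℝ) := by
            rw [Finset.sum_mul]
            exact Finset.sum_le_sum fun k _ => cheb r hr hm0 hN ε hε k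
        _ = _ := by simp
    rw [div_lt_iff₀ (by positivity)] at hm
    have hN' : (0:ℝ) < N := by exact_mod_cast hN
    have h4 : (bad.card : ℝ) * (2 * N * (A.D + 1)) ≤ N * (mcomps m N r).card := by
      refine le_trans (mul_le_mul_of_nonneg_left ?_ (Nat.cast_nonneg _)) h2
      linarith
    have h5 : (bad.card : ℝ) * (2 * (A.D + 1)) ≤ (mcomps m N r).card := by
      refine le_of_mul_le_mul_left ?_ hN'
      linarith
    have h6 : bad.card * (2 * (A.D + 1)) ≤ (mcomps m N r).card := by exact_mod_cast h5
    nlinarith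
  have hne : 0 < (mcomps m N r).card := by
    rw [Finset.card_pos]
    refine ⟨fun h => Pi.single ⟨0, hN⟩ (r h), ?_⟩
    rw [mem_mcomps]
    intro h
    simp
  set S := ∑ h, r h with hS
  have hS1 : 1 ≤ S := by
    have := Finset.single_le_sum (f := r) (fun _ _ => Nat.zero_le _) (Finset.mem_univ ⟨0, hm0⟩)
    have h2 := hr ⟨0, hm0⟩
    omega
  set L : (Fin m → Fin N → ℕ) → MvPolynomial (Fin m × Fin N) A.O :=
    fun w => lsub (fun _ => W') (monomial (ex w) 1) with hL
  have hLb : ∀ w ∈ mcomps m N r, ∀ d, A.ν (coeff d (L w)) ≤ B ^ S := by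
    intro w hw d
    have h1 : ∀ _ : Fin m × Fin N, (0:ℝ) ≤ 1 := fun _ => zero_le_one
    have h2 := coeff_le_pN A.ν h1 (L w) d
    rw [mev_one, mul_one] at h2
    refine h2.trans ((pN_aeval_le A.ν h1 A.ν1 _ _).trans ?_)
    rw [pN_monomial]
    have h3 : mev (fun x : Fin m × Fin N => pN A.ν (fun _ : Fin m × Fin N => (1:ℝ))
        (∑ s, C (W' x.2 s) * X (x.1, s))) (ex w) ≤ B ^ S := by
      have e1 : B ^ S = mev (fun _ : Fin m × Fin N => B) (ex w) := by
        rw [mev, Finset.prod_pow_eq_pow_sum, Fintype.sum_prod_type]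
        congr 1
        refine Finset.sum_congr rfl fun h _ => ?_
        rw [mem_mcomps] at hw
        exact (hw h).symm
      rw [e1]
      refine Finset.prod_le_prod (fun x _ => pow_nonneg (pN_nonneg A.ν h1 _) _) fun x _ =>
        pow_le_pow_left₀ (pN_nonneg A.ν h1 _) ?_ _
      refine (pN_sum_le A.ν h1 _ _).trans (le_trans (Finset.sum_le_sum fun s _ => ?_) (hrow x.2))
      refine (pN_mul_le A.ν h1 _ _).trans ?_
      rw [pN_C, pN_X, mul_one]
      exact mul_le_of_le_one_right (apply_nonneg _ _) A.ν1
    have h4 := apply_nonneg A.ν (1 : A.O)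
    have h5 := A.ν1
    have h6 : 0 ≤ B ^ S := by positivity
    calc _ ≤ A.ν 1 * B ^ S := mul_le_mul_of_nonneg_left h3 h4
      _ ≤ _ := mul_le_of_le_one_left h6 h5
  have hH1 : 1 ≤ (1 + A.K) * B ^ S := by
    have := one_le_pow₀ hB1 (n := S); nlinarith
  obtain ⟨t, ht0, ht, htb⟩ := siegel_int (α := {v // v ∈ bad} × Fin A.D) (β := {v // v ∈ mcomps m N r})
    (fun i w => A.c i.2 (coeff (ex i.1.1) (L w.1))) (by simpa using hcard) (by simpa using hne)
    ((1 + A.K) * B ^ S) hH1 (by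
      intro i w
      refine (A.c_le _ _).trans ?_
      have h1 := hLb w.1 w.2 (ex i.1.1)
      have h2 : 0 ≤ B ^ S := by positivity
      nlinarith [mul_le_mul_of_nonneg_left h1 hK])
  set P : MvPolynomial (Fin m × Fin N) ℤ := ∑ w : {v // v ∈ mcomps m N r}, monomial (ex w.1) (t w) with hP
  have hPc : ∀ w : {v // v ∈ mcomps m N r}, coeff (ex w.1) P = t w := by
    intro w
    rw [hP, coeff_sum, Finset.sum_eq_single w]
    · simp
    · intro w' _ hw
      rw [coeff_monomial, if_neg]
      intro h
      exact hw (Subtype.ext (ex_injective h))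
    · simp
  have hPc0 : ∀ d, coeff d P ≠ 0 → ∃ w : {v // v ∈ mcomps m N r}, ex w.1 = d := by
    intro d hd
    by_contra hcon
    push Not at hcon
    apply hd
    rw [hP, coeff_sum]
    refine Finset.sum_eq_zero fun w _ => ?_
    rw [coeff_monomial, if_neg (hcon w)]
  have hmh : mh r P := by
    intro d hd h
    obtain ⟨w, rfl⟩ := hPc0 d (mem_support_iff.1 hd)
    have := w.2
    rw [mem_mcomps] at this
    exact this h
  refine ⟨P, ?_, hmh, ?_, ?_⟩
  · intro h0
    apply ht0
    funext w
    rw [← hPc w, h0]; simp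
  · intro d
    by_cases hd : coeff d P = 0
    · rw [hd]; simp; positivity
    · obtain ⟨w, rfl⟩ := hPc0 d hd
      rw [hPc]
      refine (htb w).trans ?_
      have h1 := card_mcomps_le (N := N) r
      rw [Fintype.card_coe, mul_pow, mul_pow]
      refine mul_le_mul h1 ?_ (by linarith) (by positivity)
      refine mul_le_mul_of_nonneg_right ?_ (by positivity)
      exact le_self_pow₀ (by linarith) (by omega)
  · intro d hd k
    by_contra hcon
    push Not at hcon
    rw [mem_support_iff] at hd
    have hmhR : mh r (map (Int.castRingHom ℝ) P) := fun e he => hmh e (support_map_subset _ _ he)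
    have hdv : (fun h l => d (h, l)) ∈ mcomps m N r := by
      rw [mem_mcomps]
      exact fun h => (hmhR.lsub (fun _ => W)) d (mem_support_iff.2 hd) h
    have hbd : (fun h l => d (h, l)) ∈ bad := by
      rw [hbad, Finset.mem_filter]
      exact ⟨hdv, k, hcon⟩
    have hz : coeff d (lsub (fun _ => W') (map (Int.castRingHom A.O) P)) = 0 := by
      apply A.c_inj
      intro τ
      have h1 := congrFun ht (⟨_, hbd⟩, τ)
      rw [hP, map_sum, map_sum, coeff_sum, map_sum]
      change ∑ w : {v // v ∈ mcomps m N r}, A.c τ (coeff (ex fun h l => d (h, l)) (L w.1)) * t w = 0 at h1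
      rw [ex_curry] at h1
      rw [← h1]
      refine Finset.sum_congr rfl fun w _ => ?_
      rw [map_monomial]
      have e1 : (monomial (ex w.1) ((Int.castRingHom A.O) (t w)) : MvPolynomial (Fin m × Fin N) A.O) =
          t w • monomial (ex w.1) 1 := by
        rw [← map_zsmul]; simp
      rw [e1, map_zsmul, coeff_smul, map_zsmul, smul_eq_mul, mul_comm]
    have h2 := congrArg A.φ hz
    rw [map_zero, ← coeff_map, map_lsub, map_map, hWmap] at h2
    have e2 : A.φ.comp (Int.castRingHom A.O) = Int.castRingHom ℝ := RingHom.ext_int _ _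
    rw [e2, ← lsub_lsub (fun _ => (A.s : ℝ) • (1 : Matrix (Fin N) (Fin N) ℝ)) (fun _ => W), lsub_scalar] at h2
    rcases mul_eq_zero.1 h2 with h3 | h3
    · have h4 : (A.s : ℝ) ≠ 0 := by have := A.hs; positivity
      exact pow_ne_zero _ h4 h3
    · exact hd h3
end SST
end

section
namespace SST
open Matrix

lemma abs_det_le {ι : Type*} [Fintype ι] [DecidableEq ι] (A : Matrix ι ι ℝ) (β : ι → ℝ)
    (h : ∀ i j, |A i j| ≤ β j) : |A.det| ≤ (Fintype.card ι).factorial * ∏ j, β j := by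
  rw [det_apply]
  refine (Finset.abs_sum_le_sum_abs _ _).trans ?_
  have h1 : ∀ s : Equiv.Perm ι, |Equiv.Perm.sign s • ∏ i, A (s i) i| ≤ ∏ j, β j := by
    intro s
    have h2 : |Equiv.Perm.sign s • ∏ i, A (s i) i| = |∏ i, A (s i) i| := by
      rcases Int.units_eq_one_or (Equiv.Perm.sign s) with h | h
      · rw [h, one_smul]
      · rw [h, Units.neg_smul, one_smul, abs_neg]
    rw [h2, Finset.abs_prod]
    exact Finset.prod_le_prod (fun _ _ => abs_nonneg _) fun i _ => h _ _
  refine (Finset.sum_le_sum fun s _ => h1 s).trans ?_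
  simp [Fintype.card_perm]

lemma algebraic_inv {ι : Type*} [Fintype ι] [DecidableEq ι] (M : Matrix ι ι ℝ)
    (h : ∀ i j, IsAlgebraic ℚ (M i j)) : ∀ i j, IsAlgebraic ℚ (M⁻¹ i j) := by
  set K := algebraicClosure ℚ ℝ
  let M0 : Matrix ι ι K := Matrix.of fun i j => ⟨M i j, (mem_algebraicClosure_iff.2 (h i j))⟩
  let f : K →+* ℝ := (algebraMap K ℝ)
  have h1 : M = f.mapMatrix M0 := by ext i j; rfl
  intro i j
  rw [inv_def, h1, ← RingHom.map_adjugate, ← RingHom.map_det, Ring.inverse_eq_inv', ← map_inv₀]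
  have : (f (M0.det)⁻¹ • f.mapMatrix M0.adjugate) i j = f ((M0.det)⁻¹ * M0.adjugate i j) := by
    simp
  rw [this]
  exact mem_algebraicClosure_iff.1 ((M0.det)⁻¹ * M0.adjugate i j).2

lemma algebraic_det {ι : Type*} [Fintype ι] [DecidableEq ι] (M : Matrix ι ι ℝ)
    (h : ∀ i j, IsAlgebraic ℚ (M i j)) : IsAlgebraic ℚ M.det := by
  set K := algebraicClosure ℚ ℝ
  let M0 : Matrix ι ι K := Matrix.of fun i j => ⟨M i j, (mem_algebraicClosure_iff.2 (h i j))⟩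
  let f : K →+* ℝ := (algebraMap K ℝ)
  have h1 : M = f.mapMatrix M0 := by ext i j; rfl
  rw [h1, ← RingHom.map_det]
  exact mem_algebraicClosure_iff.1 (M0.det).2

/-- generalized cross product -/
def wdg {R : Type*} [CommRing R] {n : ℕ} (v : Fin n → Fin (n+1) → R) (l : Fin (n+1)) : R :=
  (-1) ^ (l : ℕ) * (Matrix.of fun i j => v i (l.succAbove j)).det

lemma det_cons {R : Type*} [CommRing R] {n : ℕ} (v : Fin n → Fin (n+1) → R) (x : Fin (n+1) → R) :
    (Matrix.of (Fin.cons x v : Fin (n+1) → Fin (n+1) → R)).det = ∑ l, x l * wdg v l := by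
  rw [det_succ_row_zero]
  refine Finset.sum_congr rfl fun l _ => ?_
  rw [wdg]
  have : (Matrix.of (Fin.cons x v : Fin (n+1) → Fin (n+1) → R)).submatrix Fin.succ l.succAbove =
    Matrix.of fun i j => v i (l.succAbove j) := by ext i j; simp
  rw [this]; simp; ring

lemma wdg_cast {n : ℕ} (v : Fin n → Fin (n+1) → ℤ) (l) :
    ((wdg v l : ℤ) : ℝ) = wdg (fun j l => (v j l : ℝ)) l := by
  rw [wdg, wdg]
  push_cast
  congr 2

lemma perp_prop {n : ℕ} (v : Fin n → Fin (n+1) → ℤ) (x : Fin (n+1) → ℤ) (hx : ∀ j, ∑ l, x l * v j l = 0)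
    (i l) : x i * wdg v l = x l * wdg v i := by
  by_cases hx0 : x = 0
  · simp [hx0]
  have h1 : (Matrix.of (Fin.cons (x i • Pi.single l 1 - x l • Pi.single i 1) v :
      Fin (n+1) → Fin (n+1) → ℤ)).det = 0 := by
    rw [← exists_mulVec_eq_zero_iff]
    refine ⟨x, hx0, ?_⟩
    funext j
    refine Fin.cases ?_ (fun j => ?_) j
    · simp only [mulVec, dotProduct, of_apply, Fin.cons_zero, Pi.zero_apply]
      simp [sub_mul, Finset.sum_sub_distrib, Pi.single_apply]
      ring
    · simp only [mulVec, dotProduct, of_apply, Fin.cons_succ, Pi.zero_apply]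
      rw [← hx j]
      exact Finset.sum_congr rfl fun l _ => mul_comm _ _
  rw [det_cons] at h1
  simp [sub_mul, Finset.sum_sub_distrib, Pi.single_apply] at h1
  linarith

/-- primitive vector -/
def Prim {ι : Type*} [Fintype ι] (a : ι → ℤ) : Prop := ∃ c : ι → ℤ, ∑ l, c l * a l = 1

lemma Prim.prop {ι : Type*} [Fintype ι] {a w : ι → ℤ} (ha : Prim a)
    (h : ∀ i l, a i * w l = a l * w i) : ∃ g : ℤ, ∀ i, w i = g * a i := by
  obtain ⟨c, hc⟩ := ha
  refine ⟨∑ l, c l * w l, fun i => ?_⟩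
  rw [Finset.sum_mul]
  calc w i = (∑ l, c l * a l) * w i := by rw [hc, one_mul]
    _ = _ := by
      rw [Finset.sum_mul]
      refine Finset.sum_congr rfl fun l _ => ?_
      have := h i l
      linear_combination (-c l) * this

lemma Prim.ne_zero {ι : Type*} [Fintype ι] {a : ι → ℤ} (ha : Prim a) : a ≠ 0 := by
  rintro rfl
  obtain ⟨c, hc⟩ := ha
  simp at hc

/-- The data appearing in the main intermediate theorem. -/
structure Good {n : ℕ} (M : Matrix (Fin (n+1)) (Fin (n+1)) ℝ) (b : Fin (n+1) → ℝ)
    (a : Fin (n+1) → ℤ) (Q : ℝ) (v : Fin n → Fin (n+1) → ℤ) : Prop where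
  prim : Prim a
  hQ : 1 ≤ Q
  li : LinearIndependent ℤ v
  perp : ∀ j, ∑ l, a l * v j l = 0
  le : ∀ j k, |∑ l, M k l * v j l| ≤ Q ^ b k

lemma det_ne_zero_of_perp {n : ℕ} {v : Fin n → Fin (n+1) → ℤ} (li : LinearIndependent ℤ v)
    {a : Fin (n+1) → ℤ} (perp : ∀ j, ∑ l, a l * v j l = 0) {i} (hi : a i ≠ 0) :
    (Matrix.of (Fin.cons (Pi.single i 1) v : Fin (n+1) → Fin (n+1) → ℤ)).det ≠ 0 := by
  intro h0
  rw [← exists_vecMul_eq_zero_iff] at h0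
  obtain ⟨c, hc0, hc⟩ := h0
  have h1 : ∀ l, c 0 * (Pi.single i 1 : Fin (n+1) → ℤ) l + ∑ j : Fin n, c j.succ * v j l = 0 := by
    intro l
    have := congrFun hc l
    simpa [vecMul, dotProduct, Fin.sum_univ_succ] using this
  have h2 : c 0 * a i = 0 := by
    have : ∑ l, a l * (c 0 * (Pi.single i 1 : Fin (n+1) → ℤ) l + ∑ j : Fin n, c j.succ * v j l) = 0 :=
      Finset.sum_eq_zero fun l _ => by rw [h1 l, mul_zero]
    simp only [mul_add, Finset.sum_add_distrib, Finset.mul_sum] at this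
    rw [Finset.sum_comm] at this
    have h3 : ∑ j : Fin n, ∑ l, a l * (c j.succ * v j l) = 0 := by
      refine Finset.sum_eq_zero fun j _ => ?_
      rw [← mul_zero (c j.succ), ← perp j, Finset.mul_sum]
      exact Finset.sum_congr rfl fun l _ => by ring
    rw [h3, add_zero] at this
    simp [Pi.single_apply] at this
    rcases this with h | h <;> simp [h]
  have hc00 : c 0 = 0 := by
    rcases mul_eq_zero.1 h2 with h | h
    · exact h
    · exact absurd h hi
  have h4 : ∑ j : Fin n, c j.succ • v j = 0 := by
    funext l
    have := h1 l
    rw [hc00, zero_mul, zero_add] at this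
    simpa using this
  have h5 := Fintype.linearIndependent_iff.1 li _ h4
  apply hc0
  funext j
  refine Fin.cases hc00 (fun j => h5 j) j

lemma Good.wdg_eq {n : ℕ} {M : Matrix (Fin (n+1)) (Fin (n+1)) ℝ} {b : Fin (n+1) → ℝ}
    {a : Fin (n+1) → ℤ} {Q : ℝ} {v : Fin n → Fin (n+1) → ℤ} (h : Good M b a Q v) :
    ∃ g : ℤ, g ≠ 0 ∧ ∀ i, wdg v i = g * a i := by
  obtain ⟨g, hg⟩ := h.prim.prop (w := wdg v) (fun i l => perp_prop v a h.perp i l)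
  refine ⟨g, ?_, hg⟩
  rintro rfl
  obtain ⟨i, hi⟩ := Function.ne_iff.1 h.prim.ne_zero
  apply det_ne_zero_of_perp h.li h.perp hi
  rw [det_cons]
  simp [hg]

/-- dual form value -/
def dualM {n : ℕ} (M : Matrix (Fin n) (Fin n) ℝ) (i : Fin n) (x : Fin n → ℤ) : ℝ :=
  ∑ l, M⁻¹ l i * x l

lemma dualM_dot {n : ℕ} {M : Matrix (Fin n) (Fin n) ℝ} (hM : M.det ≠ 0) (x v : Fin n → ℤ) :
    ((∑ l, x l * v l : ℤ) : ℝ) = ∑ i, dualM M i x * ∑ l, M i l * v l := by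
  have h1 : M⁻¹ * M = 1 := nonsing_inv_mul _ (isUnit_iff_ne_zero.2 hM)
  have h2 : ∀ l l', ∑ i, M⁻¹ l i * M i l' = if l = l' then 1 else 0 := by
    intro l l'
    have := congrFun (congrFun h1 l) l'
    rw [mul_apply, one_apply] at this
    exact this
  have h3 : ∑ i, dualM M i x * ∑ l, M i l * v l =
      ∑ l, ∑ l', (∑ i, M⁻¹ l i * M i l') * (x l * v l') := by
    simp only [dualM, Finset.sum_mul, Finset.mul_sum]
    rw [Finset.sum_comm]
    rw [Finset.sum_congr rfl fun l _ => Finset.sum_comm]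
    rw [Finset.sum_comm]
    refine Finset.sum_congr rfl fun i _ => ?_
    refine Finset.sum_congr rfl fun l _ => ?_
    refine Finset.sum_congr rfl fun l' _ => ?_
    ring
  rw [h3]
  simp [h2]

lemma Good.coord_le {n : ℕ} {M : Matrix (Fin (n+1)) (Fin (n+1)) ℝ} (hM : M.det ≠ 0) (b : Fin (n+1) → ℝ) :
    ∃ C : ℝ, 1 ≤ C ∧ ∃ E : ℝ, 0 ≤ E ∧ ∀ a Q v, Good M b a Q v → ∀ l, |(a l : ℝ)| ≤ C * Q ^ E := by
  have h1 : M⁻¹ * M = 1 := nonsing_inv_mul _ (isUnit_iff_ne_zero.2 hM)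
  set C1 : ℝ := 1 + ∑ l, ∑ k, |M⁻¹ l k| with hC1
  have hC0 : 0 ≤ ∑ l, ∑ k, |M⁻¹ l k| :=
    Finset.sum_nonneg fun _ _ => Finset.sum_nonneg fun _ _ => abs_nonneg _
  set bb : ℝ := ∑ k, |b k| with hbb
  have hbb0 : 0 ≤ bb := Finset.sum_nonneg fun _ _ => abs_nonneg _
  refine ⟨n.factorial * C1 ^ n, ?_, bb * n, by positivity, ?_⟩
  · have h2 : (1:ℝ) ≤ n.factorial := by exact_mod_cast Nat.factorial_pos n
    have h3 : (1:ℝ) ≤ C1 ^ n := one_le_pow₀ (by linarith)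
    nlinarith
  intro a Q v h l
  have hQ := h.hQ
  have hv : ∀ j l, |(v j l : ℝ)| ≤ C1 * Q ^ bb := by
    intro j l
    have e1 : (v j l : ℝ) = ∑ k, M⁻¹ l k * ∑ l', M k l' * v j l' := by
      have := congrFun (congrArg (fun A => A *ᵥ (fun l' => (v j l' : ℝ))) h1) l
      simp only [one_mulVec] at this
      rw [← this, ← mulVec_mulVec]
      rfl
    rw [e1]
    refine (Finset.abs_sum_le_sum_abs _ _).trans ?_
    have e2 : ∀ k, |M⁻¹ l k * ∑ l', M k l' * v j l'| ≤ |M⁻¹ l k| * Q ^ bb := by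
      intro k
      rw [abs_mul]
      refine mul_le_mul_of_nonneg_left ((h.le j k).trans ?_) (abs_nonneg _)
      refine Real.rpow_le_rpow_of_exponent_le hQ ?_
      exact (le_abs_self _).trans
        (Finset.single_le_sum (f := fun k => |b k|) (fun _ _ => abs_nonneg _) (Finset.mem_univ k))
    refine (Finset.sum_le_sum fun k _ => e2 k).trans ?_
    rw [← Finset.sum_mul]
    refine mul_le_mul_of_nonneg_right ?_ (by positivity)
    have := Finset.single_le_sum (f := fun l => ∑ k, |M⁻¹ l k|)
      (fun _ _ => Finset.sum_nonneg fun _ _ => abs_nonneg _) (Finset.mem_univ l)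
    linarith
  obtain ⟨g, hg, hw⟩ := h.wdg_eq
  have h3 : |(a l : ℝ)| ≤ |((wdg v l : ℤ) : ℝ)| := by
    rw [hw l]; push_cast; rw [abs_mul]
    have : (1:ℝ) ≤ |(g:ℝ)| := by
      have := Int.one_le_abs hg
      exact_mod_cast this
    nlinarith [abs_nonneg (a l : ℝ)]
  refine h3.trans ?_
  rw [wdg_cast, wdg, abs_mul]
  have h4 : |(-1:ℝ) ^ (l:ℕ)| = 1 := by simp [abs_pow]
  rw [h4, one_mul]
  refine (abs_det_le _ (fun _ => C1 * Q ^ bb) fun i j => by simpa using hv i _).trans ?_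
  rw [Finset.prod_const, Finset.card_univ, Fintype.card_fin, mul_pow, ← Real.rpow_natCast (Q ^ bb),
    ← Real.rpow_mul (by linarith)]
  rw [mul_assoc]

lemma Good.dual_le {n : ℕ} {M : Matrix (Fin (n+1)) (Fin (n+1)) ℝ} (hM : M.det ≠ 0) {b : Fin (n+1) → ℝ}
    {a Q v} (h : Good M b a Q v) (i) :
    |dualM M i a| * |M.det| ≤ n.factorial * Q ^ ((∑ k, b k) - b i) := by
  have hQ := h.hQ
  obtain ⟨g, hg, hw⟩ := h.wdg_eq
  have h3 : |dualM M i a| ≤ |∑ l, M⁻¹ l i * wdg (fun j l => (v j l : ℝ)) l| := by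
    have : ∑ l, M⁻¹ l i * wdg (fun j l => (v j l : ℝ)) l = g * dualM M i a := by
      rw [dualM, Finset.mul_sum]
      refine Finset.sum_congr rfl fun l _ => ?_
      rw [← wdg_cast, hw]; push_cast; ring
    rw [this, abs_mul]
    have : (1:ℝ) ≤ |(g:ℝ)| := by
      have := Int.one_le_abs hg
      exact_mod_cast this
    nlinarith [abs_nonneg (dualM M i a)]
  refine (mul_le_mul_of_nonneg_right h3 (abs_nonneg _)).trans ?_
  set B := (Matrix.of (Fin.cons (fun l => M⁻¹ l i) (fun j l => (v j l : ℝ)) :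
    Fin (n+1) → Fin (n+1) → ℝ)) with hB
  have h4 : B.det = ∑ l, M⁻¹ l i * wdg (fun j l => (v j l : ℝ)) l := det_cons _ _
  rw [← h4, ← abs_mul, ← det_transpose M, ← det_mul]
  have h5 : B * Mᵀ = Matrix.of (Fin.cons (Pi.single i 1) (fun j k => ∑ l, M k l * v j l) :
      Fin (n+1) → Fin (n+1) → ℝ) := by
    ext s k
    rw [mul_apply]
    refine Fin.cases ?_ (fun j => ?_) s
    · simp only [hB, of_apply, Fin.cons_zero, transpose_apply]
      have : M * M⁻¹ = 1 := mul_nonsing_inv _ (isUnit_iff_ne_zero.2 hM)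
      have := congrFun (congrFun this k) i
      rw [mul_apply, one_apply] at this
      rw [Pi.single_apply, ← this]
      exact Finset.sum_congr rfl fun l _ => mul_comm _ _
    · simp only [hB, of_apply, Fin.cons_succ, transpose_apply]
      exact Finset.sum_congr rfl fun l _ => mul_comm _ _
  rw [h5, det_cons, Finset.sum_eq_single i (by intro l _ hl; simp [hl]) (by simp), Pi.single_eq_same,
    one_mul, wdg, abs_mul]
  have h4 : |(-1:ℝ) ^ (i:ℕ)| = 1 := by simp [abs_pow]
  rw [h4, one_mul]
  refine (abs_det_le _ (fun j => Q ^ b (i.succAbove j)) fun s j => by simpa using h.le s _).trans ?_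
  rw [Fintype.card_fin, ← Real.rpow_sum_of_pos (by linarith), Fin.sum_univ_succAbove b i]
  simp

lemma nu_int {O : Type*} [CommRing O] (ν : RingSeminorm O) (y : O) (k : ℤ) : ν (k • y) ≤ |(k:ℝ)| * ν y := by
  have hn : ∀ k : ℕ, ν (k • y) ≤ k * ν y := by
    intro k
    induction k with
    | zero => simp
    | succ k ih =>
      rw [succ_nsmul]; push_cast
      have := map_add_le_add ν (k • y) y
      linarith
  rcases Int.natAbs_eq k with h | h
  · have := hn k.natAbs
    rw [h, natCast_zsmul]; simpa using this
  · have := hn k.natAbs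
    rw [h, neg_smul, map_neg_eq_map, natCast_zsmul]; simpa using this

lemma dual_liou {n : ℕ} {M : Matrix (Fin n) (Fin n) ℝ} (hM : ∀ i j, IsAlgebraic ℚ (M i j)) :
    ∃ c : ℝ, 0 < c ∧ ∃ D : ℕ, ∀ (a : Fin n → ℤ) (A : ℝ), 1 ≤ A → (∀ l, |(a l : ℝ)| ≤ A) →
      ∀ i, dualM M i a ≠ 0 → c ≤ |dualM M i a| * A ^ D := by
  obtain ⟨A⟩ := exists_algData (fun p : Fin n × Fin n => M⁻¹ p.1 p.2) (fun p => algebraic_inv M hM _ _)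
  set H : ℝ := 1 + ∑ p, A.ν (A.x' p) with hH
  have hH1 : 1 ≤ H := by
    have : 0 ≤ ∑ p, A.ν (A.x' p) := Finset.sum_nonneg fun _ _ => apply_nonneg _ _
    linarith
  have hs : (0:ℝ) < A.s := by exact_mod_cast A.hs
  refine ⟨A.κ / (A.s * H ^ A.D), div_pos A.hκ (by positivity), A.D, ?_⟩
  intro a B hB ha i hi
  set y : A.O := ∑ l, a l • A.x' (l, i) with hy
  have h1 : A.φ y = A.s * dualM M i a := by
    rw [hy, map_sum, dualM, Finset.mul_sum]
    refine Finset.sum_congr rfl fun l _ => ?_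
    rw [map_zsmul, A.hx', zsmul_eq_mul]; ring
  have hy0 : y ≠ 0 := by
    intro h
    rw [h, map_zero] at h1
    rcases mul_eq_zero.1 h1.symm with h2 | h2
    · linarith
    · exact hi h2
  have h2 := A.liou y hy0
  have h3 : A.ν y ≤ H * B := by
    have h4 : A.ν y ≤ ∑ l, A.ν (a l • A.x' (l, i)) := by
      rw [hy]
      exact Finset.le_sum_of_subadditive A.ν (map_zero A.ν).le (map_add_le_add A.ν) _ _
    refine h4.trans ?_
    have h5 : ∀ l, A.ν (a l • A.x' (l, i)) ≤ B * A.ν (A.x' (l, i)) := fun l =>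
      (nu_int _ _ _).trans (mul_le_mul_of_nonneg_right (ha l) (apply_nonneg _ _))
    refine (Finset.sum_le_sum fun l _ => h5 l).trans ?_
    rw [← Finset.mul_sum, mul_comm]
    refine mul_le_mul_of_nonneg_right ?_ (by linarith)
    have h6 : ∑ l, A.ν (A.x' (l, i)) ≤ ∑ p, A.ν (A.x' p) := by
      rw [Fintype.sum_prod_type]
      exact Finset.sum_le_sum fun l _ =>
        Finset.single_le_sum (f := fun k => A.ν (A.x' (l, k))) (fun _ _ => apply_nonneg _ _) (Finset.mem_univ i)
    linarith
  have h4 : max 1 (A.ν y) ≤ H * B := max_le (by nlinarith) h3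
  have h5 : (max 1 (A.ν y)) ^ A.D ≤ (H * B) ^ A.D := pow_le_pow_left₀ (by positivity) h4 _
  rw [div_le_iff₀ (by positivity)]
  refine h2.trans ((mul_le_mul_of_nonneg_left h5 (abs_nonneg _)).trans ?_)
  rw [h1, abs_mul, abs_of_pos hs, mul_pow]
  apply le_of_eq; ring
end SST
end

section
namespace SST
open Matrix Filter

lemma eventually_rpow_lt (C e δ : ℝ) (hδ : 0 < δ) (he : 0 < e) : ∀ᶠ Q : ℝ in atTop, C * Q ^ (-δ) < e := by
  have h1 : Tendsto (fun Q : ℝ => C * Q ^ (-δ)) atTop (nhds (C * 0)) :=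
    (tendsto_rpow_neg_atTop hδ).const_mul C
  rw [mul_zero] at h1
  exact h1.eventually (gt_mem_nhds he)

lemma int_eq_zero_of_abs_lt_one {z : ℤ} (h : |(z:ℝ)| < 1) : z = 0 := by
  have : |z| < 1 := by exact_mod_cast h
  exact Int.abs_lt_one_iff.1 this

/-- Points `a` that are small compared with `Q` lie in a finite set. -/
lemma Good.small {n : ℕ} {M : Matrix (Fin (n+1)) (Fin (n+1)) ℝ} (hM : M.det ≠ 0)
    (hMa : ∀ i j, IsAlgebraic ℚ (M i j)) (b : Fin (n+1) → ℝ) (hb : ∑ k, b k < 0) :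
    ∃ κ : ℝ, 0 < κ ∧ ∃ B0 : ℝ, ∀ᶠ Q : ℝ in atTop, ∀ a v, Good M b a Q v →
      (∀ l, |(a l : ℝ)| ≤ Q ^ κ) → ∀ l, |(a l : ℝ)| ≤ B0 := by
  classical
  obtain ⟨c, hc, D, hL⟩ := dual_liou hMa
  set β := -∑ k, b k with hβ
  have hβ0 : 0 < β := by linarith
  have hdet : 0 < |M.det| := abs_pos.2 hM
  have hex : ∀ J : Finset (Fin (n+1)), ∃ x : Fin (n+1) → ℤ,
      (∃ y : Fin (n+1) → ℤ, y ≠ 0 ∧ ∀ i ∉ J, dualM M i y = 0) → x ≠ 0 ∧ ∀ i ∉ J, dualM M i x = 0 := by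
    intro J
    by_cases h : ∃ y : Fin (n+1) → ℤ, y ≠ 0 ∧ ∀ i ∉ J, dualM M i y = 0
    · obtain ⟨y, hy⟩ := h; exact ⟨y, fun _ => hy⟩
    · exact ⟨0, fun h' => absurd h' h⟩
  choose bJ hbJ using hex
  refine ⟨β / (4 * (D + 1)), by positivity, ∑ J, ∑ l, |(bJ J l : ℝ)|, ?_⟩
  have hev2 : ∀ᶠ Q : ℝ in atTop, ∀ J, (∑ i, |dualM M i (bJ J)|) * Q ^ (-(β/4)) < 1 :=
    eventually_all.2 fun J => eventually_rpow_lt _ _ _ (by positivity) one_pos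
  filter_upwards [eventually_rpow_lt n.factorial (c * |M.det|) (β/2) (by positivity) (by positivity),
    hev2] with Q hQ1 hQ2 a v h hsm l
  have hQ := h.hQ
  set J : Finset (Fin (n+1)) := Finset.univ.filter fun i => dualM M i a ≠ 0 with hJ
  have hJb : ∀ i ∈ J, b i ≤ -(β/4) := by
    intro i hi
    have hi' := (Finset.mem_filter.1 hi).2
    by_contra hcon
    push Not at hcon
    have hA1 : 1 ≤ Q ^ (β / (4 * (D + 1))) := Real.one_le_rpow hQ (by positivity)
    have h1 := hL a _ hA1 hsm i hi'
    have h2 := h.dual_le hM i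
    have h3 : (Q ^ (β / (4 * (D + 1)))) ^ D ≤ Q ^ (β/4) := by
      rw [← Real.rpow_natCast, ← Real.rpow_mul (by linarith)]
      refine Real.rpow_le_rpow_of_exponent_le hQ ?_
      rw [div_mul_eq_mul_div, div_le_div_iff₀ (by positivity) (by norm_num)]
      nlinarith
    have h4 : Q ^ ((∑ k, b k) - b i) * Q ^ (β/4) ≤ Q ^ (-(β/2)) := by
      rw [← Real.rpow_add (by linarith)]
      exact Real.rpow_le_rpow_of_exponent_le hQ (by linarith)
    have h5 : c * |M.det| ≤ n.factorial * Q ^ (-(β/2)) := by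
      calc c * |M.det| ≤ (|dualM M i a| * (Q ^ (β / (4 * (D + 1)))) ^ D) * |M.det| :=
            mul_le_mul_of_nonneg_right h1 hdet.le
        _ ≤ (|dualM M i a| * Q ^ (β/4)) * |M.det| := by gcongr
        _ = (|dualM M i a| * |M.det|) * Q ^ (β/4) := by ring
        _ ≤ (n.factorial * Q ^ ((∑ k, b k) - b i)) * Q ^ (β/4) := by gcongr
        _ = n.factorial * (Q ^ ((∑ k, b k) - b i) * Q ^ (β/4)) := by ring
        _ ≤ _ := by gcongr
    linarith
  obtain ⟨hx0, hx⟩ := hbJ J ⟨a, h.prim.ne_zero, fun i hi => by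
    by_contra hcon; exact hi (Finset.mem_filter.2 ⟨Finset.mem_univ i, hcon⟩)⟩
  have hperp : ∀ j, ∑ l, bJ J l * v j l = 0 := by
    intro j
    apply int_eq_zero_of_abs_lt_one
    rw [dualM_dot hM]
    refine lt_of_le_of_lt (Finset.abs_sum_le_sum_abs _ _) (lt_of_le_of_lt ?_ (hQ2 J))
    rw [Finset.sum_mul]
    refine Finset.sum_le_sum fun i _ => ?_
    rw [abs_mul]
    by_cases hi : i ∈ J
    · refine mul_le_mul_of_nonneg_left ((h.le j i).trans ?_) (abs_nonneg _)
      exact Real.rpow_le_rpow_of_exponent_le hQ (hJb i hi)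
    · rw [hx i hi]; simp
  obtain ⟨g, hg, hw⟩ := h.wdg_eq
  have hpr : ∀ i l, a i * bJ J l = a l * bJ J i := by
    intro i l
    have := perp_prop v _ hperp l i
    rw [hw, hw] at this
    apply mul_left_cancel₀ hg
    linarith
  obtain ⟨g', hg'⟩ := h.prim.prop hpr
  have hg0 : g' ≠ 0 := by
    rintro rfl
    apply hx0; funext i; simp [hg' i]
  have h1 : |(a l : ℝ)| ≤ |(bJ J l : ℝ)| := by
    rw [hg' l]; push_cast; rw [abs_mul]
    have : (1:ℝ) ≤ |(g':ℝ)| := by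
      have := Int.one_le_abs hg0
      exact_mod_cast this
    nlinarith [abs_nonneg (a l : ℝ)]
  refine h1.trans ((Finset.single_le_sum (f := fun l => |(bJ J l : ℝ)|) (fun _ _ => abs_nonneg _)
    (Finset.mem_univ l)).trans ?_)
  exact Finset.single_le_sum (f := fun J => ∑ l, |(bJ J l : ℝ)|)
    (fun _ _ => Finset.sum_nonneg fun _ _ => abs_nonneg _) (Finset.mem_univ J)

/-- choice of the second coordinate -/
lemma exists_coord {n : ℕ} {a : Fin (n+1) → ℤ} (ha : Prim a) (i : Fin (n+1)) (hi : a i ≠ 0) (hn : 0 < n) :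
    ∃ j, j ≠ i ∧ ∃ p q : ℤ, 0 < q ∧ IsCoprime p q ∧ a i * p = - (a j * q) ∧ |a i| ≤ q ^ n := by
  by_contra hcon
  push Not at hcon
  have key : ∀ j, j ≠ i → ∃ q : ℤ, 0 < q ∧ a i ∣ a j * q ∧ q ^ n < |a i| := by
    intro j hj
    have hg : (Int.gcd (a i) (a j) : ℤ) ≠ 0 := by
      intro h
      have : Int.gcd (a i) (a j) = 0 := by exact_mod_cast h
      exact hi (Int.gcd_eq_zero_iff.1 this).1
    have hgp : 0 < Int.gcd (a i) (a j) := by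
      rcases Nat.eq_zero_or_pos (Int.gcd (a i) (a j)) with h | h
      · rw [h] at hg; simp at hg
      · exact h
    obtain ⟨x, hx⟩ := Int.gcd_dvd_left (a i) (a j)
    obtain ⟨y, hy⟩ := Int.gcd_dvd_right (a i) (a j)
    set g : ℤ := (Int.gcd (a i) (a j) : ℤ) with hgdef
    have hcop : IsCoprime x y := by
      have := Int.gcd_eq_gcd_ab (a i) (a j)
      rw [← hgdef] at this
      refine ⟨Int.gcdA (a i) (a j), Int.gcdB (a i) (a j), ?_⟩
      apply mul_left_cancel₀ hg
      rw [mul_one]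
      calc _ = (g * x) * Int.gcdA (a i) (a j) + (g * y) * Int.gcdB (a i) (a j) := by ring
        _ = _ := by rw [← hx, ← hy]; exact this.symm
    have hx0 : x ≠ 0 := by rintro rfl; apply hi; rw [hx]; simp
    rcases lt_or_gt_of_ne hx0 with hneg | hpos
    · refine ⟨-x, by linarith, ⟨-y, by rw [hx, hy]; ring⟩, ?_⟩
      exact hcon j hj y (-x) (by linarith) hcop.symm.neg_right (by rw [hx, hy]; ring)
    · refine ⟨x, hpos, ⟨y, by rw [hx, hy]; ring⟩, ?_⟩
      exact hcon j hj (-y) x hpos hcop.symm.neg_left (by rw [hx, hy]; ring)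
  choose! q hq0 hqd hql using key
  set PP := ∏ j ∈ Finset.univ.erase i, q j with hPP
  have hPi : 0 < PP := Finset.prod_pos fun j hj => hq0 j (Finset.ne_of_mem_erase hj)
  have hd : ∀ j, a i ∣ a j * PP := by
    intro j
    by_cases hj : j = i
    · subst hj; exact Dvd.intro _ rfl
    · rw [hPP, ← Finset.mul_prod_erase _ _ (Finset.mem_erase.2 ⟨hj, Finset.mem_univ j⟩), ← mul_assoc]
      exact Dvd.dvd.mul_right (hqd j hj) _
  obtain ⟨c, hc⟩ := ha
  have hd2 : a i ∣ PP := by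
    have : ∑ l, c l * (a l * PP) = PP := by
      simp only [← mul_assoc]; rw [← Finset.sum_mul, hc, one_mul]
    rw [← this]
    exact Finset.dvd_sum fun l _ => Dvd.dvd.mul_left (hd l) _
  have h1 : |a i| ≤ PP := by
    have := Int.le_of_dvd hPi ((abs_dvd _ _).2 hd2)
    exact this
  have hcard : (Finset.univ.erase i).card = n := by
    rw [Finset.card_erase_of_mem (Finset.mem_univ i)]; simp
  have h2 : PP ^ n < |a i| ^ n := by
    rw [hPP, ← Finset.prod_pow]
    calc _ < ∏ j ∈ Finset.univ.erase i, |a i| := by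
          refine Finset.prod_lt_prod_of_nonempty (fun j hj => pow_pos (hq0 j (Finset.ne_of_mem_erase hj)) _)
            (fun j hj => hql j (Finset.ne_of_mem_erase hj)) ?_
          rw [← Finset.card_pos, hcard]; exact hn
      _ = _ := by rw [Finset.prod_const, hcard]
  have h3 := pow_le_pow_left₀ (abs_nonneg _) h1 n
  linarith
end SST
end

section
namespace SST
open MvPolynomial

lemma pN_le_of_mev {R : Type*} [CommRing R] {σ : Type*} [Fintype σ] (ν : RingSeminorm R) {x : σ → ℝ}
    (P : MvPolynomial σ R) (K : ℝ) (h : ∀ d ∈ P.support, mev x d ≤ K) :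
    pN ν x P ≤ pN ν (fun _ => (1:ℝ)) P * K := by
  rw [pN, pN, Finset.sum_mul]
  refine Finset.sum_le_sum fun d hd => ?_
  rw [mev_one, mul_one]
  exact mul_le_mul_of_nonneg_left (h d hd) (apply_nonneg ν _)

lemma mh_card_support {R : Type*} [CommRing R] {m N : ℕ} {r : Fin m → ℕ}
    {P : MvPolynomial (Fin m × Fin N) R} (hP : mh r P) :
    (P.support.card : ℝ) ≤ ((2:ℝ) ^ N) ^ (∑ h, r h) := by
  refine le_trans ?_ (card_mcomps_le (N := N) r)
  have : P.support.card ≤ (mcomps m N r).card := by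
    refine Finset.card_le_card_of_injOn (fun d h l => d (h, l)) ?_ ?_
    · intro d hd
      rw [Finset.mem_coe, mem_mcomps]
      exact hP d hd
    · intro d _ d' _ h
      ext x
      exact congrFun (congrFun h x.1) x.2
  exact_mod_cast this

lemma mh_sum_eq {m N : ℕ} {r : Fin m → ℕ} {d : Fin m × Fin N →₀ ℕ} (h : ∀ h, ∑ l, d (h, l) = r h) :
    ∑ x, d x = ∑ h, r h := by
  rw [Fintype.sum_prod_type]
  exact Finset.sum_congr rfl fun i _ => h i

/-- seminorm on the reals -/
def nuR : RingSeminorm ℝ := normRingSeminorm ℝ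

lemma nuR_apply (a : ℝ) : nuR a = |a| := rfl

lemma nuR_one : nuR 1 ≤ 1 := by rw [nuR_apply]; simp

lemma pN_lin_le {m N : ℕ} {x : Fin m × Fin N → ℝ} (hx : ∀ i, 0 ≤ x i) (h : Fin m) (g : Fin N → ℝ) :
    pN nuR x (∑ s, C (g s) * X (h, s)) ≤ ∑ s, |g s| * x (h, s) := by
  refine (pN_sum_le nuR hx _ _).trans (Finset.sum_le_sum fun s _ => ?_)
  refine (pN_mul_le nuR hx _ _).trans ?_
  rw [pN_C, pN_X, nuR_apply, nuR_apply, abs_one, one_mul]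

/-- balanced exponents give a negative total exponent -/
lemma balanced_sum {m N : ℕ} (hN : 0 < N) (b : Fin N → ℝ) (Bb ε T : ℝ) (hBb : ∑ k, |b k| ≤ Bb)
    (hε : 0 < ε) (hT : 0 < T) (L : Fin m → ℝ) (r : Fin m → ℕ) (hr : ∀ h, 0 < r h)
    (h1 : ∀ h, T ≤ r h * L h) (h2 : ∀ h, r h * L h ≤ (1 + ε) * T)
    (d : Fin m × Fin N →₀ ℕ) (hd : ∀ h, ∑ l, d (h, l) = r h)
    (hbal : ∀ k, |∑ h, (d (h, k) : ℝ) / r h - m / N| ≤ ε * m) :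
    ∑ h, ∑ k, b k * L h * d (h, k) ≤ T * m * ((∑ k, b k) / N + 2 * ε * Bb) := by
  rw [Finset.sum_comm]
  have hm0 : (0:ℝ) ≤ m := Nat.cast_nonneg _
  have key : ∀ k, ∑ h, b k * L h * d (h, k) ≤ T * m * (b k / N + 2 * ε * |b k|) := by
    intro k
    set S := ∑ h, (d (h, k) : ℝ) / r h with hS
    have hSm : S ≤ m := by
      have : S ≤ ∑ h : Fin m, (1:ℝ) := by
        refine Finset.sum_le_sum fun h _ => ?_
        have hr' : (0:ℝ) < r h := by exact_mod_cast hr h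
        rw [div_le_one hr', ← hd h]
        exact_mod_cast Finset.single_le_sum (f := fun l => d (h, l)) (fun _ _ => Nat.zero_le _) (Finset.mem_univ k)
      simpa using this
    have e1 : ∑ h, b k * L h * d (h, k) ≤ T * (b k * S) + |b k| * ε * T * S := by
      rw [hS, Finset.mul_sum, Finset.mul_sum, Finset.mul_sum, ← Finset.sum_add_distrib]
      refine Finset.sum_le_sum fun h _ => ?_
      have hr' : (0:ℝ) < r h := by exact_mod_cast hr h
      set q := (d (h, k) : ℝ) / r h with hq
      have hq0 : 0 ≤ q := by positivity
      have e2 : b k * L h * d (h, k) = (b k * q) * T + (b k * q) * (r h * L h - T) := by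
        rw [hq]; field_simp; ring
      rw [e2]
      have e3 : (b k * q) * (r h * L h - T) ≤ (|b k| * q) * (ε * T) := by
        have f1 : 0 ≤ r h * L h - T := by linarith [h1 h]
        have f2 : r h * L h - T ≤ ε * T := by linarith [h2 h]
        have f3 : b k * q ≤ |b k| * q := mul_le_mul_of_nonneg_right (le_abs_self _) hq0
        calc _ ≤ (|b k| * q) * (r h * L h - T) := mul_le_mul_of_nonneg_right f3 f1
          _ ≤ _ := mul_le_mul_of_nonneg_left f2 (by positivity)
      linarith
    have e4 : b k * S ≤ b k * (m / N) + |b k| * (ε * m) := by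
      have : b k * (S - m / N) ≤ |b k| * (ε * m) := by
        refine (le_abs_self _).trans ?_
        rw [abs_mul]
        exact mul_le_mul_of_nonneg_left (hbal k) (abs_nonneg _)
      linarith
    have e5 : |b k| * ε * T * S ≤ |b k| * ε * T * m := mul_le_mul_of_nonneg_left hSm (by positivity)
    have e6 := mul_le_mul_of_nonneg_left e4 hT.le
    have e7 : T * m * (b k / N + 2 * ε * |b k|) = T * (b k * (m / N) + |b k| * (ε * m)) + |b k| * ε * T * m := by
      ring
    linarith
  refine (Finset.sum_le_sum fun k _ => key k).trans ?_
  rw [← Finset.mul_sum, Finset.sum_add_distrib, ← Finset.sum_div, ← Finset.mul_sum]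
  refine mul_le_mul_of_nonneg_left ?_ (by positivity)
  have := mul_le_mul_of_nonneg_left hBb (by positivity : 0 ≤ 2 * ε)
  linarith

set_option maxHeartbeats 2000000 in
lemma vanish {n : ℕ} {M : Matrix (Fin (n+1)) (Fin (n+1)) ℝ} (hM : M.det ≠ 0)
    (hMa : ∀ i j, IsAlgebraic ℚ (M i j)) (b : Fin (n+1) → ℝ) (hb : ∑ k, b k < 0) :
    ∃ m : ℕ, 0 < m ∧ ∃ θ : ℝ, 0 < θ ∧ ∃ Cc : ℝ, 1 ≤ Cc ∧ ∃ η : ℝ, 0 < η ∧ η ≤ 1 ∧ ∃ L0 : ℝ, 0 < L0 ∧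
      ∀ (L : Fin m → ℝ) (T : ℝ) (r : Fin m → ℕ), (∀ h, L0 ≤ L h) → 0 < T → (∀ h, 0 < r h) →
        (∀ h, T ≤ r h * L h) → (∀ h, r h * L h ≤ (1 + η) * T) →
        ∃ P : MvPolynomial (Fin m × Fin (n+1)) ℤ, P ≠ 0 ∧ mh r P ∧
          (∀ d, |((coeff d P : ℤ) : ℝ)| ≤ Cc ^ (∑ h, r h)) ∧
          ∀ G : Fin m → Matrix (Fin (n+1)) (Fin (n+1)) ℤ,
            (∀ h k (s : Fin n), |∑ l, M k l * G h l s.succ| ≤ Real.exp (b k * L h)) →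
            (∀ h, ∃ i, ∀ l, G h l 0 = if l = i then 1 else 0) →
            ∀ d ∈ (lsub G P).support, θ * m ≤ ∑ h, (d (h, 0) : ℝ) / r h := by
  classical
  set β := -∑ k, b k with hβ
  have hβ0 : 0 < β := by linarith
  set Bb := 1 + ∑ k, |b k| with hBb
  have hsb0 : 0 ≤ ∑ k, |b k| := Finset.sum_nonneg fun _ _ => abs_nonneg _
  have hβB : β ≤ Bb := by
    have : β ≤ ∑ k, |b k| := by
      rw [hβ, ← Finset.sum_neg_distrib]
      exact Finset.sum_le_sum fun k _ => neg_le_abs _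
    linarith
  have hBb0 : 1 ≤ Bb := by linarith
  set N : ℝ := ((n+1 : ℕ) : ℝ) with hN
  have hN1 : 1 ≤ N := by rw [hN]; exact_mod_cast Nat.succ_pos n
  set ε := β / (4 * N * Bb) with hε
  have hε0 : 0 < ε := by positivity
  have hε1 : ε ≤ 1 := by
    rw [hε, div_le_one (by positivity)]; nlinarith
  obtain ⟨m, hm, Cc, hCc, hP⟩ := aux_poly (Nat.succ_pos n) M⁻¹ (algebraic_inv M hMa) ε hε0
  have hm' : (0:ℝ) < m := by exact_mod_cast hm
  set C0 : ℝ := 1 + ∑ k, ∑ i, |M k i| with hC0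
  have hC0s : ∀ k i, |M k i| ≤ C0 := by
    intro k i
    have h1 := Finset.single_le_sum (f := fun i => |M k i|) (fun _ _ => abs_nonneg _) (Finset.mem_univ i)
    have h2 := Finset.single_le_sum (f := fun k => ∑ i, |M k i|)
      (fun _ _ => Finset.sum_nonneg fun _ _ => abs_nonneg _) (Finset.mem_univ k)
    linarith
  have hC01 : 1 ≤ C0 := by
    have : 0 ≤ ∑ k, ∑ i, |M k i| := Finset.sum_nonneg fun _ _ => Finset.sum_nonneg fun _ _ => abs_nonneg _
    linarith
  set C1 : ℝ := 1 + ∑ k, ∑ i, |M⁻¹ k i| with hC1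
  have hC1s : ∀ k, ∑ i, |M⁻¹ k i| ≤ C1 := by
    intro k
    have h2 := Finset.single_le_sum (f := fun k => ∑ i, |M⁻¹ k i|)
      (fun _ _ => Finset.sum_nonneg fun _ _ => abs_nonneg _) (Finset.mem_univ k)
    linarith
  have hC11 : 1 ≤ C1 := by
    have : 0 ≤ ∑ k, ∑ i, |M⁻¹ k i| := Finset.sum_nonneg fun _ _ => Finset.sum_nonneg fun _ _ => abs_nonneg _
    linarith
  set C2 : ℝ := C0 + n with hC2
  have hC21 : 1 ≤ C2 := by
    have : (0:ℝ) ≤ n := Nat.cast_nonneg _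
    linarith
  set C4 : ℝ := (2 ^ (n+1) * Cc) * C1 * C2 with hC4
  have h2N : (1:ℝ) ≤ 2 ^ (n+1) := one_le_pow₀ (by norm_num)
  have hC41 : 1 ≤ C4 := by
    have := one_le_mul_of_one_le_of_one_le h2N hCc
    have := one_le_mul_of_one_le_of_one_le this hC11
    exact one_le_mul_of_one_le_of_one_le this hC21
  have hlog : 0 ≤ Real.log C4 := Real.log_nonneg hC41
  refine ⟨m, hm, β / (8 * N * Bb), by positivity, Cc, hCc, ε, hε0, hε1,
    8 * N * (Real.log C4 + 1) / β, by positivity, ?_⟩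
  intro L T r hL hT hr hr1 hr2
  obtain ⟨P, hP0, hmh, hPc, hPb⟩ := hP r hr
  refine ⟨P, hP0, hmh, hPc, ?_⟩
  intro G hG hG0 d hd
  by_contra hcon
  push Not at hcon
  set L0 := 8 * N * (Real.log C4 + 1) / β with hL0
  have hL0p : 0 < L0 := by positivity
  have hLp : ∀ h, 0 < L h := fun h => lt_of_lt_of_le hL0p (hL h)
  set S := ∑ h, r h with hS
  set x : Fin m × Fin (n+1) → ℝ := fun p => if p.2 = 0 then Real.exp (-(Bb * L p.1)) else 1 with hx
  have hx0 : ∀ p, 0 ≤ x p := by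
    intro p; rw [hx]; dsimp only; split_ifs <;> positivity
  set PR := map (Int.castRingHom ℝ) P with hPR
  have hmhR : mh r PR := fun e he => hmh e (support_map_subset _ _ he)
  set Rp := lsub (fun _ : Fin m => M⁻¹) PR with hRp
  have hmhRp : mh r Rp := hmhR.lsub _
  have h1x : ∀ _ : Fin m × Fin (n+1), (0:ℝ) ≤ 1 := fun _ => zero_le_one
  have hmevle : ∀ (y : Fin m × Fin (n+1) → ℝ) (B : ℝ) (e : Fin m × Fin (n+1) →₀ ℕ), (∀ p, 0 ≤ y p) →
      (∀ p, y p ≤ B) → (∀ h, ∑ l, e (h, l) = r h) → mev y e ≤ B ^ S := by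
    intro y B e hy hyB he
    calc mev y e ≤ ∏ p, B ^ e p := Finset.prod_le_prod (fun p _ => pow_nonneg (hy p) _)
          fun p _ => pow_le_pow_left₀ (hy p) (hyB p) _
      _ = B ^ S := by rw [Finset.prod_pow_eq_pow_sum, mh_sum_eq he]
  -- size of P
  have hNP : pN nuR (fun _ => (1:ℝ)) PR ≤ ((2:ℝ) ^ (n+1) * Cc) ^ S := by
    have h1 : pN nuR (fun _ => (1:ℝ)) PR ≤ ∑ e ∈ PR.support, Cc ^ S := by
      refine Finset.sum_le_sum fun e _ => ?_
      rw [mev_one, mul_one, nuR_apply, hPR, coeff_map]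
      exact hPc e
    refine h1.trans ?_
    rw [Finset.sum_const, nsmul_eq_mul, mul_pow]
    exact mul_le_mul_of_nonneg_right (mh_card_support hmhR) (by positivity)
  have hNR : pN nuR (fun _ => (1:ℝ)) Rp ≤ ((2:ℝ) ^ (n+1) * Cc) ^ S * C1 ^ S := by
    refine (pN_aeval_le nuR h1x nuR_one _ _).trans ?_
    refine (pN_le_of_mev nuR _ (C1 ^ S) ?_).trans (mul_le_mul_of_nonneg_right hNP (by positivity))
    intro e he
    refine hmevle _ _ _ (fun p => pN_nonneg nuR h1x _) (fun p => ?_) (hmhR e he)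
    refine (pN_lin_le h1x _ _).trans ?_
    simpa using hC1s p.2
  -- change of basis
  have hPt : map (Int.castRingHom ℝ) (lsub G P) =
      lsub (fun h => M * (G h).map (Int.castRingHom ℝ)) Rp := by
    rw [hRp, lsub_lsub, map_lsub]
    congr 2
    funext h
    rw [← Matrix.mul_assoc, Matrix.nonsing_inv_mul _ (isUnit_iff_ne_zero.2 hM), Matrix.one_mul]
  have hx' : ∀ p : Fin m × Fin (n+1), pN nuR x (∑ s, C ((M * (G p.1).map (Int.castRingHom ℝ)) p.2 s) * X (p.1, s)) ≤
      C2 * Real.exp (b p.2 * L p.1) := by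
    intro p
    refine (pN_lin_le hx0 _ _).trans ?_
    rw [Fin.sum_univ_succ, hC2, add_mul]
    refine add_le_add ?_ ?_
    · obtain ⟨i, hi⟩ := hG0 p.1
      have e1 : (M * (G p.1).map (Int.castRingHom ℝ)) p.2 0 = M p.2 i := by
        rw [Matrix.mul_apply]
        simp [hi]
      rw [e1]
      refine mul_le_mul (hC0s _ _) ?_ (hx0 _) (by linarith)
      rw [hx]
      simp only [if_true]
      rw [Real.exp_le_exp]
      have e2 : -Bb ≤ b p.2 := by
        have := Finset.single_le_sum (f := fun k => |b k|) (fun _ _ => abs_nonneg _) (Finset.mem_univ p.2)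
        have h3 := neg_abs_le (b p.2)
        linarith
      have := mul_le_mul_of_nonneg_right e2 (hLp p.1).le
      linarith
    · have e3 : ∀ s : Fin n, |(M * (G p.1).map (Int.castRingHom ℝ)) p.2 s.succ| * x (p.1, s.succ) ≤
          Real.exp (b p.2 * L p.1) := by
        intro s
        have e4 : x (p.1, s.succ) = 1 := by rw [hx]; simp [Fin.succ_ne_zero]
        rw [e4, mul_one, Matrix.mul_apply]
        exact hG p.1 p.2 s
      refine (Finset.sum_le_sum fun s _ => e3 s).trans ?_
      simp
  have hNt : pN nuR x (map (Int.castRingHom ℝ) (lsub G P)) ≤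
      ((2:ℝ) ^ (n+1) * Cc) ^ S * C1 ^ S * (C2 ^ S * Real.exp (-(T * m * β / (2 * N)))) := by
    rw [hPt]
    refine (pN_aeval_le nuR hx0 nuR_one _ _).trans ?_
    refine (pN_mono nuR (fun p => pN_nonneg nuR hx0 _) hx' _).trans ?_
    refine (pN_le_of_mev nuR _ _ ?_).trans (mul_le_mul_of_nonneg_right hNR (by positivity))
    intro e he
    have e1 : mev (fun p : Fin m × Fin (n+1) => C2 * Real.exp (b p.2 * L p.1)) e =
        C2 ^ S * Real.exp (∑ h, ∑ k, b k * L h * e (h, k)) := by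
      rw [mev]
      simp only [mul_pow]
      rw [Finset.prod_mul_distrib, Finset.prod_pow_eq_pow_sum, mh_sum_eq (hmhRp e he),
        ← Fintype.sum_prod_type' (fun h k => b k * L h * e (h, k)), Real.exp_sum]
      congr 1
      refine Finset.prod_congr rfl fun p _ => ?_
      rw [← Real.exp_nat_mul]
      congr 1; ring
    rw [e1]
    refine mul_le_mul_of_nonneg_left ?_ (by positivity)
    rw [Real.exp_le_exp]
    refine (balanced_sum (Nat.succ_pos n) b Bb ε T (by linarith) hε0 hT L r hr hr1 hr2 e
      (hmhRp e he) (hPb e he)).trans ?_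
    have e2 : (∑ k, b k) / ((n+1 : ℕ) : ℝ) + 2 * ε * Bb = -(β / (2 * N)) := by
      have : ∑ k, b k = -β := by rw [hβ]; ring
      rw [this, ← hN, hε]; field_simp; norm_num
    change T * m * ((∑ k, b k) / ((n+1 : ℕ) : ℝ) + 2 * ε * Bb) ≤ _
    rw [e2]
    apply le_of_eq; ring
  have hco := (coeff_le_pN nuR hx0 (map (Int.castRingHom ℝ) (lsub G P)) d).trans hNt
  rw [coeff_map, nuR_apply] at hco
  have hmd : ∀ h, ∑ l, d (h, l) = r h := (hmh.lsub G) d hd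
  -- the weight of the monomial d
  have hmx : Real.exp (-(T * m * β / (4 * N))) ≤ mev x d := by
    have e1 : mev x d = Real.exp (-∑ h, Bb * L h * d (h, 0)) := by
      rw [mev, Fintype.prod_prod_type, ← Finset.sum_neg_distrib, Real.exp_sum]
      refine Finset.prod_congr rfl fun h _ => ?_
      rw [Fin.prod_univ_succ]
      simp only [hx, if_true, Fin.succ_ne_zero, if_false, one_pow, Finset.prod_const_one, mul_one]
      rw [← Real.exp_nat_mul]
      congr 1; ring
    rw [e1, Real.exp_le_exp, neg_le_neg_iff]
    have e2 : ∑ h, Bb * L h * d (h, 0) ≤ Bb * (2 * T) * ∑ h, (d (h, 0) : ℝ) / r h := by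
      rw [Finset.mul_sum]
      refine Finset.sum_le_sum fun h _ => ?_
      have hr' : (0:ℝ) < r h := by exact_mod_cast hr h
      have e3 : Bb * L h * d (h, 0) = Bb * (r h * L h) * ((d (h, 0) : ℝ) / r h) := by field_simp
      rw [e3]
      have e4 : r h * L h ≤ 2 * T := (hr2 h).trans (by nlinarith)
      gcongr
    refine e2.trans ((mul_le_mul_of_nonneg_left hcon.le (by positivity)).trans ?_)
    apply le_of_eq; field_simp; norm_num
  have hSb : (S : ℝ) * Real.log C4 < T * m * β / (4 * N) := by
    have e1 : (S : ℝ) * L0 ≤ 2 * T * m := by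
      rw [hS]; push_cast
      rw [Finset.sum_mul]
      have : ∑ h : Fin m, (r h : ℝ) * L0 ≤ ∑ h : Fin m, 2 * T := by
        refine Finset.sum_le_sum fun h _ => ?_
        have : (r h : ℝ) * L0 ≤ r h * L h := mul_le_mul_of_nonneg_left (hL h) (Nat.cast_nonneg _)
        refine this.trans ((hr2 h).trans (by nlinarith))
      refine this.trans (le_of_eq ?_)
      simp; ring
    have hS0 : (0:ℝ) < S := by
      have : 0 < S := by
        rw [hS]; exact Finset.sum_pos (fun h _ => hr h) ⟨⟨0, hm⟩, Finset.mem_univ _⟩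
      exact_mod_cast this
    have e2 : (S:ℝ) * (8 * N * (Real.log C4 + 1)) ≤ 2 * T * m * β := by
      rw [hL0, mul_div_assoc', div_le_iff₀ hβ0] at e1
      exact e1
    rw [lt_div_iff₀ (by positivity)]
    nlinarith [mul_pos hS0 (by linarith : (0:ℝ) < N)]
  have hfin : |((coeff d (lsub G P) : ℤ) : ℝ)| < 1 := by
    have e1 : ((2:ℝ) ^ (n+1) * Cc) ^ S * C1 ^ S * (C2 ^ S * Real.exp (-(T * m * β / (2 * N)))) =
        C4 ^ S * Real.exp (-(T * m * β / (2 * N))) := by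
      rw [hC4, mul_pow, mul_pow]; ring
    rw [e1] at hco
    have e2 : C4 ^ S = Real.exp (S * Real.log C4) := by
      rw [Real.exp_nat_mul, Real.exp_log (by linarith)]
    rw [e2, ← Real.exp_add] at hco
    have e3 := (mul_le_mul_of_nonneg_left hmx (abs_nonneg _)).trans hco
    have e4 : Real.exp (S * Real.log C4 + -(T * m * β / (2 * N))) < 1 * Real.exp (-(T * m * β / (4 * N))) := by
      rw [one_mul, Real.exp_lt_exp]
      have : T * m * β / (2 * N) = T * m * β / (4 * N) + T * m * β / (4 * N) := by field_simp; norm_num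
      linarith
    exact lt_of_mul_lt_mul_right (lt_of_le_of_lt e3 e4) (Real.exp_pos _).le
  exact (mem_support_iff.1 hd) (int_eq_zero_of_abs_lt_one hfin)
end SST
end

section
namespace SST
open MvPolynomial

section geY
variable {m : ℕ} {σ : Type*} (r : Fin m → ℕ)
/-- all coefficients have weight at least θ -/
def geY (F : MvPolynomial σ (MvPolynomial (Fin m) ℚ)) (θ : ℝ) : Prop := ∀ e, ge r (coeff e F) θ
variable {r}

lemma geY_nonpos (F : MvPolynomial σ (MvPolynomial (Fin m) ℚ)) {θ : ℝ} (h : θ ≤ 0) : geY r F θ :=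
  fun _ => ge_nonpos _ h

lemma geY.sum {ι : Type*} (S : Finset ι) {f : ι → MvPolynomial σ (MvPolynomial (Fin m) ℚ)} {θ : ℝ}
    (hf : ∀ i ∈ S, geY r (f i) θ) : geY r (∑ i ∈ S, f i) θ := by
  intro e
  rw [coeff_sum]
  exact ge.sum _ fun i hi => hf i hi e

lemma geY.mul {f g : MvPolynomial σ (MvPolynomial (Fin m) ℚ)} {θ η : ℝ} (hf : geY r f θ) (hg : geY r g η) :
    geY r (f * g) (θ + η) := by
  classical
  intro e
  rw [coeff_mul]
  exact ge.sum _ fun i _ => (hf _).mul (hg _)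

lemma geY.pow {f : MvPolynomial σ (MvPolynomial (Fin m) ℚ)} {θ : ℝ} (hf : geY r f θ) (k : ℕ) :
    geY r (f ^ k) (k * θ) := by
  induction k with
  | zero => exact geY_nonpos _ (by simp)
  | succ k ih =>
    rw [pow_succ]
    have := ih.mul hf
    convert this using 1
    push_cast; ring

lemma geY.prod {ι : Type*} (S : Finset ι) {f : ι → MvPolynomial σ (MvPolynomial (Fin m) ℚ)} {θ : ι → ℝ}
    (hf : ∀ i ∈ S, geY r (f i) (θ i)) : geY r (∏ i ∈ S, f i) (∑ i ∈ S, θ i) := by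
  classical
  induction S using Finset.induction_on with
  | empty => exact geY_nonpos _ (by simp)
  | insert a S ha ih =>
    rw [Finset.prod_insert ha, Finset.sum_insert ha]
    exact (hf a (Finset.mem_insert_self _ _)).mul (ih fun i hi => hf i (Finset.mem_insert_of_mem hi))

lemma geY_CX (h : Fin m) : geY r (C (X h) : MvPolynomial σ (MvPolynomial (Fin m) ℚ)) (1 / r h) := by
  classical
  intro e d hd
  rw [coeff_C] at hd
  split_ifs at hd
  · rw [support_X, Finset.mem_singleton] at hd
    subst hd
    rw [wt, Finset.sum_eq_single h]
    · simp
    · intro b _ hb; simp [hb.symm]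
    · simp
  · simp at hd
end geY

section spec
variable {m N : ℕ} (i j : Fin m → Fin N) (c : Fin m → Fin N → ℚ) (ξ : Fin m → ℚ)

/-- the substitution -/
def spF (x : Fin m × Fin N) : MvPolynomial (Fin m × Fin N) (MvPolynomial (Fin m) ℚ) :=
  if x.2 = i x.1 then C (X x.1 + C (ξ x.1)) -
    ∑ l ∈ Finset.univ.filter (fun l => l ≠ i x.1 ∧ l ≠ j x.1), C (C (c x.1 l)) * X (x.1, l)
  else if x.2 = j x.1 then 1 else X x

/-- remaining exponents -/
def rest (d : Fin m × Fin N →₀ ℕ) : Fin m × Fin N →₀ ℕ :=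
  d.filter (fun x => x.2 ≠ i x.1 ∧ x.2 ≠ j x.1)

/-- main exponents -/
def mainE (d : Fin m × Fin N →₀ ℕ) : Fin m →₀ ℕ :=
  Finsupp.equivFunOnFinite.symm fun h => d (h, i h)

lemma rest_main_inj {d d' : Fin m × Fin N →₀ ℕ}
    (hs : ∀ h, ∑ l, d (h, l) = ∑ l, d' (h, l))
    (h1 : rest i j d = rest i j d') (h2 : mainE i d = mainE i d') : d = d' := by
  have hi : ∀ h, d (h, i h) = d' (h, i h) := fun h => DFunLike.congr_fun h2 h
  have ho : ∀ h l, l ≠ i h → l ≠ j h → d (h, l) = d' (h, l) := by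
    intro h l hl hl'
    have := DFunLike.congr_fun h1 (h, l)
    simpa [rest, Finsupp.filter_apply, hl, hl'] using this
  ext ⟨h, l⟩
  by_cases h3 : l = i h
  · subst h3; exact hi h
  by_cases h4 : l = j h
  · subst h4
    have := hs h
    rw [← Finset.add_sum_erase _ _ (Finset.mem_univ (j h)),
      ← Finset.add_sum_erase _ (fun l => d' (h, l)) (Finset.mem_univ (j h))] at this
    have e : ∑ l ∈ Finset.univ.erase (j h), d (h, l) = ∑ l ∈ Finset.univ.erase (j h), d' (h, l) := by
      refine Finset.sum_congr rfl fun l hl => ?_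
      by_cases h5 : l = i h
      · subst h5; exact hi h
      · exact ho h l h5 (Finset.ne_of_mem_erase hl)
    omega
  · exact ho h l h3 h4

lemma spF_prod (d : Fin m × Fin N →₀ ℕ) :
    ∏ x, spF i j c ξ x ^ d x = monomial (rest i j d) 1 * ∏ h, spF i j c ξ (h, i h) ^ d (h, i h) := by
  classical
  have h1 : ∀ x : Fin m × Fin N, spF i j c ξ x ^ d x =
      (if x.2 ≠ i x.1 ∧ x.2 ≠ j x.1 then X x ^ d x else 1) *
      (if x.2 = i x.1 then spF i j c ξ (x.1, i x.1) ^ d (x.1, i x.1) else 1) := by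
    rintro ⟨h, l⟩
    by_cases h3 : l = i h
    · subst h3; simp
    · by_cases h4 : l = j h
      · subst h4; simp [spF, h3]
      · simp [spF, h3, h4]
  rw [Finset.prod_congr rfl fun x _ => h1 x, Finset.prod_mul_distrib]
  congr 1
  · rw [monomial_eq, C_1, one_mul, Finsupp.prod_fintype _ _ (by simp)]
    refine Finset.prod_congr rfl fun x _ => ?_
    by_cases h : x.2 ≠ i x.1 ∧ x.2 ≠ j x.1
    · rw [if_pos h, rest, Finsupp.filter_apply, if_pos h]
    · rw [if_neg h, rest, Finsupp.filter_apply, if_neg h, pow_zero]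
  · rw [Fintype.prod_prod_type]
    refine Finset.prod_congr rfl fun h _ => ?_
    simp

lemma spF_const (h : Fin m) : constantCoeff (spF i j c ξ (h, i h)) = X h + C (ξ h) := by
  simp [spF, map_sum]

lemma coeff_spF_prod (d e0 : Fin m × Fin N →₀ ℕ) (hmin : rest i j d ≤ e0 → rest i j d = e0) :
    coeff e0 (∏ x, spF i j c ξ x ^ d x) =
      if rest i j d = e0 then shift ξ (monomial (mainE i d) 1) else 0 := by
  classical
  rw [spF_prod, coeff_monomial_mul', one_mul]
  by_cases h : rest i j d ≤ e0
  · have h' := hmin h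
    rw [if_pos h, if_pos h', h', tsub_self]
    rw [← constantCoeff_eq, map_prod]
    simp only [map_pow, spF_const]
    rw [monomial_eq, C_1, one_mul, Finsupp.prod_fintype _ _ (by simp), map_prod]
    refine Finset.prod_congr rfl fun h _ => ?_
    simp [shift, mainE]
  · rw [if_neg h, if_neg]
    rintro rfl
    exact h le_rfl
end spec

lemma special {m n : ℕ} {r : Fin m → ℕ} {P : MvPolynomial (Fin m × Fin (n+1)) ℤ} (hP0 : P ≠ 0)
    (hmh : mh r P) (B : ℝ) (hB : 0 ≤ B) (hPB : ∀ d, |((coeff d P : ℤ) : ℝ)| ≤ B)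
    (a : Fin m → Fin (n+1) → ℤ) (i j : Fin m → Fin (n+1)) (hij : ∀ h, j h ≠ i h)
    (ha : ∀ h, a h (i h) ≠ 0) (p q : Fin m → ℤ) (hq : ∀ h, 0 < q h)
    (hpq : ∀ h, a h (i h) * p h = -(a h (j h) * q h))
    (G : Fin m → Matrix (Fin (n+1)) (Fin (n+1)) ℤ) (hG : ∀ h, (G h).det ≠ 0)
    (hG0 : ∀ h l, G h l 0 = if l = i h then 1 else 0)
    (hGs : ∀ h (s : Fin n), ∑ l, a h l * G h l s.succ = 0)
    (θ : ℝ) (hθ : ∀ d ∈ (lsub G P).support, θ ≤ ∑ h, (d (h, 0) : ℝ) / r h) :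
    ∃ f : MvPolynomial (Fin m) ℤ, f ≠ 0 ∧ (∀ h, f.degreeOf h ≤ r h) ∧
      (∀ e, |((coeff e f : ℤ) : ℝ)| ≤ B) ∧
      ∀ e ∈ (shift (rpt p q) (map (Int.castRingHom ℚ) f)).support, θ ≤ wt r e := by
  classical
  set ξ := rpt p q with hξ
  set c : Fin m → Fin (n+1) → ℚ := fun h l => (a h l : ℚ) / a h (i h) with hc
  have haQ : ∀ h, (a h (i h) : ℚ) ≠ 0 := fun h => by exact_mod_cast ha h
  set F := spF i j c ξ with hF
  set PQ := map (Int.castRingHom ℚ) P with hPQ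
  set H : Fin m → Matrix (Fin (n+1)) (Fin (n+1)) ℚ := fun h => (G h).map (Int.castRingHom ℚ) with hH
  have hHu : ∀ h, IsUnit (H h).det := by
    intro h
    rw [hH, isUnit_iff_ne_zero]
    have : ((G h).map (Int.castRingHom ℚ)).det = ((G h).det : ℚ) := by
      rw [← RingHom.mapMatrix_apply, ← RingHom.map_det]; rfl
    rw [this]
    exact_mod_cast hG h
  -- the linear form
  have hlin : ∀ h, ∑ l, C (C (c h l)) * F (h, l) = C (X h) := by
    intro h
    have hji := hij h
    have e1 : c h (i h) = 1 := div_self (haQ h)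
    have e2 : c h (j h) = - ξ h := by
      rw [hc, hξ, rpt]
      have h1 : (q h : ℚ) ≠ 0 := by exact_mod_cast (hq h).ne'
      have h2 : (a h (i h) : ℚ) * p h = -(a h (j h) * q h) := by exact_mod_cast hpq h
      have h3 := haQ h
      dsimp only
      rw [← neg_div, div_eq_div_iff h3 h1]
      linarith
    rw [← Finset.add_sum_erase _ _ (Finset.mem_univ (i h)),
      ← Finset.add_sum_erase _ _ (Finset.mem_erase.2 ⟨hji, Finset.mem_univ (j h)⟩)]
    have e3 : (Finset.univ.erase (i h)).erase (j h) = Finset.univ.filter (fun l => l ≠ i h ∧ l ≠ j h) := by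
      ext l; simp; tauto
    have e4 : ∀ l ∈ Finset.univ.filter (fun l => l ≠ i h ∧ l ≠ j h), F (h, l) = X (h, l) := by
      intro l hl
      simp only [Finset.mem_filter, Finset.mem_univ, true_and] at hl
      simp [hF, spF, hl.1, hl.2]
    rw [e3, Finset.sum_congr rfl fun l hl => by rw [e4 l hl], e1, e2]
    simp only [hF, spF, if_true, hji, if_false]
    simp only [map_one, map_add, map_neg]
    ring
  have hrow : ∀ h l, (H h)⁻¹ 0 l = c h l := by
    intro h l
    have h1 : Matrix.vecMul (c h) (H h) = Pi.single 0 1 := by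
      funext s
      rw [Matrix.vecMul, dotProduct]
      refine Fin.cases ?_ (fun s => ?_) s
      · simp only [hH, Matrix.map_apply, hG0]
        simp [hc, haQ h]
      · simp only [hH, Matrix.map_apply, hc]
        have := hGs h s
        have h2 : ∑ l, (a h l : ℚ) * G h l s.succ = 0 := by exact_mod_cast this
        rw [Pi.single_eq_of_ne (Fin.succ_ne_zero s)]
        rw [← zero_div (a h (i h) : ℚ), ← h2, Finset.sum_div]
        refine Finset.sum_congr rfl fun l _ => ?_
        simp; ring
    have h2 := congrArg (fun v => Matrix.vecMul v (H h)⁻¹) h1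
    simp only [Matrix.vecMul_vecMul, Matrix.mul_nonsing_inv _ (hHu h), Matrix.vecMul_one] at h2
    rw [h2]; simp
  -- Φ(P) vanishes to high order
  have hvan : geY r (aeval F PQ) θ := by
    have e1 : PQ = lsub (fun h => (H h)⁻¹) (map (Int.castRingHom ℚ) (lsub G P)) := by
      rw [map_lsub, lsub_lsub]
      have : (fun h => H h * (H h)⁻¹) = fun _ => 1 := by
        funext h; exact Matrix.mul_nonsing_inv _ (hHu h)
      change PQ = lsub (fun h => H h * (H h)⁻¹) PQ
      rw [this, lsub_one]
    set F' : Fin m × Fin (n+1) → MvPolynomial (Fin m × Fin (n+1)) (MvPolynomial (Fin m) ℚ) :=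
      fun x => ∑ s, C (C ((H x.1)⁻¹ x.2 s)) * F (x.1, s) with hF'
    have e2 : aeval F PQ = aeval F' (map (Int.castRingHom ℚ) (lsub G P)) := by
      rw [e1]
      have : (aeval F).comp (lsub (fun h => (H h)⁻¹)) = aeval (R := ℚ) F' := by
        apply MvPolynomial.algHom_ext
        intro x
        rw [AlgHom.comp_apply, lsub_X, map_sum, aeval_X, hF']
        refine Finset.sum_congr rfl fun s _ => ?_
        rw [map_mul, aeval_X, algHom_C]; rfl
      rw [← this, AlgHom.comp_apply]
    rw [e2, aeval_def, eval₂_eq']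
    refine geY.sum _ fun d hd => ?_
    have hd' := hθ d (support_map_subset _ _ hd)
    have h3 : geY r (∏ x, F' x ^ d x) (∑ x : Fin m × Fin (n+1), (d x : ℝ) * (if x.2 = 0 then 1 / (r x.1 : ℝ) else 0)) := by
      refine geY.prod _ fun x _ => geY.pow ?_ _
      split_ifs with hx
      · have : F' x = C (X x.1) := by
          rw [hF', ← hlin x.1]
          dsimp only
          rw [hx]
          refine Finset.sum_congr rfl fun l _ => ?_
          rw [hrow]
        rw [this]
        exact geY_CX _
      · exact geY_nonpos _ le_rfl
    have h4 := (geY_nonpos (r := r) (algebraMap ℚ (MvPolynomial (Fin m × Fin (n+1)) (MvPolynomial (Fin m) ℚ))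
      (coeff d (map (Int.castRingHom ℚ) (lsub G P)))) le_rfl).mul h3
    intro e k hk
    refine le_trans ?_ (h4 e k hk)
    rw [zero_add, Fintype.sum_prod_type]
    refine hd'.trans (le_of_eq (Finset.sum_congr rfl fun h _ => ?_))
    simp [div_eq_mul_inv]
  -- minimal exponent
  have hne : (P.support.image (rest i j)).Nonempty := (support_nonempty.2 hP0).image _
  obtain ⟨e0, he0, hmin⟩ := Finset.exists_minimal hne
  obtain ⟨d0, hd0, hd0e⟩ := Finset.mem_image.1 he0
  have hmin' : ∀ d ∈ P.support, rest i j d ≤ e0 → rest i j d = e0 := fun d hd hle =>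
    le_antisymm hle (hmin (Finset.mem_image_of_mem _ hd) hle)
  set S := P.support.filter (fun d => rest i j d = e0) with hS
  set f : MvPolynomial (Fin m) ℤ := ∑ d ∈ S, monomial (mainE i d) (coeff d P) with hf
  have hinj : ∀ d ∈ S, ∀ d' ∈ S, mainE i d = mainE i d' → d = d' := by
    intro d hd d' hd' h
    rw [hS, Finset.mem_filter] at hd hd'
    refine rest_main_inj i j (fun k => ?_) (hd.2.trans hd'.2.symm) h
    rw [hmh d hd.1, hmh d' hd'.1]
  have hcf : ∀ d ∈ S, coeff (mainE i d) f = coeff d P := by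
    intro d hd
    rw [hf, coeff_sum, Finset.sum_eq_single d]
    · simp
    · intro d' hd' hne
      rw [coeff_monomial, if_neg]
      exact fun h => hne (hinj d' hd' d hd h)
    · exact fun h => absurd hd h
  have hcf' : ∀ e, (∃ d ∈ S, mainE i d = e) ∨ coeff e f = 0 := by
    intro e
    by_cases h : ∃ d ∈ S, mainE i d = e
    · exact Or.inl h
    · right
      push Not at h
      rw [hf, coeff_sum]
      refine Finset.sum_eq_zero fun d hd => ?_
      rw [coeff_monomial, if_neg (h d hd)]
  refine ⟨f, ?_, ?_, ?_, ?_⟩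
  · intro h0
    have := hcf d0 (Finset.mem_filter.2 ⟨hd0, hd0e⟩)
    rw [h0, coeff_zero] at this
    exact (mem_support_iff.1 hd0) this.symm
  · intro h
    rw [degreeOf_le_iff]
    intro e he
    rcases hcf' e with ⟨d, hd, rfl⟩ | h0
    · rw [hS, Finset.mem_filter] at hd
      rw [← hmh d hd.1 h]
      exact Finset.single_le_sum (f := fun l => d (h, l)) (fun _ _ => Nat.zero_le _) (Finset.mem_univ (i h))
    · exact absurd h0 (mem_support_iff.1 he)
  · intro e
    rcases hcf' e with ⟨d, hd, rfl⟩ | h0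
    · rw [hcf d hd]; exact hPB d
    · rw [h0]; simpa using hB
  · have : shift ξ (map (Int.castRingHom ℚ) f) = coeff e0 (aeval F PQ) := by
      rw [hPQ, aeval_def, eval₂_eq', coeff_sum, support_map_of_injective _ (Int.cast_injective)]
      have e1 : ∀ d ∈ P.support, coeff e0 (algebraMap ℚ (MvPolynomial (Fin m × Fin (n+1)) (MvPolynomial (Fin m) ℚ))
          (coeff d (map (Int.castRingHom ℚ) P)) * ∏ x, F x ^ d x) =
          if rest i j d = e0 then shift ξ (monomial (mainE i d) ((coeff d P : ℤ) : ℚ)) else 0 := by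
        intro d hd
        have e2 : algebraMap ℚ (MvPolynomial (Fin m × Fin (n+1)) (MvPolynomial (Fin m) ℚ))
          (coeff d (map (Int.castRingHom ℚ) P)) = C (C ((coeff d P : ℤ) : ℚ)) := by
          rw [coeff_map]; rfl
        rw [e2, coeff_C_mul, hF, coeff_spF_prod i j c ξ d e0 (hmin' d hd)]
        split_ifs
        · have : monomial (mainE i d) ((coeff d P : ℤ) : ℚ) = C ((coeff d P : ℤ) : ℚ) * monomial (mainE i d) 1 := by
            rw [C_mul_monomial, mul_one]
          rw [this, map_mul, shift, algHom_C]; rfl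
        · simp
      rw [Finset.sum_congr rfl e1, ← Finset.sum_filter, hf, map_sum, map_sum]
      refine Finset.sum_congr rfl fun d _ => ?_
      rw [map_monomial]; rfl
    rw [this]
    exact hvan e0
end SST
end

section
namespace SST
section
open Matrix Filter

lemma thmA_pick {n : ℕ} {M : Matrix (Fin (n+1)) (Fin (n+1)) ℝ} (hM : M.det ≠ 0)
    (hMa : ∀ i j, IsAlgebraic ℚ (M i j)) (b : Fin (n+1) → ℝ) (hb : ∑ k, b k < 0)
    (hinf : {a : Fin (n+1) → ℤ | ∃ Q v, Good M b a Q v}.Infinite) :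
    ∃ κ : ℝ, 0 < κ ∧ ∀ X : ℝ, ∃ a Q v, Good M b a Q v ∧ X ≤ Real.log Q ∧
      ∃ l, Q ^ κ < |((a l : ℤ) : ℝ)| := by
  obtain ⟨C, hC, E, hE, hCE⟩ := Good.coord_le hM b
  obtain ⟨κ, hκ, B0, hsm⟩ := Good.small hM hMa b hb
  obtain ⟨Q1, hQ1⟩ := eventually_atTop.1 hsm
  refine ⟨κ, hκ, fun X => ?_⟩
  set Q2 := max (Real.exp X) Q1 with hQ2
  have hQ2p : 0 < Q2 := lt_of_lt_of_le (Real.exp_pos _) (le_max_left _ _)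
  obtain ⟨K, hK⟩ := exists_nat_gt (max (C * Q2 ^ E) B0)
  have hfin : {a : Fin (n+1) → ℤ | ∀ l, |a l| ≤ (K:ℤ)}.Finite := by
    refine (Set.finite_Icc (fun _ : Fin (n+1) => -(K:ℤ)) (fun _ => (K:ℤ))).subset ?_
    intro a ha
    exact ⟨fun l => (abs_le.1 (ha l)).1, fun l => (abs_le.1 (ha l)).2⟩
  obtain ⟨a, ⟨Q, v, hg⟩, ha⟩ := hinf.exists_notMem_finite hfin
  have ha' : ∃ l, (K:ℤ) < |a l| := by
    by_contra h
    push Not at h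
    exact ha h
  obtain ⟨l, hl⟩ := ha'
  have hl' : (K:ℝ) < |((a l : ℤ) : ℝ)| := by exact_mod_cast hl
  have hQQ : Q2 ≤ Q := by
    by_contra h
    push Not at h
    have h1 := hCE a Q v hg l
    have h2 : C * Q ^ E ≤ C * Q2 ^ E :=
      mul_le_mul_of_nonneg_left (Real.rpow_le_rpow (by linarith [hg.hQ]) h.le hE) (by linarith)
    have h3 := le_max_left (C * Q2 ^ E) B0
    linarith
  refine ⟨a, Q, v, hg, ?_, ?_⟩
  · rw [Real.le_log_iff_exp_le (lt_of_lt_of_le hQ2p hQQ)]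
    exact (le_max_left _ _).trans hQQ
  · by_contra h
    push Not at h
    have := hQ1 Q ((le_max_right _ _).trans hQQ) a v hg h l
    have h3 := le_max_right (C * Q2 ^ E) B0
    linarith

lemma exists_r {m : ℕ} (η : ℝ) (hη : 0 < η) (L : Fin m → ℝ) (hL : ∀ h, 0 < L h) :
    ∃ (T : ℝ) (r : Fin m → ℕ), 0 < T ∧ (∀ h, 0 < r h) ∧ (∀ h, T ≤ r h * L h) ∧
      (∀ h, r h * L h ≤ (1 + η) * T) := by
  have hs : 0 ≤ ∑ h, L h / η := Finset.sum_nonneg fun h _ => (div_pos (hL h) hη).le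
  refine ⟨1 + ∑ h, L h / η, fun h => ⌈(1 + ∑ h, L h / η) / L h⌉₊, by linarith, ?_, ?_, ?_⟩
  · intro h
    rw [Nat.ceil_pos]
    have := hL h
    positivity
  · intro h
    rw [← div_le_iff₀ (hL h)]
    exact Nat.le_ceil _
  · intro h
    have hT : L h / η ≤ 1 + ∑ h, L h / η := by
      have := Finset.single_le_sum (f := fun h => L h / η) (fun h _ => (div_pos (hL h) hη).le) (Finset.mem_univ h)
      linarith
    have h0 : 0 ≤ (1 + ∑ h, L h / η) / L h := div_nonneg (by linarith) (hL h).le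
    have h1 := (Nat.ceil_lt_add_one h0).le
    have h2 := mul_le_mul_of_nonneg_right h1 (hL h).le
    refine h2.trans ?_
    rw [add_mul, div_mul_cancel₀ _ (hL h).ne']
    rw [div_le_iff₀ hη] at hT
    linarith

theorem thmA {n : ℕ} (hn : 0 < n) {M : Matrix (Fin (n+1)) (Fin (n+1)) ℝ} (hM : M.det ≠ 0)
    (hMa : ∀ i j, IsAlgebraic ℚ (M i j)) (b : Fin (n+1) → ℝ) (hb : ∑ k, b k < 0) :
    {a : Fin (n+1) → ℤ | ∃ Q v, Good M b a Q v}.Finite := by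
  classical
  by_contra hinf
  obtain ⟨κ, hκ, hpick⟩ := thmA_pick hM hMa b hb hinf
  obtain ⟨m, hm, θ, hθ, Cc, hCc, η, hη, hη1, L0, hL0, hvan⟩ := vanish hM hMa b hb
  have hm' : (0:ℝ) < m := by exact_mod_cast hm
  have hn' : (0:ℝ) < n := by exact_mod_cast hn
  obtain ⟨ω, hω, hω1, hroth⟩ := roth m (θ * m / 2) (by positivity)
  have hlog : 0 ≤ Real.log Cc := Real.log_nonneg hCc
  choose a Q v hg hX i hi using hpick
  set L0' := max L0 (2 * m * n * (Real.log Cc + 1) / (ω * κ)) with hL0'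
  have hL0p : 0 < L0' := lt_of_lt_of_le hL0 (le_max_left _ _)
  have hω2 : 1 ≤ 2 / ω := by rw [le_div_iff₀ hω]; linarith
  -- the sequence
  obtain ⟨Xs, hXs0, hXs⟩ : ∃ Xs : ℕ → ℝ, Xs 0 = L0' ∧ ∀ k, Xs (k+1) = 2 / ω * Real.log (Q (Xs k)) :=
    ⟨fun k => Nat.rec L0' (fun _ x => 2 / ω * Real.log (Q x)) k, rfl, fun k => rfl⟩
  set Ls : ℕ → ℝ := fun k => Real.log (Q (Xs k)) with hLs
  have hLs0 : ∀ k, L0' ≤ Ls k := by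
    intro k
    induction k with
    | zero => rw [← hXs0]; exact hX _
    | succ k ih =>
      refine le_trans ?_ (hX (Xs (k+1)))
      rw [hXs]
      change L0' ≤ 2 / ω * Ls k
      nlinarith
  have hstep : ∀ k, 2 / ω * Ls k ≤ Ls (k+1) := by
    intro k
    rw [hLs]
    change 2 / ω * Real.log (Q (Xs k)) ≤ Real.log (Q (Xs (k+1)))
    rw [← hXs]; exact hX _
  have hgap : ∀ j k, 2 / ω * Ls j ≤ Ls (j + 1 + k) := by
    intro j k
    induction k with
    | zero => exact hstep j
    | succ k ih =>
      have h1 := hstep (j + 1 + k)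
      have h2 := hLs0 (j+1+k)
      have h3 : Ls (j+1+k) ≤ 2 / ω * Ls (j+1+k) := by nlinarith
      exact ih.trans (h3.trans h1)
  set ix : Fin m → ℝ := fun h => Xs (m - 1 - h) with hix
  set L : Fin m → ℝ := fun h => Ls (m - 1 - h) with hLd
  have hLL : ∀ h, L0' ≤ L h := fun h => hLs0 _
  have hLp : ∀ h, 0 < L h := fun h => lt_of_lt_of_le hL0p (hLL h)
  have hLg : ∀ h h', h < h' → 2 / ω * L h' ≤ L h := by
    intro h h' hh
    have e : m - 1 - (h:ℕ) = (m - 1 - h') + 1 + (h' - h - 1) := by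
      have := h'.2; have : (h:ℕ) < h' := hh; omega
    rw [hLd]
    dsimp only
    rw [e]
    exact hgap _ _
  obtain ⟨T, r, hT, hr, hr1, hr2⟩ := exists_r η hη L hLp
  have hr2' : ∀ h, r h * L h ≤ 2 * T := fun h => (hr2 h).trans (by nlinarith)
  obtain ⟨P, hP0, hmh, hPc, hPv⟩ := hvan L T r (fun h => (le_max_left _ _).trans (hLL h)) hT hr hr1 hr2
  have hai : ∀ h, a (ix h) (i (ix h)) ≠ 0 := by
    intro h h0
    have := hi (ix h)
    rw [h0] at this
    simp only [Int.cast_zero, abs_zero] at this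
    have h1 := Real.rpow_nonneg (by linarith [(hg (ix h)).hQ] : 0 ≤ Q (ix h)) κ
    linarith
  have hcoord := fun h => exists_coord (hg (ix h)).prim (i (ix h)) (hai h) hn
  choose j hji p q hq hpq hpq2 hqa using hcoord
  set G : Fin m → Matrix (Fin (n+1)) (Fin (n+1)) ℤ := fun h =>
    (of (Fin.cons (Pi.single (i (ix h)) 1) (v (ix h))))ᵀ with hG
  have hGs : ∀ h l (s : Fin n), G h l s.succ = v (ix h) s l := fun h l s => rfl
  have hG0 : ∀ h l, G h l 0 = if l = i (ix h) then 1 else 0 := by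
    intro h l
    change (Pi.single (i (ix h)) 1 : Fin (n+1) → ℤ) l = _
    rw [Pi.single_apply]
  have hvv := hPv G (by
    intro h k s
    have h1 := (hg (ix h)).le s k
    rw [Real.rpow_def_of_pos (by linarith [(hg (ix h)).hQ])] at h1
    rw [mul_comm (b k)]
    exact h1) (fun h => ⟨i (ix h), hG0 h⟩)
  obtain ⟨f, hf0, hfd, hfc, hfv⟩ := special hP0 hmh (Cc ^ (∑ h, r h)) (by positivity) hPc
    (fun h => a (ix h)) (fun h => i (ix h)) j hji hai p q hq hpq2 G
    (by
      intro h
      rw [hG, det_transpose]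
      exact det_ne_zero_of_perp (hg (ix h)).li (hg (ix h)).perp (hai h)) hG0
    (fun h s => (hg (ix h)).perp s) (θ * m) hvv
  have hR := hroth r p q ((∑ h, (r h : ℝ)) * Real.log Cc) f hr ?_ hq hpq hf0 hfd
    (mul_nonneg (Finset.sum_nonneg fun _ _ => Nat.cast_nonneg _) hlog) ?_ ?_
  · obtain ⟨e, he, hwe⟩ := hR
    have := hfv e he
    have : 0 < θ * m := by positivity
    linarith
  · intro h h' hh
    have h1 := hLg h h' hh
    have h2 := hr2' h
    have h3 := hr1 h'
    have h4 := hLp h'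
    have h5 : (0:ℝ) < r h := by exact_mod_cast hr h
    have h6 : (r h : ℝ) * (2 / ω * L h') ≤ 2 * (r h' * L h') := by
      calc _ ≤ (r h : ℝ) * L h := mul_le_mul_of_nonneg_left h1 h5.le
        _ ≤ _ := by linarith
    have h7 : (r h : ℝ) * (2 / ω * L h') = 2 * (r h / ω) * L h' := by ring
    rw [h7, ← mul_assoc] at h6
    have h8 := le_of_mul_le_mul_right h6 h4
    have h9 : (r h : ℝ) / ω ≤ r h' := by linarith
    rw [div_le_iff₀ hω] at h9
    linarith
  · intro e
    refine (hfc e).trans (le_of_eq ?_)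
    rw [← Nat.cast_sum, Real.exp_nat_mul, Real.exp_log (by linarith)]
  · intro h
    have h1 : κ / n * L h ≤ Real.log (q h) := by
      have h2 := hi (ix h)
      have h3 : |((a (ix h) (i (ix h)) : ℤ) : ℝ)| ≤ (q h : ℝ) ^ n := by exact_mod_cast hqa h
      have hq' : (0:ℝ) < q h := by exact_mod_cast hq h
      have hQp : 0 < Q (ix h) := by linarith [(hg (ix h)).hQ]
      have h4 := Real.log_le_log (Real.rpow_pos_of_pos hQp κ) (h2.le.trans h3)
      rw [Real.log_rpow hQp, Real.log_pow] at h4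
      have h5 : κ * L h ≤ n * Real.log (q h) := h4
      rw [div_mul_eq_mul_div, div_le_iff₀ hn']
      linarith
    have hsr : (∑ h, (r h : ℝ)) * L0' ≤ 2 * T * m := by
      rw [Finset.sum_mul]
      have : ∑ h : Fin m, (r h : ℝ) * L0' ≤ ∑ h : Fin m, 2 * T := by
        refine Finset.sum_le_sum fun h _ => ?_
        exact (mul_le_mul_of_nonneg_left (hLL h) (Nat.cast_nonneg _)).trans (hr2' h)
      refine this.trans (le_of_eq ?_)
      simp [mul_comm]
    have hLb : 2 * m * n * (Real.log Cc + 1) ≤ L0' * (ω * κ) := by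
      rw [← div_le_iff₀ (by positivity)]
      exact le_max_right _ _
    set Sr := ∑ h, (r h : ℝ) with hSr
    have hSr0 : 0 ≤ Sr := Finset.sum_nonneg fun _ _ => Nat.cast_nonneg _
    have h5 : Sr * (2 * m * n * (Real.log Cc + 1)) ≤ (2 * T * m) * (ω * κ) := by
      calc _ ≤ Sr * (L0' * (ω * κ)) := mul_le_mul_of_nonneg_left hLb hSr0
        _ = (Sr * L0') * (ω * κ) := by ring
        _ ≤ _ := mul_le_mul_of_nonneg_right hsr (by positivity)
    have h6 : (Sr * (n * (Real.log Cc + 1))) * (2 * m) ≤ (T * (ω * κ)) * (2 * m) := by linarith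
    have h7 := le_of_mul_le_mul_right h6 (by positivity)
    have h8 : ω * (κ / n * T) ≤ ω * (r h * Real.log (q h)) := by
      refine mul_le_mul_of_nonneg_left ?_ hω.le
      calc κ / n * T ≤ κ / n * (r h * L h) := mul_le_mul_of_nonneg_left (hr1 h) (by positivity)
        _ = r h * (κ / n * L h) := by ring
        _ ≤ _ := mul_le_mul_of_nonneg_left h1 (Nat.cast_nonneg _)
    refine le_trans ?_ h8
    have h9 : ω * (κ / n * T) = T * (ω * κ) / n := by ring
    rw [h9, le_div_iff₀ hn']
    linarith
end
end SST
end

section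
namespace SST
section
open Matrix

/-- integer matrices as real matrices -/
def rM {m n : Type*} (T : Matrix m n ℤ) : Matrix m n ℝ := T.map (Int.castRingHom ℝ)

lemma rM_apply {m n : Type*} (T : Matrix m n ℤ) (i : m) (j : n) : rM T i j = (T i j : ℝ) := rfl

lemma rM_mul {l m n : Type*} [Fintype m] (S : Matrix l m ℤ) (T : Matrix m n ℤ) :
    rM (S * T) = rM S * rM T := Matrix.map_mul

lemma rM_det {n : Type*} [Fintype n] [DecidableEq n] (T : Matrix n n ℤ) : (rM T).det = (T.det : ℝ) := by
  rw [rM, ← RingHom.mapMatrix_apply, ← RingHom.map_det]; rfl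

/-- lower bound for images of integer columns -/
lemma col_lower {n : ℕ} (G : Matrix (Fin n) (Fin n) ℝ) (hG : G.det ≠ 0) :
    ∃ c : ℝ, 0 < c ∧ ∀ T : Matrix (Fin n) (Fin n) ℤ, IsUnit T.det → ∀ j,
      c ≤ ‖fun i => (G * rM T) i j‖ := by
  set K := 1 + ∑ i, ∑ l, |G⁻¹ i l| with hK
  have hK0 : 0 ≤ ∑ i, ∑ l, |G⁻¹ i l| := Finset.sum_nonneg fun _ _ => Finset.sum_nonneg fun _ _ => abs_nonneg _
  refine ⟨1 / K, by positivity, fun T hT j => ?_⟩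
  have h1 : ∃ i, T i j ≠ 0 := by
    by_contra h
    push Not at h
    have := Matrix.det_eq_zero_of_column_eq_zero j h
    rw [this] at hT
    simp at hT
  obtain ⟨i, hi⟩ := h1
  have h2 : (1:ℝ) ≤ |(T i j : ℝ)| := by exact_mod_cast Int.one_le_abs hi
  have h3 : (T i j : ℝ) = ∑ l, G⁻¹ i l * (G * rM T) l j := by
    have : G⁻¹ * (G * rM T) = rM T := by
      rw [← Matrix.mul_assoc, Matrix.nonsing_inv_mul _ (isUnit_iff_ne_zero.2 hG), Matrix.one_mul]
    rw [← Matrix.mul_apply, this]; rfl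
  set w : Fin n → ℝ := fun i => (G * rM T) i j with hw
  rw [h3] at h2
  have h4 : |∑ l, G⁻¹ i l * (G * rM T) l j| ≤ (∑ l, |G⁻¹ i l|) * ‖w‖ := by
    refine (Finset.abs_sum_le_sum_abs _ _).trans ?_
    rw [Finset.sum_mul]
    refine Finset.sum_le_sum fun l _ => ?_
    rw [abs_mul]
    exact mul_le_mul_of_nonneg_left (norm_le_pi_norm w l) (abs_nonneg _)
  have h5 := Finset.single_le_sum (f := fun i => ∑ l, |G⁻¹ i l|)
    (fun _ _ => Finset.sum_nonneg fun _ _ => abs_nonneg _) (Finset.mem_univ i)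
  have h6 : (∑ l, |G⁻¹ i l|) * ‖w‖ ≤ K * ‖w‖ :=
    mul_le_mul_of_nonneg_right (by linarith) (norm_nonneg _)
  rw [div_le_iff₀ (by linarith)]
  linarith

lemma near_min {n : ℕ} (G : Matrix (Fin (n+1)) (Fin (n+1)) ℝ) (hG : G.det ≠ 0) :
    ∃ T0 : Matrix (Fin (n+1)) (Fin (n+1)) ℤ, IsUnit T0.det ∧ 0 < ‖fun i => (G * rM T0) i 0‖ ∧
      ∀ T : Matrix (Fin (n+1)) (Fin (n+1)) ℤ, IsUnit T.det → ∀ j,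
        3 / 4 * ‖fun i => (G * rM T0) i 0‖ ≤ ‖fun i => (G * rM T) i j‖ := by
  obtain ⟨c, hc, hcl⟩ := col_lower G hG
  set S : Set ℝ := {x | ∃ T : Matrix (Fin (n+1)) (Fin (n+1)) ℤ, IsUnit T.det ∧ x = ‖fun i => (G * rM T) i 0‖} with hS
  have hne : S.Nonempty := ⟨_, 1, by simp, rfl⟩
  have hlb : ∀ x ∈ S, c ≤ x := by
    rintro x ⟨T, hT, rfl⟩; exact hcl T hT 0
  have hbdd : BddBelow S := ⟨c, hlb⟩
  have hs : c ≤ sInf S := le_csInf hne hlb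
  obtain ⟨x, ⟨T0, hT0, rfl⟩, hx⟩ := exists_lt_of_csInf_lt hne (show sInf S < 4 / 3 * sInf S by linarith)
  refine ⟨T0, hT0, lt_of_lt_of_le hc (hcl T0 hT0 0), fun T hT j => ?_⟩
  have h1 : sInf S ≤ ‖fun i => (G * rM T) i j‖ := by
    refine csInf_le hbdd ⟨T.submatrix id (Equiv.swap 0 j), ?_, ?_⟩
    · rw [Matrix.det_permute']
      refine IsUnit.mul ?_ hT
      rcases Int.units_eq_one_or (Equiv.Perm.sign (Equiv.swap (0 : Fin (n+1)) j)) with h | h <;> rw [h] <;> simp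
    · refine congrArg norm (funext fun i => ?_)
      rw [Matrix.mul_apply, Matrix.mul_apply]
      simp [rM]
  linarith

/-- lifted transformation -/
def liftT {n : ℕ} (T : Matrix (Fin n) (Fin n) ℤ) (z : Fin n → ℤ) : Matrix (Fin (n+1)) (Fin (n+1)) ℤ :=
  of (Fin.cons (Fin.cons 1 z) (fun s => Fin.cons 0 (T s)))

lemma liftT_det {n : ℕ} (T : Matrix (Fin n) (Fin n) ℤ) (z : Fin n → ℤ) : (liftT T z).det = T.det := by
  rw [Matrix.det_succ_column_zero, Finset.sum_eq_single 0]
  · simp [liftT, Matrix.submatrix]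
    rfl
  · intro b _ hb
    obtain ⟨b, rfl⟩ := Fin.exists_succ_eq.2 hb
    simp [liftT]
  · simp

/-- Schur complement -/
def schur {n : ℕ} (A : Matrix (Fin (n+1)) (Fin (n+1)) ℝ) : Matrix (Fin n) (Fin n) ℝ :=
  of fun l j => A l.succ j.succ - A l.succ 0 * A 0 j.succ / A 0 0

lemma schur_det {n : ℕ} (A : Matrix (Fin (n+1)) (Fin (n+1)) ℝ) (h : A 0 0 ≠ 0) :
    A.det = A 0 0 * (schur A).det := by
  set B : Matrix (Fin (n+1)) (Fin (n+1)) ℝ := of fun i => Fin.cons (A i 0)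
    (fun j => A i j.succ - A i 0 * A 0 j.succ / A 0 0) with hB
  have h1 : A.det = B.det := by
    rw [← Matrix.det_transpose, ← Matrix.det_transpose B]
    refine Matrix.det_eq_of_forall_row_eq_smul_add_const (k := 0) (fun j => Fin.cases 0 (fun j => A 0 j.succ / A 0 0) j) rfl ?_
    intro j i
    refine Fin.cases ?_ (fun j => ?_) j
    · simp [hB]
    · simp [hB]; ring
  rw [h1, Matrix.det_succ_row_zero, Finset.sum_eq_single 0]
  · simp [hB, schur, Matrix.submatrix]
  · intro b _ hb
    obtain ⟨b, rfl⟩ := Fin.exists_succ_eq.2 hb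
    have : B 0 b.succ = 0 := by simp [hB]; field_simp; ring
    rw [this]; simp
  · simp

lemma lift_row0 {n : ℕ} (A : Matrix (Fin (n+1)) (Fin (n+1)) ℝ) (h : A 0 0 ≠ 0) (T : Matrix (Fin n) (Fin n) ℤ)
    (z : Fin n → ℤ) (j : Fin n) :
    (A * rM (liftT T z)) 0 j.succ = A 0 0 * ((z j : ℝ) + (∑ s, A 0 s.succ * T s j) / A 0 0) := by
  rw [Matrix.mul_apply, Fin.sum_univ_succ]
  simp [rM, liftT]
  field_simp

lemma lift_row {n : ℕ} (A : Matrix (Fin (n+1)) (Fin (n+1)) ℝ) (T : Matrix (Fin n) (Fin n) ℤ)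
    (z : Fin n → ℤ) (j l : Fin n) :
    (A * rM (liftT T z)) l.succ j.succ = (schur A * rM T) l j +
      A l.succ 0 * ((z j : ℝ) + (∑ s, A 0 s.succ * T s j) / A 0 0) := by
  rw [Matrix.mul_apply, Fin.sum_univ_succ, Matrix.mul_apply]
  simp only [rM, liftT, schur, Matrix.map_apply, of_apply, Fin.cons_zero, Fin.cons_succ]
  rw [mul_add, Finset.sum_div, Finset.mul_sum]
  have key : ∑ s, A l.succ s.succ * (T s j : ℝ) =
      ∑ s, (A l.succ s.succ - A l.succ 0 * A 0 s.succ / A 0 0) * (T s j : ℝ) +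
      ∑ s, A l.succ 0 * (A 0 s.succ * (T s j : ℝ) / A 0 0) := by
    rw [← Finset.sum_add_distrib]
    refine Finset.sum_congr rfl fun s _ => ?_
    ring
  simp only [eq_intCast]
  linarith

lemma lift_col0 {n : ℕ} (A : Matrix (Fin (n+1)) (Fin (n+1)) ℝ) (T : Matrix (Fin n) (Fin n) ℤ)
    (z : Fin n → ℤ) (l : Fin (n+1)) : (A * rM (liftT T z)) l 0 = A l 0 := by
  rw [Matrix.mul_apply, Fin.sum_univ_succ]
  simp [rM, liftT]

theorem redR : ∀ n : ℕ, ∃ C : ℝ, 0 < C ∧ ∀ G : Matrix (Fin n) (Fin n) ℝ, G.det ≠ 0 →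
    ∃ T : Matrix (Fin n) (Fin n) ℤ, IsUnit T.det ∧ ∃ μ : Fin n → ℝ, Monotone μ ∧ (∀ j, 0 < μ j) ∧
      ∃ π : Equiv.Perm (Fin n), (∀ l j, |(G * rM T) (π l) j| ≤ min (μ l) (μ j)) ∧
        ∏ j, μ j ≤ C * |G.det| := by
  intro n
  induction n with
  | zero =>
    refine ⟨1, one_pos, fun G _ => ⟨1, by simp, fun _ => 1, fun _ _ _ => le_rfl, fun _ => one_pos, 1, ?_, ?_⟩⟩
    · intro l; exact l.elim0
    · simp
  | succ n ih =>
    obtain ⟨C, hC, hr⟩ := ih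
    refine ⟨4 ^ n * C, by positivity, fun G hG => ?_⟩
    obtain ⟨T0, hT0, hpos, hmin⟩ := near_min G hG
    set w : Fin (n+1) → ℝ := fun i => (G * rM T0) i 0 with hw
    obtain ⟨i1, -, hi1⟩ := Finset.exists_max_image Finset.univ (fun i => |w i|) ⟨0, Finset.mem_univ _⟩
    have hwi : ∀ i, |w i| ≤ |w i1| := fun i => hi1 i (Finset.mem_univ _)
    have hnw : ‖w‖ = |w i1| := by
      refine le_antisymm ((pi_norm_le_iff_of_nonneg (abs_nonneg _)).2 hwi) (norm_le_pi_norm w i1)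
    set A : Matrix (Fin (n+1)) (Fin (n+1)) ℝ := (G * rM T0).submatrix (Equiv.swap 0 i1) id with hA
    have hA0 : ∀ l, A l 0 = w (Equiv.swap 0 i1 l) := fun l => rfl
    have hA00 : |A 0 0| = ‖w‖ := by rw [hA0, Equiv.swap_apply_left, hnw]
    have hAne : A 0 0 ≠ 0 := by
      intro h; rw [h, abs_zero] at hA00; linarith
    have hAl : ∀ l, |A l 0| ≤ ‖w‖ := fun l => by rw [hA0]; exact norm_le_pi_norm w _
    have hdT0 : |((T0.det : ℤ) : ℝ)| = 1 := by
      have := Int.isUnit_iff_abs_eq.1 hT0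
      exact_mod_cast this
    have hdA : |A.det| = |G.det| := by
      rw [hA, Matrix.det_permute, abs_mul, Matrix.det_mul, abs_mul, rM_det, hdT0, mul_one]
      rcases Int.units_eq_one_or (Equiv.Perm.sign (Equiv.swap (0 : Fin (n+1)) i1)) with h | h <;> rw [h] <;> simp
    have hsd := schur_det A hAne
    have hsne : (schur A).det ≠ 0 := by
      intro h
      rw [h, mul_zero] at hsd
      rw [hsd, abs_zero] at hdA
      exact hG (abs_eq_zero.1 hdA.symm)
    obtain ⟨T', hT', μ, hμm, hμp, π, hb, hpr⟩ := hr (schur A) hsne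
    set y : Fin n → ℝ := fun j => (∑ s, A 0 s.succ * T' s j) / A 0 0 with hy
    set z : Fin n → ℤ := fun j => - round (y j) with hz
    have hzy : ∀ j, |(z j : ℝ) + y j| ≤ 1 / 2 := by
      intro j
      rw [hz]
      push_cast
      rw [neg_add_eq_sub]
      exact abs_sub_round _
    set T1 := liftT T' z with hT1
    have hT : IsUnit (T0 * T1).det := by
      rw [Matrix.det_mul, hT1, liftT_det]; exact hT0.mul hT'
    have hAT : ∀ l j, (A * rM T1) l j = (G * rM (T0 * T1)) (Equiv.swap 0 i1 l) j := by
      intro l j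
      rw [rM_mul, ← Matrix.mul_assoc]
      rfl
    have hrow0 : ∀ j : Fin n, |(A * rM T1) 0 j.succ| ≤ ‖w‖ / 2 := by
      intro j
      rw [hT1, lift_row0 A hAne, abs_mul, hA00]
      have := mul_le_mul_of_nonneg_left (hzy j) (norm_nonneg w)
      linarith
    have hrow : ∀ l j : Fin n, |(A * rM T1) l.succ j.succ| ≤ |(schur A * rM T') l j| + ‖w‖ / 2 := by
      intro l j
      rw [hT1, lift_row]
      refine (abs_add_le _ _).trans (add_le_add le_rfl ?_)
      rw [abs_mul]
      have := mul_le_mul (hAl l.succ) (hzy j) (abs_nonneg _) (norm_nonneg w)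
      linarith
    have hlow : ∀ j : Fin n, ‖w‖ ≤ 4 * μ j := by
      intro j
      have h1 := hmin (T0 * T1) hT j.succ
      have h2 : ‖fun i => (G * rM (T0 * T1)) i j.succ‖ ≤ μ j + ‖w‖ / 2 := by
        refine (pi_norm_le_iff_of_nonneg (by linarith [hμp j])).2 fun i => ?_
        have h3 : (G * rM (T0 * T1)) i j.succ = (A * rM T1) (Equiv.swap 0 i1 i) j.succ := by
          rw [hAT]; simp
        rw [h3, Real.norm_eq_abs]
        refine Fin.cases ?_ (fun l => ?_) (Equiv.swap 0 i1 i)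
        · linarith [hrow0 j, hμp j]
        · refine (hrow l j).trans (add_le_add ?_ le_rfl)
          have := hb (π.symm l) j
          rw [Equiv.apply_symm_apply] at this
          exact this.trans (min_le_right _ _)
      linarith
    set μ' : Fin (n+1) → ℝ := Fin.cons ‖w‖ (fun j => 4 * μ j) with hμ'
    have hμ0 : ∀ j, ‖w‖ ≤ μ' j := by
      intro j
      refine Fin.cases ?_ (fun j => ?_) j
      · exact le_rfl
      · exact hlow j
    refine ⟨T0 * T1, hT, μ', ?_, ?_, (Equiv.Perm.decomposeFin.symm (0, π) : Equiv.Perm (Fin (n+1))).trans (Equiv.swap 0 i1), ?_, ?_⟩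
    · intro j k
      refine Fin.cases (fun _ => hμ0 k) (fun j => ?_) j
      refine Fin.cases (fun h => ?_) (fun k h => ?_) k
      · simp at h
      · have := hμm (Fin.succ_le_succ_iff.1 h)
        change 4 * μ j ≤ 4 * μ k
        linarith
    · intro j; exact lt_of_lt_of_le hpos (hμ0 j)
    · intro l j
      rw [Equiv.trans_apply, ← hAT]
      refine Fin.cases ?_ (fun l => ?_) l
      · have e : (Equiv.Perm.decomposeFin.symm (0, π) : Equiv.Perm (Fin (n+1))) 0 = 0 := by simp
        rw [e]
        refine Fin.cases ?_ (fun j => ?_) j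
        · rw [hT1, lift_col0, hA00]; exact le_min le_rfl le_rfl
        · refine le_min ?_ ?_
          · have := hrow0 j
            change _ ≤ ‖w‖
            linarith
          · have := hrow0 j
            have := hμ0 j.succ
            linarith
      · have e : (Equiv.Perm.decomposeFin.symm (0, π) : Equiv.Perm (Fin (n+1))) l.succ = (π l).succ := by simp
        rw [e]
        refine Fin.cases ?_ (fun j => ?_) j
        · rw [hT1, lift_col0]
          exact le_min ((hAl _).trans (hμ0 _)) ((hAl _).trans (hμ0 _))
        · have h1 := hrow (π l) j
          have h2 := hb l j
          have h3 := le_min_iff.1 h2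
          have h4 := hlow l
          have h5 := hlow j
          refine le_min ?_ ?_
          · change _ ≤ 4 * μ l
            linarith [h3.1]
          · change _ ≤ 4 * μ j
            linarith [h3.2]
    · rw [hμ', Fin.prod_univ_succ]
      simp only [Fin.cons_zero, Fin.cons_succ]
      rw [Finset.prod_mul_distrib]
      simp only [Finset.prod_const, Finset.card_univ, Fintype.card_fin]
      rw [← hdA, hsd, abs_mul, hA00]
      have := mul_le_mul_of_nonneg_left hpr (by positivity : 0 ≤ 4 ^ n * ‖w‖)
      linarith
end
end SST
end

section
namespace SST
section
open Matrix

/-- subsets of fixed cardinality -/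
abbrev PS (n p : ℕ) : Type := {s : Finset (Fin n) // s.card = p}

/-- increasing enumeration -/
def emb {n p : ℕ} (s : PS n p) : Fin p ↪o Fin n := s.1.orderEmbOfFin s.2

lemma emb_mem {n p : ℕ} (s : PS n p) (i : Fin p) : emb s i ∈ s.1 := Finset.orderEmbOfFin_mem _ _ _

lemma exists_emb {n p : ℕ} (s : PS n p) {x : Fin n} (hx : x ∈ s.1) : ∃ i, emb s i = x := by
  have : x ∈ Set.range (s.1.orderEmbOfFin s.2) := by
    rw [Finset.range_orderEmbOfFin]; exact hx
  exact this

lemma prod_emb {n p : ℕ} (s : PS n p) {R : Type*} [CommMonoid R] (f : Fin n → R) :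
    ∏ i, f (emb s i) = ∏ x ∈ s.1, f x := by
  refine Finset.prod_bij (fun i _ => emb s i) (fun i _ => emb_mem s i) (fun i _ j _ h => (emb s).injective h) ?_ ?_
  · intro x hx
    obtain ⟨i, hi⟩ := exists_emb s hx
    exact ⟨i, Finset.mem_univ _, hi⟩
  · intros; rfl

/-- Cauchy-Binet -/
lemma cauchyBinet {R : Type*} [CommRing R] {n p : ℕ} (A : Matrix (Fin p) (Fin n) R) (B : Matrix (Fin n) (Fin p) R) :
    (A * B).det = ∑ s : PS n p, (A.submatrix id (emb s)).det * (B.submatrix (emb s) id).det := by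
  classical
  have h1 : (A * B).det = ∑ f : Fin p → Fin n, (∏ i, B (f i) i) * (A.submatrix id f).det := by
    rw [← Matrix.det_transpose]
    have e1 : (A * B)ᵀ = fun i => ∑ l, B l i • Aᵀ l := by
      funext i k
      simp [Matrix.mul_apply, mul_comm]
    change Matrix.detRowAlternating.toMultilinearMap (A * B)ᵀ = _
    rw [e1, MultilinearMap.map_sum]
    refine Finset.sum_congr rfl fun f _ => ?_
    rw [MultilinearMap.map_smul_univ, smul_eq_mul]
    congr 1
    rw [← Matrix.det_transpose (A.submatrix id f)]
    rfl
  rw [h1]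
  have h2 : ∀ s : PS n p, (A.submatrix id (emb s)).det * (B.submatrix (emb s) id).det =
      ∑ σ : Equiv.Perm (Fin p), (∏ i, B (emb s (σ i)) i) * (A.submatrix id (emb s ∘ σ)).det := by
    intro s
    rw [Matrix.det_apply' (B.submatrix (emb s) id), Finset.mul_sum]
    refine Finset.sum_congr rfl fun σ _ => ?_
    have : A.submatrix id (emb s ∘ σ) = (A.submatrix id (emb s)).submatrix id σ := rfl
    rw [this, Matrix.det_permute']
    simp only [Matrix.submatrix_apply, id]
    ring
  rw [Finset.sum_congr rfl fun s _ => h2 s,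
    ← Fintype.sum_prod_type' (f := fun (s : PS n p) (σ : Equiv.Perm (Fin p)) =>
      (∏ i, B (emb s (σ i)) i) * (A.submatrix id (emb s ∘ σ)).det)]
  symm
  refine Fintype.sum_of_injective (fun x : PS n p × Equiv.Perm (Fin p) => (emb x.1 ∘ x.2 : Fin p → Fin n)) ?_ _ _ ?_ ?_
  · rintro ⟨s, σ⟩ ⟨s', σ'⟩ h
    have hr : ∀ (s : PS n p) (σ : Equiv.Perm (Fin p)) x, x ∈ s.1 ↔ ∃ i, (emb s ∘ σ) i = x := by
      intro s σ x
      constructor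
      · intro hx
        obtain ⟨i, hi⟩ := exists_emb s hx
        exact ⟨σ.symm i, by simp [hi]⟩
      · rintro ⟨i, rfl⟩; exact emb_mem _ _
    have hs : s = s' := by
      apply Subtype.ext
      ext x
      rw [hr s σ, hr s' σ']
      simp only at h
      rw [h]
    subst hs
    congr 1
    ext i
    have := congrFun h i
    exact congrArg Fin.val ((emb s).injective this)
  · intro f hf
    by_cases hi : Function.Injective f
    · exfalso
      apply hf
      set s : PS n p := ⟨Finset.univ.image f, by rw [Finset.card_image_of_injective _ hi]; simp⟩ with hs
      have : ∀ i, ∃ k, emb s k = f i := fun i => exists_emb s (Finset.mem_image_of_mem _ (Finset.mem_univ _))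
      choose k hk using this
      have hki : Function.Injective k := by
        intro i j h
        apply hi
        rw [← hk, ← hk, h]
      refine ⟨(s, Equiv.ofBijective k (Finite.injective_iff_bijective.1 hki)), ?_⟩
      funext i
      exact hk i
    · have : ∃ i j, f i = f j ∧ i ≠ j := by
        rw [Function.Injective] at hi
        push Not at hi
        exact hi
      obtain ⟨i, j, hij, hne⟩ := this
      have h0 : (A.submatrix id f).det = 0 := by
        apply Matrix.det_zero_of_column_eq hne
        intro k
        simp [hij]
      rw [h0, mul_zero]
  · intro x; rfl

/-- compound matrix -/
def cmp {R : Type*} [CommRing R] {n : ℕ} (p : ℕ) (A : Matrix (Fin n) (Fin n) R) : Matrix (PS n p) (PS n p) R :=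
  of fun s t => (A.submatrix (emb s) (emb t)).det

lemma cmp_apply {R : Type*} [CommRing R] {n p : ℕ} (A : Matrix (Fin n) (Fin n) R) (s t : PS n p) :
    cmp p A s t = (A.submatrix (emb s) (emb t)).det := rfl

lemma cmp_mul {R : Type*} [CommRing R] {n p : ℕ} (A B : Matrix (Fin n) (Fin n) R) :
    cmp p (A * B) = cmp p A * cmp p B := by
  ext s t
  rw [cmp_apply, Matrix.mul_apply]
  have : (A * B).submatrix (emb s) (emb t) = A.submatrix (emb s) id * B.submatrix id (emb t) := by
    rw [Matrix.submatrix_mul _ _ _ _ _ Function.bijective_id]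
  rw [this, cauchyBinet]
  rfl

lemma cmp_one {R : Type*} [CommRing R] {n p : ℕ} : cmp p (1 : Matrix (Fin n) (Fin n) R) = 1 := by
  ext s t
  rw [cmp_apply]
  by_cases h : s = t
  · subst h
    rw [Matrix.submatrix_one _ (emb s).injective]
    simp
  · rw [Matrix.one_apply_ne h]
    have : ∃ x ∈ s.1, x ∉ t.1 := by
      by_contra hc
      push Not at hc
      exact h (Subtype.ext (Finset.eq_of_subset_of_card_le hc (by rw [s.2, t.2])))
    obtain ⟨x, hx, hxt⟩ := this
    obtain ⟨i, hi⟩ := exists_emb s hx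
    refine Matrix.det_eq_zero_of_row_eq_zero i fun j => ?_
    rw [Matrix.submatrix_apply, hi, Matrix.one_apply_ne]
    rintro rfl
    exact hxt (emb_mem t j)

lemma cmp_rM {n p : ℕ} (T : Matrix (Fin n) (Fin n) ℤ) : cmp p (rM T) = rM (cmp p T) := by
  ext s t
  rw [cmp_apply, rM_apply, cmp_apply, ← rM_det]
  rfl

lemma cmp_diag {R : Type*} [CommRing R] {n p : ℕ} (d : Fin n → R) (A : Matrix (Fin n) (Fin n) R) (s t : PS n p) :
    cmp p (diagonal d * A) s t = (∏ i ∈ s.1, d i) * cmp p A s t := by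
  rw [cmp_apply, cmp_apply, ← prod_emb, ← Matrix.det_mul_column]
  congr 1
  ext i j
  simp [Matrix.diagonal_mul]

lemma cmp_alg {n p : ℕ} (A : Matrix (Fin n) (Fin n) ℝ) (hA : ∀ i j, IsAlgebraic ℚ (A i j)) (s t : PS n p) :
    IsAlgebraic ℚ (cmp p A s t) := algebraic_det _ fun _ _ => hA _ _

lemma cmp_det_ne {n p : ℕ} (A : Matrix (Fin n) (Fin n) ℝ) (hA : A.det ≠ 0) : (cmp p A).det ≠ 0 := by
  have h : cmp p A * cmp p A⁻¹ = 1 := by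
    rw [← cmp_mul, Matrix.mul_nonsing_inv _ (isUnit_iff_ne_zero.2 hA), cmp_one]
  have := congrArg Matrix.det h
  rw [Matrix.det_mul, Matrix.det_one] at this
  exact left_ne_zero_of_mul_eq_one this

/-- general index version of Theorem A -/
theorem thmA' {I : Type*} [Fintype I] [DecidableEq I] (hI : 2 ≤ Fintype.card I) {M : Matrix I I ℝ}
    (hM : M.det ≠ 0) (hMa : ∀ i j, IsAlgebraic ℚ (M i j)) (b : I → ℝ) (hb : ∑ k, b k < 0) :
    {a : I → ℤ | ∃ Q : ℝ, 1 ≤ Q ∧ ∃ U V : Matrix I I ℤ, U * V = 1 ∧ ∃ i0, a = U i0 ∧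
      ∀ j, j ≠ i0 → ∀ k, |∑ l, M k l * (V l j : ℝ)| ≤ Q ^ b k}.Finite := by
  obtain ⟨n, hn⟩ : ∃ n, Fintype.card I = n + 1 := ⟨Fintype.card I - 1, by omega⟩
  have hn0 : 0 < n := by omega
  let e : Fin (n+1) ≃ I := (Fintype.equivFinOfCardEq hn).symm
  have h1 := thmA hn0 (M := M.submatrix e e) (by rwa [Matrix.det_submatrix_equiv_self])
    (fun i j => hMa _ _) (b ∘ e) (by rw [← Equiv.sum_comp e] at hb; exact hb)
  refine (h1.preimage (f := fun a : I → ℤ => a ∘ e) ?_).subset ?_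
  · intro a _ a' _ h
    funext i
    have := congrFun h (e.symm i)
    simpa using this
  · rintro a ⟨Q, hQ, U, V, hUV, i0, rfl, hle⟩
    have hc : Fintype.card {i : I // i ≠ i0} = n := by
      rw [Fintype.card_subtype_compl, hn]; simp
    let f : Fin n ≃ {i : I // i ≠ i0} := (Fintype.equivFinOfCardEq hc).symm
    have hUVe : ∀ i j, ∑ l, U i l * V l j = if i = j then 1 else 0 := by
      intro i j
      rw [← Matrix.mul_apply, hUV, Matrix.one_apply]
    refine ⟨Q, fun j l => V (e l) (f j), ?_, hQ, ?_, ?_, ?_⟩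
    · refine ⟨fun l => V (e l) i0, ?_⟩
      have := hUVe i0 i0
      rw [if_pos rfl, ← Equiv.sum_comp e] at this
      rw [← this]
      refine Finset.sum_congr rfl fun l _ => ?_
      simp [mul_comm]
    · rw [Fintype.linearIndependent_iff]
      intro g hg j
      have h2 : ∀ l, ∑ j, g j * V l (f j) = 0 := by
        intro l
        have := congrFun hg (e.symm l)
        simpa using this
      have h3 : ∑ l, U (f j) l * ∑ j, g j * V l (f j) = 0 := by
        simp [h2]
      simp only [Finset.mul_sum] at h3
      rw [Finset.sum_comm, Finset.sum_eq_single j] at h3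
      · have h4 := hUVe (f j) (f j)
        rw [if_pos rfl] at h4
        have h5 : ∑ x, U (f j) x * (g j * V x (f j)) = g j * ∑ l, U (f j) l * V l (f j) := by
          rw [Finset.mul_sum]; exact Finset.sum_congr rfl fun l _ => by ring
        rw [h5, h4, mul_one] at h3
        exact h3
      · intro j' _ hj'
        have h4 := hUVe (f j) (f j')
        rw [if_neg] at h4
        · rw [← mul_zero (g j'), ← h4, Finset.mul_sum]
          refine Finset.sum_congr rfl fun l _ => ?_
          ring
        · intro h
          exact hj' (f.injective (Subtype.ext h)).symm
      · simp
    · intro j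
      have := hUVe i0 (f j)
      rw [if_neg (f j).2.symm, ← Equiv.sum_comp e] at this
      exact this
    · intro j k
      have := hle (f j) (f j).2 (e k)
      rw [← Equiv.sum_comp e] at this
      exact this

/-- the grid lemma -/
lemma grid (I : Type*) [Fintype I] (hI : 0 < Fintype.card I) (C1 δ : ℝ) (hC1 : 0 ≤ C1) (hδ : 0 < δ) :
    ∃ B : Set (I → ℝ), B.Finite ∧ (∀ b ∈ B, ∑ i, b i < 0) ∧
      ∀ x : I → ℝ, (∀ i, x i ≤ C1) → ∑ i, x i ≤ -δ → ∃ b ∈ B, ∀ i, x i ≤ b i := by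
  classical
  set N : ℝ := ((Fintype.card I : ℕ) : ℝ) with hN
  have hN0 : 0 < N := by rw [hN]; exact_mod_cast hI
  set η := δ / (2 * N) with hη
  have hη0 : 0 < η := by positivity
  set K := N * C1 + δ with hK
  have hK0 : 0 < K := by positivity
  set Z : ℤ := ⌈K / η⌉ + ⌈C1 / η⌉ with hZ
  have hfin : (Set.range fun f : I → Finset.Icc (-Z) Z => fun i => η * ((f i : ℤ) : ℝ)).Finite :=
    Set.finite_range _
  refine ⟨{b ∈ Set.range fun f : I → Finset.Icc (-Z) Z => fun i => η * ((f i : ℤ) : ℝ) | ∑ i, b i < 0},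
    hfin.subset (Set.sep_subset _ _), fun b hb => hb.2, ?_⟩
  intro x hx hs
  set y : I → ℝ := fun i => max (x i) (-K) with hy
  have hyle : ∀ i, y i ≤ C1 := fun i => max_le (hx i) (by linarith)
  set z : I → ℤ := fun i => ⌈y i / η⌉ with hz
  have hz1 : ∀ i, y i ≤ η * z i := by
    intro i
    have := Int.le_ceil (y i / η)
    rw [div_le_iff₀ hη0] at this
    rw [mul_comm]; exact this
  have hz2 : ∀ i, η * z i ≤ y i + η := by
    intro i
    have := (Int.ceil_lt_add_one (y i / η)).le
    have h2 := mul_le_mul_of_nonneg_left this hη0.le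
    rw [mul_add, mul_div_cancel₀ _ hη0.ne', mul_one] at h2
    exact h2
  have hc1 : 0 ≤ ⌈C1 / η⌉ := Int.ceil_nonneg (by positivity)
  have hc2 : 0 ≤ ⌈K / η⌉ := Int.ceil_nonneg (by positivity)
  have hzm : ∀ i, z i ∈ Finset.Icc (-Z) Z := by
    intro i
    rw [Finset.mem_Icc]
    constructor
    · have h1 : -(K / η) ≤ y i / η := by
        rw [← neg_div]; exact div_le_div_of_nonneg_right (le_max_right _ _) hη0.le
      have h2 : -(⌈K / η⌉ : ℝ) ≤ z i := by
        have := Int.le_ceil (K / η)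
        have h3 := Int.le_ceil (y i / η)
        change -(⌈K / η⌉ : ℝ) ≤ ((⌈y i / η⌉ : ℤ) : ℝ)
        linarith
      have h4 : -⌈K / η⌉ ≤ z i := by exact_mod_cast h2
      omega
    · have : z i ≤ ⌈C1 / η⌉ := Int.ceil_le_ceil (div_le_div_of_nonneg_right (hyle i) hη0.le)
      omega
  refine ⟨fun i => η * z i, ⟨⟨fun i => ⟨z i, hzm i⟩, rfl⟩, ?_⟩, fun i => (le_max_left _ _).trans (hz1 i)⟩
  have h1 : ∑ i, η * (z i : ℝ) ≤ ∑ i, y i + N * η := by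
    refine (Finset.sum_le_sum fun i _ => hz2 i).trans (le_of_eq ?_)
    rw [Finset.sum_add_distrib]; simp [hN]
  have h2 : N * η = δ / 2 := by rw [hη]; field_simp
  by_cases hall : ∀ i, -K ≤ x i
  · have : ∑ i, y i = ∑ i, x i := Finset.sum_congr rfl fun i _ => max_eq_left (hall i)
    linarith
  · push Not at hall
    obtain ⟨i, hi⟩ := hall
    have h3 : y i = -K := max_eq_right hi.le
    rw [← Finset.add_sum_erase _ y (Finset.mem_univ i), h3] at h1
    have h4 : ∑ j ∈ Finset.univ.erase i, y j ≤ N * C1 := by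
      refine (Finset.sum_le_sum fun j _ => hyle j).trans ?_
      rw [Finset.sum_const, nsmul_eq_mul]
      refine mul_le_mul_of_nonneg_right ?_ hC1
      rw [hN]
      exact_mod_cast Finset.card_le_univ _
    linarith

/-- symmetric product -/
lemma prod_PS (n p : ℕ) : ∃ E : ℕ, ∀ x : Fin n → ℝ, ∏ s : PS n p, ∏ i ∈ s.1, x i = (∏ i, x i) ^ E := by
  classical
  have hc : ∀ i j : Fin n, (Finset.univ.filter fun s : PS n p => i ∈ s.1).card =
      (Finset.univ.filter fun s : PS n p => j ∈ s.1).card := by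
    intro i j
    refine Finset.card_bij' (fun s _ => ⟨s.1.map (Equiv.swap i j).toEmbedding, by rw [Finset.card_map, s.2]⟩)
      (fun s _ => ⟨s.1.map (Equiv.swap i j).toEmbedding, by rw [Finset.card_map, s.2]⟩) ?_ ?_ ?_ ?_
    · intro s hs
      simp only [Finset.mem_filter, Finset.mem_univ, true_and] at hs ⊢
      exact Finset.mem_map.2 ⟨i, hs, by simp⟩
    · intro s hs
      simp only [Finset.mem_filter, Finset.mem_univ, true_and] at hs ⊢
      exact Finset.mem_map.2 ⟨j, hs, by simp⟩
    · intro s _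
      apply Subtype.ext
      ext x
      simp
    · intro s _
      apply Subtype.ext
      ext x
      simp
  have key : ∀ x : Fin n → ℝ, ∏ s : PS n p, ∏ i ∈ s.1, x i =
      ∏ i, x i ^ (Finset.univ.filter fun s : PS n p => i ∈ s.1).card := by
    intro x
    have h1 : ∀ s : PS n p, ∏ i ∈ s.1, x i = ∏ i, if i ∈ s.1 then x i else 1 := by
      intro s
      rw [Finset.prod_ite_mem, Finset.univ_inter]
    rw [Finset.prod_congr rfl fun s _ => h1 s, Finset.prod_comm]
    refine Finset.prod_congr rfl fun i _ => ?_
    rw [← Finset.prod_filter, Finset.prod_const]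
  rcases n with _ | n
  · exact ⟨0, fun x => by rw [key]; simp⟩
  · refine ⟨(Finset.univ.filter fun s : PS (n+1) p => (0 : Fin (n+1)) ∈ s.1).card, fun x => ?_⟩
    rw [key, ← Finset.prod_pow]
    exact Finset.prod_congr rfl fun i _ => by rw [hc i 0]
end
end SST
end

section
namespace SST
section
open Matrix

lemma functional {n p : ℕ} (hp : p < n) (a : PS n p → ℤ) (ha : a ≠ 0) :
    ∃ ℓ : (Fin n → ℝ) →ₗ[ℝ] ℝ, ℓ ≠ 0 ∧ ∀ (U : Matrix (Fin n) (Fin n) ℤ) (σ0 : PS n p), a = cmp p U σ0 →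
      ∀ (q : Fin n → ℤ) (c : Fin p → ℤ), (∀ k, q k = ∑ r, c r * U (emb σ0 r) k) →
        ℓ (fun i => (q i : ℝ)) = 0 := by
  classical
  obtain ⟨J, hJ⟩ : ∃ J, a J ≠ 0 := by
    by_contra h
    push Not at h
    exact ha (funext h)
  obtain ⟨i, hi⟩ : ∃ i, i ∉ J.1 := by
    by_contra h
    push Not at h
    have h1 : J.1 = Finset.univ := Finset.eq_univ_iff_forall.2 h
    have h2 := J.2
    rw [h1, Finset.card_univ, Fintype.card_fin] at h2
    omega
  let t : PS n (p+1) := ⟨insert i J.1, by rw [Finset.card_insert_of_notMem hi, J.2]⟩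
  let er : Fin (p+1) → PS n p := fun l => ⟨t.1.erase (emb t l), by
    rw [Finset.card_erase_of_mem (emb_mem t l), t.2]; rfl⟩
  have her : ∀ l k, emb (er l) k = emb t (l.succAbove k) := by
    intro l k
    have h1 := Finset.orderEmbOfFin_unique' (s := (er l).1) (er l).2
      (f := (Fin.succAboveOrderEmb l).trans (emb t)) (by
        intro k
        refine Finset.mem_erase.2 ⟨?_, emb_mem t _⟩
        intro h
        exact Fin.succAbove_ne l k ((emb t).injective h))
    rw [emb, ← h1]
    rfl
  let ℓ : (Fin n → ℝ) →ₗ[ℝ] ℝ :=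
    { toFun := fun x => ∑ l : Fin (p+1), (-1)^(l : ℕ) * x (emb t l) * (a (er l) : ℝ)
      map_add' := by
        intro x y
        rw [← Finset.sum_add_distrib]
        exact Finset.sum_congr rfl fun l _ => by rw [Pi.add_apply]; ring
      map_smul' := by
        intro c x
        rw [RingHom.id_apply, smul_eq_mul, Finset.mul_sum]
        exact Finset.sum_congr rfl fun l _ => by rw [Pi.smul_apply, smul_eq_mul]; ring }
  have hℓ : ∀ x, ℓ x = ∑ l : Fin (p+1), (-1)^(l : ℕ) * x (emb t l) * (a (er l) : ℝ) := fun x => rfl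
  refine ⟨ℓ, ?_, ?_⟩
  · intro h0
    have h1 : ℓ (Pi.single i 1) = 0 := by rw [h0]; rfl
    obtain ⟨l0, hl0⟩ := exists_emb t (x := i) (Finset.mem_insert_self _ _)
    have herJ : er l0 = J := by
      apply Subtype.ext
      change t.1.erase (emb t l0) = J.1
      rw [hl0]
      exact Finset.erase_insert hi
    rw [hℓ, Finset.sum_eq_single l0] at h1
    · rw [hl0, herJ, Pi.single_eq_same] at h1
      have : (a J : ℝ) ≠ 0 := by exact_mod_cast hJ
      simp [this] at h1
    · intro l _ hl
      rw [Pi.single_eq_of_ne]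
      · simp
      · rw [← hl0]
        exact fun h => hl ((emb t).injective h)
    · simp
  · intro U σ0 hU q c hq
    let A : Matrix (Fin (p+1)) (Fin (p+1)) ℤ :=
      of (Fin.cons (fun k => q (emb t k)) (fun r k => U (emb σ0 r) (emb t k)))
    have hA0 : ∀ k, A 0 k = q (emb t k) := fun k => rfl
    have hA1 : ∀ r k, A (Fin.succ r) k = U (emb σ0 r) (emb t k) := fun r k => rfl
    have hdet : A.det = 0 := by
      rw [← Matrix.exists_vecMul_eq_zero_iff]
      refine ⟨Fin.cons 1 (fun r => - c r), ?_, ?_⟩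
      · intro h
        have := congrFun h 0
        simp at this
      · funext k
        rw [Matrix.vecMul, dotProduct, Fin.sum_univ_succ]
        simp only [Fin.cons_zero, Fin.cons_succ, hA0, hA1, hq, Pi.zero_apply]
        simp
    rw [Matrix.det_succ_row_zero] at hdet
    rw [hℓ]
    have : ∑ l : Fin (p+1), (-1 : ℝ)^(l : ℕ) * (q (emb t l) : ℝ) * (a (er l) : ℝ) =
      ((∑ l : Fin (p+1), (-1)^(l : ℕ) * A 0 l * (A.submatrix Fin.succ l.succAbove).det : ℤ) : ℝ) := by
      rw [Int.cast_sum]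
      refine Finset.sum_congr rfl fun l _ => ?_
      rw [Int.cast_mul, Int.cast_mul, Int.cast_pow, Int.cast_neg, Int.cast_one]
      have h5 : U.submatrix (emb σ0) (emb (er l)) = A.submatrix Fin.succ l.succAbove := by
        ext r k
        simp only [Matrix.submatrix_apply, hA1, her]
      rw [hA0, hU, cmp_apply, h5]
    rw [this, hdet, Int.cast_zero]

end
end SST
end

section
namespace SST
section
open Matrix Filter

lemma card_PS {n p : ℕ} (hp : 1 ≤ p) (hpn : p < n) : 2 ≤ Fintype.card (PS n p) := by
  rw [Fintype.card_finset_len, Fintype.card_fin]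
  obtain ⟨m, rfl⟩ : ∃ m, n = m + 1 := ⟨n - 1, by omega⟩
  obtain ⟨r, rfl⟩ : ∃ r, p = r + 1 := ⟨p - 1, by omega⟩
  rw [Nat.choose_succ_succ]
  have h1 : 0 < m.choose r := Nat.choose_pos (by omega)
  have h2 : 0 < m.choose (r+1) := Nat.choose_pos (by omega)
  simp only [Nat.succ_eq_add_one]
  omega

/-- minors of a doubly bounded matrix -/
lemma cmp_bound {n p : ℕ} (A : Matrix (Fin n) (Fin n) ℝ) (μ : Fin n → ℝ) (π : Equiv.Perm (Fin n))
    (hA : ∀ l j, |A (π l) j| ≤ min (μ l) (μ j)) (s σ : PS n p) :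
    |cmp p A s σ| ≤ p.factorial * ∏ i ∈ s.1, μ (π.symm i) ∧
    |cmp p A s σ| ≤ p.factorial * ∏ j ∈ σ.1, μ j := by
  have hA' : ∀ i j, |A i j| ≤ min (μ (π.symm i)) (μ j) := by
    intro i j
    have := hA (π.symm i) j
    rwa [Equiv.apply_symm_apply] at this
  constructor
  · rw [cmp_apply, ← Matrix.det_transpose, ← prod_emb s (fun i => μ (π.symm i))]
    have := abs_det_le (A.submatrix (emb s) (emb σ))ᵀ (fun i => μ (π.symm (emb s i)))
      (fun i j => (hA' _ _).trans (min_le_left _ _))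
    rwa [Fintype.card_fin] at this
  · rw [cmp_apply, ← prod_emb σ (fun i => μ i)]
    have := abs_det_le (A.submatrix (emb s) (emb σ)) (fun i => μ (emb σ i))
      (fun i j => (hA' _ _).trans (min_le_right _ _))
    rwa [Fintype.card_fin] at this

lemma core {n p : ℕ} (hp : 1 ≤ p) (hpn : p < n) (W : Matrix (Fin n) (Fin n) ℝ) (hW : W.det ≠ 0)
    (hWa : ∀ i j, IsAlgebraic ℚ (W i j)) (C K δ : ℝ) (hC : 0 < C) (hK : 0 < K) (hδ : 0 < δ) :
    ∃ F : Set (PS n p → ℤ), F.Finite ∧ ∀ᶠ Q : ℝ in atTop, ∀ t : Fin n → ℝ, (∀ i, Q ^ (-K) ≤ t i) →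
      (∀ i, t i ≤ Q ^ K) → ∀ (T U : Matrix (Fin n) (Fin n) ℤ), U * T = 1 → ∀ (μ : Fin n → ℝ),
      (∀ j, 0 < μ j) → ∀ π : Equiv.Perm (Fin n),
      (∀ l j, |(diagonal t * W * rM T) (π l) j| ≤ min (μ l) (μ j)) →
      ∏ j, μ j ≤ C * |(diagonal t * W).det| →
      ∀ σ0 : PS n p, (∀ σ, σ ≠ σ0 → (∏ j ∈ σ.1, μ j) ≤ (∏ j ∈ σ0.1, μ j) * Q ^ (-δ)) →
      cmp p U σ0 ∈ F := by
  classical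
  have hcard := card_PS hp hpn
  obtain ⟨E, hE⟩ := prod_PS n p
  have hdW : 0 < |W.det| := abs_pos.2 hW
  set C' := C * |W.det| with hC'
  have hC'0 : 0 < C' := by positivity
  set H : ℝ := 1 + ∑ i, ∑ l, |W⁻¹ i l| with hH
  have hH1 : 1 ≤ H := by
    have : 0 ≤ ∑ i, ∑ l, |W⁻¹ i l| := Finset.sum_nonneg fun _ _ => Finset.sum_nonneg fun _ _ => abs_nonneg _
    linarith
  set fp : ℝ := (p.factorial : ℝ) with hfp
  have hfp0 : 0 < fp := by rw [hfp]; exact_mod_cast Nat.factorial_pos p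
  set D : ℝ := fp ^ (Fintype.card (PS n p)) * C' ^ E with hD
  have hD0 : 0 < D := by positivity
  set C1 : ℝ := 2 * K * n + 1 with hC1
  have hC10 : 0 ≤ C1 := by positivity
  obtain ⟨B, hBf, hBneg, hB⟩ := grid (PS n p) (by omega) C1 (δ/2) hC10 (by positivity)
  refine ⟨⋃ b ∈ B, {a : PS n p → ℤ | ∃ Q : ℝ, 1 ≤ Q ∧ ∃ U V : Matrix (PS n p) (PS n p) ℤ, U * V = 1 ∧
      ∃ i0, a = U i0 ∧ ∀ j, j ≠ i0 → ∀ k, |∑ l, cmp p W k l * (V l j : ℝ)| ≤ Q ^ b k}, ?_, ?_⟩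
  · exact hBf.biUnion fun b hb => thmA' hcard (cmp_det_ne W hW) (cmp_alg W hWa) b (hBneg b hb)
  filter_upwards [eventually_ge_atTop (2:ℝ), eventually_rpow_lt D 1 (δ/2) (by positivity) one_pos,
    eventually_rpow_lt (fp * C' * H ^ n) 1 1 one_pos one_pos] with Q hQ2 hQD hQH
  intro t ht1 ht2 T U hUT μ hμ π hmin hprod σ0 hσ0
  have hQ0 : 0 < Q := by linarith
  have hQ1 : 1 < Q := by linarith
  have hlog : 0 < Real.log Q := Real.log_pos hQ1
  have ht0 : ∀ i, 0 < t i := fun i => lt_of_lt_of_le (Real.rpow_pos_of_pos hQ0 _) (ht1 i)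
  -- ratios
  set r : Fin n → ℝ := fun i => μ (π.symm i) / t i with hr
  have hr0 : ∀ i, 0 < r i := fun i => div_pos (hμ _) (ht0 i)
  have hμprod : ∏ i, μ (π.symm i) = ∏ i, μ i := Equiv.prod_comp π.symm μ
  have htprod : 0 < ∏ i, t i := Finset.prod_pos fun i _ => ht0 i
  have hrprod : ∏ i, r i ≤ C' := by
    rw [hr, Finset.prod_div_distrib, hμprod, div_le_iff₀ htprod]
    refine hprod.trans (le_of_eq ?_)
    rw [Matrix.det_mul, Matrix.det_diagonal, abs_mul, abs_of_pos htprod, hC']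
    ring
  -- lower bound for mu
  have hμl : ∀ j, 1 ≤ H * Q ^ K * μ j := by
    intro j
    have h1 : ∃ i, T i j ≠ 0 := by
      by_contra h
      push Not at h
      have h2 := congrFun (congrFun hUT j) j
      rw [Matrix.mul_apply, Matrix.one_apply_eq] at h2
      simp [h] at h2
    obtain ⟨i, hi⟩ := h1
    have h2 : (1 : ℝ) ≤ |(T i j : ℝ)| := by
      have : (1:ℤ) ≤ |T i j| := Int.one_le_abs hi
      exact_mod_cast this
    have h3 : (T i j : ℝ) = ∑ l, W⁻¹ i l * ((t l)⁻¹ * (diagonal t * W * rM T) l j) := by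
      have h4 : rM T = W⁻¹ * (W * rM T) := by
        rw [← Matrix.mul_assoc, Matrix.nonsing_inv_mul _ (isUnit_iff_ne_zero.2 hW), Matrix.one_mul]
      have h5 : (T i j : ℝ) = rM T i j := rfl
      rw [h5, h4, Matrix.mul_apply]
      refine Finset.sum_congr rfl fun l _ => ?_
      rw [← h4, Matrix.mul_assoc, Matrix.diagonal_mul, ← mul_assoc (t l)⁻¹, inv_mul_cancel₀ (ht0 l).ne', one_mul]
    have h6 : ∀ l, |(t l)⁻¹ * (diagonal t * W * rM T) l j| ≤ Q ^ K * μ j := by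
      intro l
      rw [abs_mul]
      refine mul_le_mul ?_ ?_ (abs_nonneg _) (Real.rpow_pos_of_pos hQ0 _).le
      · rw [abs_of_pos (inv_pos.2 (ht0 l)), inv_le_comm₀ (ht0 l) (Real.rpow_pos_of_pos hQ0 _), ← Real.rpow_neg hQ0.le]
        exact ht1 l
      · have := hmin (π.symm l) j
        rw [Equiv.apply_symm_apply] at this
        exact this.trans (min_le_right _ _)
    have hq : 0 ≤ Q ^ K * μ j := mul_nonneg (Real.rpow_pos_of_pos hQ0 _).le (hμ j).le
    calc (1:ℝ) ≤ |(T i j : ℝ)| := h2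
      _ ≤ ∑ l, |W⁻¹ i l| * (Q ^ K * μ j) := by
        rw [h3]
        refine (Finset.abs_sum_le_sum_abs _ _).trans (Finset.sum_le_sum fun l _ => ?_)
        rw [abs_mul]
        exact mul_le_mul_of_nonneg_left (h6 l) (abs_nonneg _)
      _ = (∑ l, |W⁻¹ i l|) * (Q ^ K * μ j) := by rw [Finset.sum_mul]
      _ ≤ H * (Q ^ K * μ j) := by
        refine mul_le_mul_of_nonneg_right ?_ hq
        have := Finset.single_le_sum (f := fun i => ∑ l, |W⁻¹ i l|)
          (fun i _ => Finset.sum_nonneg fun _ _ => abs_nonneg _) (Finset.mem_univ i)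
        linarith
      _ = _ := by ring
  set R : ℝ := H * Q ^ (2 * K) with hR
  have hR0 : 0 < R := by positivity
  have hrl : ∀ i, 1 ≤ r i * R := by
    intro i
    have h1 := hμl (π.symm i)
    have h2 : Q ^ (2*K) = Q ^ K * Q ^ K := by rw [← Real.rpow_add hQ0]; ring_nf
    have h3 : r i * R = (H * Q ^ K * μ (π.symm i)) * (Q ^ K / t i) := by
      rw [hr, hR, h2]
      field_simp
    rw [h3]
    have h4 : 1 ≤ Q ^ K / t i := by rw [one_le_div (ht0 i)]; exact ht2 i
    exact one_le_mul_of_one_le_of_one_le h1 h4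
  have hrs : ∀ s : PS n p, ∏ i ∈ s.1, r i ≤ C' * R ^ n := by
    intro s
    have hR1 : 1 ≤ R := by
      rw [hR]
      exact one_le_mul_of_one_le_of_one_le hH1 (Real.one_le_rpow hQ1.le (by positivity))
    calc ∏ i ∈ s.1, r i ≤ ∏ i ∈ s.1, (r i * R) :=
          Finset.prod_le_prod (fun i _ => (hr0 i).le) fun i _ => le_mul_of_one_le_right (hr0 i).le hR1
      _ ≤ ∏ i, (r i * R) := by
          rw [← Finset.prod_mul_prod_compl s.1 (fun i => r i * R)]
          refine le_mul_of_one_le_right (Finset.prod_nonneg fun i _ => (mul_pos (hr0 i) hR0).le) ?_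
          have := Finset.prod_le_prod (s := s.1ᶜ) (f := fun _ => (1:ℝ)) (g := fun i => r i * R)
            (fun i _ => zero_le_one) (fun i _ => hrl i)
          rwa [Finset.prod_const_one] at this
      _ = (∏ i, r i) * R ^ n := by rw [Finset.prod_mul_distrib, Finset.prod_const, Finset.card_univ, Fintype.card_fin]
      _ ≤ _ := mul_le_mul_of_nonneg_right hrprod (by positivity)
  let πσ0 : PS n p := ⟨σ0.1.map π.toEmbedding, by rw [Finset.card_map, σ0.2]⟩
  have hπσ0 : ∏ i ∈ πσ0.1, μ (π.symm i) = ∏ j ∈ σ0.1, μ j := by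
    change ∏ i ∈ σ0.1.map π.toEmbedding, _ = _
    rw [Finset.prod_map]
    simp
  set w : PS n p → ℝ := fun s => fp * (∏ i ∈ s.1, r i) * (if s = πσ0 then Q ^ (-δ) else 1) with hw
  have hQδ : 0 < Q ^ (-δ) := Real.rpow_pos_of_pos hQ0 _
  have hQδ1 : Q ^ (-δ) ≤ 1 := Real.rpow_le_one_of_one_le_of_nonpos hQ1.le (by linarith)
  have hrs0 : ∀ s : PS n p, 0 < ∏ i ∈ s.1, r i := fun s => Finset.prod_pos fun i _ => hr0 i
  have hw0 : ∀ s, 0 < w s := by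
    intro s
    have := hrs0 s
    simp only [hw]
    split_ifs <;> positivity
  have hwprod : ∏ s, w s ≤ D * Q ^ (-δ) := by
    simp only [hw]
    rw [Finset.prod_mul_distrib, Finset.prod_mul_distrib, Finset.prod_const, Finset.card_univ, hE,
      Finset.prod_ite_eq' , if_pos (Finset.mem_univ _), hD]
    have : (∏ i, r i) ^ E ≤ C' ^ E := pow_le_pow_left₀ (Finset.prod_nonneg fun i _ => (hr0 i).le) hrprod _
    gcongr
  have hwle : ∀ s, w s ≤ Q ^ C1 := by
    intro s
    have h1 : w s ≤ fp * (C' * R ^ n) := by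
      simp only [hw]
      have h2 : fp * ∏ i ∈ s.1, r i ≤ fp * (C' * R ^ n) := mul_le_mul_of_nonneg_left (hrs s) hfp0.le
      refine le_trans ?_ h2
      refine mul_le_of_le_one_right (mul_pos hfp0 (hrs0 s)).le ?_
      split_ifs
      · exact hQδ1
      · exact le_rfl
    refine h1.trans ?_
    have h3 : R ^ n = H ^ n * Q ^ (2 * K * n) := by
      rw [hR, mul_pow, ← Real.rpow_natCast (Q ^ (2*K)), ← Real.rpow_mul hQ0.le]
    have h4 : Q ^ C1 = Q ^ (2 * K * n) * Q := by rw [hC1, Real.rpow_add hQ0, Real.rpow_one]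
    have h5 : fp * C' * H ^ n ≤ Q := by
      rw [Real.rpow_neg hQ0.le, Real.rpow_one, ← div_eq_mul_inv, div_lt_one hQ0] at hQH
      exact hQH.le
    rw [h3, h4]
    have h6 : 0 ≤ Q ^ (2 * K * n) := (Real.rpow_pos_of_pos hQ0 _).le
    calc fp * (C' * (H ^ n * Q ^ (2 * K * n))) = (fp * C' * H ^ n) * Q ^ (2 * K * n) := by ring
      _ ≤ Q * Q ^ (2 * K * n) := mul_le_mul_of_nonneg_right h5 h6
      _ = _ := by ring
  have hpow : ∀ s, Q ^ (Real.log (w s) / Real.log Q) = w s := by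
    intro s
    rw [Real.rpow_def_of_pos hQ0, mul_div_cancel₀ _ hlog.ne', Real.exp_log (hw0 s)]
  obtain ⟨b, hbB, hb⟩ := hB (fun s => Real.log (w s) / Real.log Q) (by
    intro s
    rw [div_le_iff₀ hlog, ← Real.log_rpow hQ0]
    exact Real.log_le_log (hw0 s) (hwle s)) (by
    rw [← Finset.sum_div, ← Real.log_prod (fun s _ => (hw0 s).ne'), div_le_iff₀ hlog, ← Real.log_rpow hQ0]
    refine Real.log_le_log (Finset.prod_pos fun s _ => hw0 s) (hwprod.trans ?_)
    have : Q ^ (-δ) = Q ^ (-(δ/2)) * Q ^ (-(δ/2)) := by rw [← Real.rpow_add hQ0]; ring_nf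
    rw [this, ← mul_assoc]
    exact mul_le_of_le_one_left (Real.rpow_pos_of_pos hQ0 _).le hQD.le)
  simp only [Set.mem_iUnion]
  refine ⟨b, hbB, Q, hQ1.le, cmp p U, cmp p T, by rw [← cmp_mul, hUT, cmp_one], σ0, rfl, ?_⟩
  intro σ hσ s
  refine le_trans ?_ (Real.rpow_le_rpow_of_exponent_le hQ1.le (hb s))
  rw [hpow s]
  have hts : 0 < ∏ i ∈ s.1, t i := Finset.prod_pos fun i _ => ht0 i
  have e1 : ∑ l, cmp p W s l * ((cmp p T l σ : ℤ) : ℝ) = cmp p (W * rM T) s σ := by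
    rw [cmp_mul, cmp_rM, Matrix.mul_apply]
    rfl
  have e2 := cmp_diag t (W * rM T) s σ
  rw [← Matrix.mul_assoc] at e2
  obtain ⟨b1, b2⟩ := cmp_bound _ μ π hmin s σ
  rw [e2, abs_mul, abs_of_pos hts] at b1 b2
  have hrr : ∏ i ∈ s.1, r i = (∏ i ∈ s.1, μ (π.symm i)) / ∏ i ∈ s.1, t i := by
    rw [hr, Finset.prod_div_distrib]
  rw [e1]
  simp only [hw]
  rw [hrr, ← mul_div_assoc, div_mul_eq_mul_div, le_div_iff₀ hts, mul_comm _ (∏ i ∈ s.1, t i)]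
  split_ifs with hs
  · subst hs
    rw [hπσ0]
    refine b2.trans ?_
    rw [mul_assoc]
    exact mul_le_mul_of_nonneg_left (hσ0 σ hσ) hfp0.le
  · rw [mul_one]; exact b1

end
end SST
end

section
namespace SST
section
open Matrix Filter

lemma sum_emb {n p : ℕ} (s : PS n p) {R : Type*} [AddCommMonoid R] (f : Fin n → R) :
    ∑ i, f (emb s i) = ∑ x ∈ s.1, f x := by
  refine Finset.sum_bij (fun i _ => emb s i) (fun i _ => emb_mem s i) (fun i _ j _ h => (emb s).injective h) ?_ ?_
  · intro x hx
    obtain ⟨i, hi⟩ := exists_emb s hx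
    exact ⟨i, Finset.mem_univ _, hi⟩
  · intros; rfl

lemma core' {n p : ℕ} (hp : 1 ≤ p) (hpn : p < n) (W : Matrix (Fin n) (Fin n) ℝ) (hW : W.det ≠ 0)
    (hWa : ∀ i j, IsAlgebraic ℚ (W i j)) (C K δ : ℝ) (hC : 0 < C) (hK : 0 < K) (hδ : 0 < δ) :
    ∃ Φ : Set ((Fin n → ℝ) →ₗ[ℝ] ℝ), Φ.Finite ∧ (∀ ℓ ∈ Φ, ℓ ≠ 0) ∧
      ∀ᶠ Q : ℝ in atTop, ∀ t : Fin n → ℝ, (∀ i, Q ^ (-K) ≤ t i) →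
      (∀ i, t i ≤ Q ^ K) → ∀ (T U : Matrix (Fin n) (Fin n) ℤ), U * T = 1 → ∀ (μ : Fin n → ℝ),
      (∀ j, 0 < μ j) → ∀ π : Equiv.Perm (Fin n),
      (∀ l j, |(diagonal t * W * rM T) (π l) j| ≤ min (μ l) (μ j)) →
      ∏ j, μ j ≤ C * |(diagonal t * W).det| →
      ∀ σ0 : PS n p, (∀ σ, σ ≠ σ0 → (∏ j ∈ σ.1, μ j) ≤ (∏ j ∈ σ0.1, μ j) * Q ^ (-δ)) →
      ∀ (q : Fin n → ℤ) (c : Fin n → ℤ), (∀ k, q k = ∑ j ∈ σ0.1, c j * U j k) →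
        ∃ ℓ ∈ Φ, ℓ (fun i => (q i : ℝ)) = 0 := by
  classical
  obtain ⟨F, hF, hcore⟩ := core hp hpn W hW hWa C K δ hC hK hδ
  have hfun := fun (a : PS n p → ℤ) (ha : a ≠ 0) => functional hpn a ha
  choose! f hf0 hf using hfun
  refine ⟨f '' (F \ {0}), (hF.subset Set.diff_subset).image _, ?_, ?_⟩
  · rintro _ ⟨a, ha, rfl⟩
    exact hf0 a ha.2
  · filter_upwards [hcore] with Q hQ
    intro t ht1 ht2 T U hUT μ hμ π hmin hprod σ0 hσ0 q c hq
    have h1 := hQ t ht1 ht2 T U hUT μ hμ π hmin hprod σ0 hσ0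
    have h2 : cmp p U σ0 ≠ 0 := by
      intro h
      have h3 : cmp p U * cmp p T = 1 := by rw [← cmp_mul, hUT, cmp_one]
      have h4 := congrFun (congrFun h3 σ0) σ0
      rw [Matrix.mul_apply, Matrix.one_apply_eq, h] at h4
      simp at h4
    refine ⟨f (cmp p U σ0), ⟨_, ⟨h1, h2⟩, rfl⟩, hf _ h2 U σ0 rfl q (fun r => c (emb σ0 r)) fun k => ?_⟩
    rw [hq, ← sum_emb σ0 (fun j => c j * U j k)]

/-- existence of a gap -/
lemma gap {n : ℕ} (μ : Fin n → ℝ) (hmono : Monotone μ) (hpos : ∀ j, 0 < μ j) (C g X : ℝ) (hC : 1 ≤ C)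
    (hg : 1 ≤ g) (hprod : ∏ j, μ j ≤ C) (j0 : Fin n) (hX : X ≤ μ j0) (hgX : g ^ n * C < X) :
    ∃ (k : ℕ) (hk : k + 1 < n), k + 1 ≤ (j0 : ℕ) ∧ g * μ ⟨k, by omega⟩ ≤ μ ⟨k+1, hk⟩ := by
  by_contra hno
  push Not at hno
  have hn : 0 < n := j0.pos
  have h1 : ∀ k (hk : k < n), k ≤ (j0 : ℕ) → μ ⟨k, hk⟩ ≤ g ^ k * μ ⟨0, hn⟩ := by
    intro k
    induction k with
    | zero => intro hk _; simp
    | succ k ih =>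
      intro hk hkj
      have h2 := ih (by omega) (by omega)
      have h3 := (hno k hk hkj).le
      refine h3.trans ?_
      rw [pow_succ']
      rw [mul_assoc]
      exact mul_le_mul_of_nonneg_left h2 (by linarith)
  have h2 := h1 j0 j0.2 le_rfl
  have h3 : μ ⟨0, hn⟩ ≤ C := by
    by_contra hc
    push Not at hc
    have h4 : C ^ n ≤ ∏ j, μ j := by
      have : C ^ n = ∏ j : Fin n, C := by simp
      rw [this]
      refine Finset.prod_le_prod (fun _ _ => by linarith) fun j _ => hc.le.trans (hmono ?_)
      exact Fin.mk_le_of_le_val (Nat.zero_le _)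
    have h5 : μ ⟨0, hn⟩ ^ n ≤ ∏ j, μ j := by
      have : μ ⟨0, hn⟩ ^ n = ∏ j : Fin n, μ ⟨0, hn⟩ := by simp
      rw [this]
      exact Finset.prod_le_prod (fun _ _ => (hpos _).le) fun j _ => hmono (Fin.mk_le_of_le_val (Nat.zero_le _))
    have h6 : C < μ ⟨0, hn⟩ ^ n := lt_of_lt_of_le hc (le_self_pow₀ (by linarith) (by omega))
    linarith
  have h4 : g ^ (j0 : ℕ) ≤ g ^ n := pow_le_pow_right₀ hg j0.2.le
  have h5 : g ^ (j0 : ℕ) * μ ⟨0, hn⟩ ≤ g ^ n * C := mul_le_mul h4 h3 (hpos _).le (by positivity)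
  linarith

lemma gap_prod {n p : ℕ} (μ : Fin n → ℝ) (hmono : Monotone μ) (hpos : ∀ j, 0 < μ j) (g : ℝ) (hg : 1 ≤ g)
    (k : ℕ) (hk : k + 1 < n) (hgap : g * μ ⟨k, by omega⟩ ≤ μ ⟨k+1, hk⟩) (σ0 σ : PS n p)
    (hσ0 : ∀ j, j ∈ σ0.1 ↔ k < (j : ℕ)) (hne : σ ≠ σ0) :
    g * ∏ j ∈ σ.1, μ j ≤ ∏ j ∈ σ0.1, μ j := by
  classical
  have hcard : (σ.1 \ σ0.1).card = (σ0.1 \ σ.1).card := Finset.card_sdiff_comm (by rw [σ.2, σ0.2])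
  have hm : (σ.1 \ σ0.1).card ≠ 0 := by
    intro h
    rw [Finset.card_eq_zero, Finset.sdiff_eq_empty_iff_subset] at h
    exact hne (Subtype.ext (Finset.eq_of_subset_of_card_le h (by rw [σ.2, σ0.2])))
  set m := (σ.1 \ σ0.1).card with hmdef
  set x := μ ⟨k, by omega⟩ with hx
  have hx0 : 0 < x := hpos _
  have hA : ∏ j ∈ σ.1 \ σ0.1, μ j ≤ x ^ m := by
    rw [hmdef, ← Finset.prod_const]
    refine Finset.prod_le_prod (fun j _ => (hpos j).le) fun j hj => hmono ?_
    have := (Finset.mem_sdiff.1 hj).2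
    rw [hσ0] at this
    rw [Fin.le_def]
    simpa using this
  have hB : (g * x) ^ m ≤ ∏ j ∈ σ0.1 \ σ.1, μ j := by
    rw [hcard, ← Finset.prod_const]
    refine Finset.prod_le_prod (fun j _ => by positivity) fun j hj => hgap.trans (hmono ?_)
    have := (Finset.mem_sdiff.1 hj).1
    rw [hσ0] at this
    rw [Fin.le_def]
    exact this
  have h1 : ∏ j ∈ σ.1, μ j = (∏ j ∈ σ.1 \ σ0.1, μ j) * ∏ j ∈ σ.1 ∩ σ0.1, μ j := by
    rw [mul_comm]; exact (Finset.prod_inter_mul_prod_diff _ _ _).symm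
  have h2 : ∏ j ∈ σ0.1, μ j = (∏ j ∈ σ0.1 \ σ.1, μ j) * ∏ j ∈ σ.1 ∩ σ0.1, μ j := by
    rw [mul_comm, Finset.inter_comm]; exact (Finset.prod_inter_mul_prod_diff _ _ _).symm
  rw [h1, h2, ← mul_assoc]
  refine mul_le_mul_of_nonneg_right ?_ (Finset.prod_nonneg fun j _ => (hpos j).le)
  calc g * ∏ j ∈ σ.1 \ σ0.1, μ j ≤ g ^ m * x ^ m := by
        refine mul_le_mul (le_self_pow₀ hg hm) hA (Finset.prod_nonneg fun j _ => (hpos j).le) (by positivity)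
    _ = (g * x) ^ m := by rw [mul_pow]
    _ ≤ _ := hB

end
end SST
end

section
namespace SST
section
open Matrix Filter

/-- the main theorem for large q -/
theorem large {n : ℕ} (hn : 2 ≤ n) (L : Matrix (Fin n) (Fin n) ℝ) (hL : L.det ≠ 0)
    (hLa : ∀ i j, IsAlgebraic ℚ (L i j)) (ε : ℝ) (hε : 0 < ε) :
    ∃ Φ : Set ((Fin n → ℝ) →ₗ[ℝ] ℝ), Φ.Finite ∧ (∀ ℓ ∈ Φ, ℓ ≠ 0) ∧
      ∀ᶠ Q : ℝ in atTop, ∀ q : Fin n → ℤ, q ≠ 0 → (∀ i, |(q i : ℝ)| ≤ Q) →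
        ∏ i, |∑ j, L i j * (q j : ℝ)| ≤ |L.det| * Q ^ (-ε) →
        ∃ ℓ ∈ Φ, ℓ (fun i => (q i : ℝ)) = 0 := by
  classical
  have hn0 : 0 < (n : ℝ) := by exact_mod_cast (by omega : 0 < n)
  set W : Matrix (Fin n) (Fin n) ℝ := (L⁻¹)ᵀ with hW
  have hLu : IsUnit L.det := isUnit_iff_ne_zero.2 hL
  have hWd : W.det ≠ 0 := by
    rw [hW, Matrix.det_transpose]
    have h1 := Matrix.mul_nonsing_inv L hLu
    have := congrArg Matrix.det h1
    rw [Matrix.det_mul, Matrix.det_one] at this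
    exact right_ne_zero_of_mul_eq_one this
  have hWa : ∀ i j, IsAlgebraic ℚ (W i j) := fun i j => algebraic_inv L hLa j i
  obtain ⟨C, hC, hred⟩ := redR n
  set H : ℝ := 1 + ∑ i, ∑ j, |L i j| with hH
  have hH1 : 1 ≤ H := by
    have : 0 ≤ ∑ i, ∑ j, |L i j| := Finset.sum_nonneg fun _ _ => Finset.sum_nonneg fun _ _ => abs_nonneg _
    linarith
  set δ : ℝ := ε / (2 * n) with hδ
  have hδ0 : 0 < δ := by positivity
  have hnδ : n * δ = ε / 2 := by rw [hδ]; field_simp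
  set K0 : ℝ := n + ε with hK0
  have hK00 : 0 < K0 := by positivity
  set K : ℝ := K0 + 2 + δ with hK
  have hKpos : 0 < K := by positivity
  set δ' : ℝ := δ / (2 * n) with hδ'
  have hδ'0 : 0 < δ' := by positivity
  have hc := fun (p : ℕ) (hp : 1 ≤ p ∧ p < n) => core' hp.1 hp.2 W hWd hWa C K δ' hC hKpos hδ'0
  choose! Φ hΦf hΦ0 hΦ using hc
  set D : ℝ := |L.det| + H ^ n with hD
  have hD0 : 0 < D := by positivity
  set C' : ℝ := max 1 (C * |W.det|) with hC'
  have hC'1 : 1 ≤ C' := le_max_left _ _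
  refine ⟨⋃ p ∈ Finset.Ico 1 n, Φ p, ?_, ?_, ?_⟩
  · refine (Finset.finite_toSet (Finset.Ico 1 n)).biUnion fun p hp => hΦf p ?_
    simpa using hp
  · intro ℓ hℓ
    simp only [Set.mem_iUnion] at hℓ
    obtain ⟨p, hp, hℓ⟩ := hℓ
    exact hΦ0 p (Finset.mem_Ico.1 hp) ℓ hℓ
  have hall := (Finset.eventually_all (Finset.Ico 1 n)).2 fun p hp => hΦ p (Finset.mem_Ico.1 hp)
  filter_upwards [hall, eventually_ge_atTop (2:ℝ), eventually_ge_atTop H,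
    eventually_rpow_lt D 1 (ε/2) (by positivity) one_pos,
    eventually_rpow_lt (n * C') 1 (δ/2) (by positivity) one_pos] with Q hQall hQ2 hQH hQD hQC
  intro q hq0 hqQ hprodq
  have hQ0 : 0 < Q := by linarith
  have hQ1 : 1 < Q := by linarith
  have hrp : ∀ x : ℝ, 0 < Q ^ x := fun x => Real.rpow_pos_of_pos hQ0 x
  set qR : Fin n → ℝ := fun i => (q i : ℝ) with hqR
  set l : Fin n → ℝ := fun i => ∑ j, L i j * (q j : ℝ) with hl
  have hlmul : l = L *ᵥ qR := rfl
  have hlle : ∀ i, |l i| ≤ H * Q := by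
    intro i
    calc |l i| ≤ ∑ j, |L i j| * Q := by
          refine (Finset.abs_sum_le_sum_abs _ _).trans (Finset.sum_le_sum fun j _ => ?_)
          rw [abs_mul]
          exact mul_le_mul_of_nonneg_left (hqQ j) (abs_nonneg _)
      _ = (∑ j, |L i j|) * Q := by rw [Finset.sum_mul]
      _ ≤ H * Q := by
        refine mul_le_mul_of_nonneg_right ?_ hQ0.le
        have := Finset.single_le_sum (f := fun i => ∑ l, |L i l|)
          (fun i _ => Finset.sum_nonneg fun _ _ => abs_nonneg _) (Finset.mem_univ i)
        linarith
  set y : Fin n → ℝ := fun i => max |l i| (Q ^ (-K0)) with hy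
  have hy0 : ∀ i, 0 < y i := fun i => lt_of_lt_of_le (hrp _) (le_max_right _ _)
  have hyle : ∀ i, y i ≤ H * Q := by
    intro i
    refine max_le (hlle i) ?_
    have : Q ^ (-K0) ≤ 1 := Real.rpow_le_one_of_one_le_of_nonpos hQ1.le (by linarith)
    have h2 : 1 ≤ H * Q := one_le_mul_of_one_le_of_one_le hH1 hQ1.le
    linarith
  have hyprod : ∏ i, y i ≤ D * Q ^ (-ε) := by
    have e0 : 0 ≤ |L.det| * Q ^ (-ε) := mul_nonneg (abs_nonneg _) (hrp _).le
    have e1 : 0 ≤ H ^ n * Q ^ (-ε) := mul_nonneg (by positivity) (hrp _).le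
    rw [hD, add_mul]
    by_cases hcase : ∀ i, Q ^ (-K0) ≤ |l i|
    · have : ∏ i, y i = ∏ i, |l i| := Finset.prod_congr rfl fun i _ => max_eq_left (hcase i)
      rw [this]
      linarith
    · push Not at hcase
      obtain ⟨i, hi⟩ := hcase
      have hyi : y i = Q ^ (-K0) := max_eq_right hi.le
      rw [← Finset.mul_prod_erase _ y (Finset.mem_univ i), hyi]
      have h1 : ∏ j ∈ Finset.univ.erase i, y j ≤ (H * Q) ^ n := by
        calc ∏ j ∈ Finset.univ.erase i, y j ≤ ∏ j ∈ Finset.univ.erase i, (H * Q) :=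
              Finset.prod_le_prod (fun j _ => (hy0 j).le) fun j _ => hyle j
          _ = (H * Q) ^ (n - 1) := by
              rw [Finset.prod_const, Finset.card_erase_of_mem (Finset.mem_univ i), Finset.card_univ, Fintype.card_fin]
          _ ≤ (H * Q) ^ n := pow_le_pow_right₀ (one_le_mul_of_one_le_of_one_le hH1 hQ1.le) (by omega)
      have h2 : Q ^ (-K0) * (H * Q) ^ n = H ^ n * Q ^ (-ε) := by
        have : Q ^ (-ε) = Q ^ (-K0) * Q ^ n := by
          rw [← Real.rpow_natCast, ← Real.rpow_add hQ0, hK0]; ring_nf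
        rw [this, mul_pow]; ring
      have h3 := mul_le_mul_of_nonneg_left h1 (hrp (-K0)).le
      linarith
  set t : Fin n → ℝ := fun i => y i * Q ^ δ with ht
  have ht0 : ∀ i, 0 < t i := fun i => mul_pos (hy0 i) (hrp _)
  have hQδ1 : 1 ≤ Q ^ δ := Real.one_le_rpow hQ1.le hδ0.le
  have htprod : ∏ i, t i ≤ 1 := by
    have h1 : ∏ i, t i = (∏ i, y i) * Q ^ (ε / 2) := by
      rw [ht, Finset.prod_mul_distrib, Finset.prod_const, Finset.card_univ, Fintype.card_fin,
        ← Real.rpow_natCast (Q ^ δ), ← Real.rpow_mul hQ0.le, mul_comm δ, hnδ]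
    have h2 : D * Q ^ (-ε) * Q ^ (ε / 2) = D * Q ^ (-(ε/2)) := by
      rw [mul_assoc, ← Real.rpow_add hQ0]; ring_nf
    rw [h1]
    have h3 := mul_le_mul_of_nonneg_right hyprod (hrp (ε/2)).le
    linarith
  have ht1 : ∀ i, Q ^ (-K) ≤ t i := by
    intro i
    have h1 : Q ^ (-K) ≤ Q ^ (-K0) := Real.rpow_le_rpow_of_exponent_le hQ1.le (by linarith)
    have h2 : y i ≤ t i := le_mul_of_one_le_right (hy0 i).le hQδ1
    have h3 : Q ^ (-K0) ≤ y i := le_max_right _ _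
    linarith
  have ht2 : ∀ i, t i ≤ Q ^ K := by
    intro i
    have h1 : Q ^ K = Q ^ K0 * (Q * Q * Q ^ δ) := by
      rw [hK, Real.rpow_add hQ0, Real.rpow_add hQ0, Real.rpow_two]; ring
    have h2 : 1 ≤ Q ^ K0 := Real.one_le_rpow hQ1.le hK00.le
    have h3 : y i ≤ Q * Q := (hyle i).trans (mul_le_mul_of_nonneg_right hQH hQ0.le)
    have h4 : t i ≤ Q * Q * Q ^ δ := mul_le_mul_of_nonneg_right h3 (hrp _).le
    rw [h1]
    have h5 : 0 ≤ Q * Q * Q ^ δ := (ht0 i).le.trans h4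
    exact h4.trans (le_mul_of_one_le_left h5 h2)
  have hGd : (diagonal t * W).det ≠ 0 := by
    rw [Matrix.det_mul, Matrix.det_diagonal]
    exact mul_ne_zero (Finset.prod_ne_zero_iff.2 fun i _ => (ht0 i).ne') hWd
  obtain ⟨T, hT, μ, hmono, hμ, π, hmin, hprod⟩ := hred (diagonal t * W) hGd
  set U : Matrix (Fin n) (Fin n) ℤ := T⁻¹ with hU
  have hUT : U * T = 1 := Matrix.nonsing_inv_mul T hT
  have hTU : T * U = 1 := Matrix.mul_nonsing_inv T hT
  have hμC : ∏ j, μ j ≤ C' := by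
    refine hprod.trans (le_trans ?_ (le_max_right _ _))
    refine mul_le_mul_of_nonneg_left ?_ hC.le
    have h0 : 0 ≤ ∏ i, t i := Finset.prod_nonneg fun i _ => (ht0 i).le
    rw [Matrix.det_mul, Matrix.det_diagonal, abs_mul, abs_of_nonneg h0]
    exact mul_le_of_le_one_left (abs_nonneg _) htprod
  -- the integer coordinates
  set z : Fin n → ℤ := q ᵥ* T with hz
  have hzU : z ᵥ* U = q := by rw [hz, Matrix.vecMul_vecMul, hTU, Matrix.vecMul_one]
  have hzle : ∀ j, |(z j : ℝ)| ≤ n * Q ^ (-δ) * μ j := by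
    intro j
    have h1 : (z j : ℝ) = (qR ᵥ* rM T) j := by
      rw [hz]
      simp only [Matrix.vecMul, dotProduct, Int.cast_sum, Int.cast_mul]
      rfl
    have h2 : qR = l ᵥ* W := by
      rw [hW, Matrix.vecMul_transpose, hlmul, Matrix.mulVec_mulVec, Matrix.nonsing_inv_mul _ hLu, Matrix.one_mulVec]
    have h3 : (z j : ℝ) = ∑ i, (l i / t i) * (diagonal t * W * rM T) i j := by
      rw [h1, h2, Matrix.vecMul_vecMul]
      simp only [Matrix.vecMul, dotProduct]
      refine Finset.sum_congr rfl fun i _ => ?_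
      rw [Matrix.mul_assoc, Matrix.diagonal_mul, ← mul_assoc, div_mul_cancel₀ _ (ht0 i).ne']
    rw [h3]
    refine (Finset.abs_sum_le_sum_abs _ _).trans ?_
    have h4 : ∀ i ∈ Finset.univ, |(l i / t i) * (diagonal t * W * rM T) i j| ≤ Q ^ (-δ) * μ j := by
      intro i _
      rw [abs_mul]
      refine mul_le_mul ?_ ?_ (abs_nonneg _) (hrp _).le
      · rw [abs_div, abs_of_pos (ht0 i), div_le_iff₀ (ht0 i)]
        have h5 : Q ^ (-δ) * t i = y i := by
          rw [ht, Real.rpow_neg hQ0.le]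
          field_simp [(hrp δ).ne']
        rw [h5]
        exact le_max_left _ _
      · have := hmin (π.symm i) j
        rw [Equiv.apply_symm_apply] at this
        exact this.trans (min_le_right _ _)
    refine (Finset.sum_le_sum h4).trans (le_of_eq ?_)
    rw [Finset.sum_const, Finset.card_univ, Fintype.card_fin, nsmul_eq_mul]
    ring
  have hzne : ∃ m : ℕ, ∃ h : m < n, z ⟨m, h⟩ ≠ 0 := by
    by_contra h
    push Not at h
    apply hq0
    have : z = 0 := funext fun j => h j.1 j.2
    rw [← hzU, this, Matrix.zero_vecMul]
  let m := Nat.find hzne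
  obtain ⟨hmn, hzm⟩ := Nat.find_spec hzne
  have hmmin : ∀ j : Fin n, (j : ℕ) < m → z j = 0 := by
    intro j hj
    by_contra h
    exact Nat.find_min hzne hj ⟨j.2, h⟩
  set g : ℝ := Q ^ δ' with hg
  have hg1 : 1 ≤ g := Real.one_le_rpow hQ1.le hδ'0.le
  have hX : Q ^ δ / n ≤ μ ⟨m, hmn⟩ := by
    have h1 : (1 : ℝ) ≤ |(z ⟨m, hmn⟩ : ℝ)| := by
      have : (1:ℤ) ≤ |z ⟨m, hmn⟩| := Int.one_le_abs hzm
      exact_mod_cast this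
    have h2 := h1.trans (hzle ⟨m, hmn⟩)
    rw [div_le_iff₀ hn0]
    have h3 : Q ^ δ * (n * Q ^ (-δ) * μ ⟨m, hmn⟩) = μ ⟨m, hmn⟩ * n := by
      rw [Real.rpow_neg hQ0.le]
      field_simp [(hrp δ).ne']
    rw [← h3]
    exact le_mul_of_one_le_right (hrp _).le h2
  have hgX : g ^ n * C' < Q ^ δ / n := by
    rw [lt_div_iff₀ hn0]
    have h1 : g ^ n = Q ^ (δ/2) := by
      rw [hg, ← Real.rpow_natCast, ← Real.rpow_mul hQ0.le, hδ']
      congr 1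
      field_simp
    have h2 : Q ^ δ = Q ^ (δ/2) * Q ^ (δ/2) := by rw [← Real.rpow_add hQ0]; ring_nf
    have h3 : n * C' < Q ^ (δ/2) := by
      rw [Real.rpow_neg hQ0.le, ← div_eq_mul_inv, div_lt_one (hrp _)] at hQC
      exact hQC
    rw [h1, h2, mul_assoc, mul_comm C']
    exact mul_lt_mul_of_pos_left h3 (hrp _)
  obtain ⟨k, hk, hkm, hgap⟩ := gap μ hmono hμ C' g _ hC'1 hg1 hμC ⟨m, hmn⟩ hX hgX
  have hkm' : k + 1 ≤ m := hkm
  set S : Finset (Fin n) := Finset.univ.filter fun j => k < (j : ℕ) with hS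
  have hSmem : ∀ j, j ∈ S ↔ k < (j : ℕ) := fun j => by simp [hS]
  have hp1 : 1 ≤ S.card := Finset.card_pos.2 ⟨⟨k+1, hk⟩, (hSmem _).2 (Nat.lt_succ_self k)⟩
  have hpn : S.card < n := by
    have : S ⊂ Finset.univ := by
      refine Finset.ssubset_univ_iff.2 fun h => ?_
      have h1 : (⟨0, by omega⟩ : Fin n) ∈ S := by rw [h]; exact Finset.mem_univ _
      rw [hSmem] at h1
      simp at h1
    have := Finset.card_lt_card this
    rwa [Finset.card_univ, Fintype.card_fin] at this
  have hfin := hQall S.card (Finset.mem_Ico.2 ⟨hp1, hpn⟩) t ht1 ht2 T U hUT μ hμ π hmin hprod ⟨S, rfl⟩ (by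
    intro σ hσ
    have h1 := gap_prod μ hmono hμ g hg1 k hk hgap ⟨S, rfl⟩ σ hSmem hσ
    rw [Real.rpow_neg hQ0.le, ← div_eq_mul_inv, le_div_iff₀ (hrp _), mul_comm]
    exact h1) q z (by
    intro i
    have h1 := congrFun hzU i
    rw [← h1]
    simp only [Matrix.vecMul, dotProduct]
    symm
    refine Finset.sum_subset (Finset.subset_univ _) fun j _ hj => ?_
    rw [hSmem] at hj
    rw [hmmin j (by omega), zero_mul])
  obtain ⟨ℓ, hℓ, hℓq⟩ := hfin
  refine ⟨ℓ, ?_, hℓq⟩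
  simp only [Set.mem_iUnion]
  exact ⟨S.card, Finset.mem_Ico.2 ⟨hp1, hpn⟩, hℓ⟩

end
end SST
end

theorem stmt3 (n : ℕ) (hn : 2 ≤ n) (α : Fin n → Fin n → ℝ)
    (halg : ∀ i j, IsAlgebraic ℚ (α i j))
    (hli : LinearIndependent ℝ α) (ε : ℝ) (hε : 0 < ε) :
    ∃ (N : ℕ) (V : Fin N → Submodule ℝ (Fin n → ℝ)),
      (∀ m : Fin N, V m ≠ ⊤ ∧
        ∃ s : Set (Fin n → ℝ), (∀ v ∈ s, ∀ j, ∃ r : ℚ, v j = (r : ℝ)) ∧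
          V m = Submodule.span ℝ s) ∧
      ∀ q : Fin n → ℤ, Finset.univ.gcd q = 1 →
        (∏ i, |dotp (α i) (zCast q)| / (euclNorm (α i) * euclNorm (zCast q))) ≤
          (|Matrix.det (Matrix.of α)| / ∏ i, euclNorm (α i)) *
            euclNorm (zCast q) ^ (-(n : ℝ) - ε) →
        ∃ m : Fin N, zCast q ∈ V m := by
  classical
  have hdet : (Matrix.of α).det ≠ 0 := by
    have h1 : LinearIndependent ℝ (Matrix.of α).row := hli
    rw [Matrix.linearIndependent_rows_iff_isUnit] at h1
    exact ((Matrix.isUnit_iff_isUnit_det _).1 h1).ne_zero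
  obtain ⟨Φ, hΦf, hΦ0, hΦ⟩ := SST.large hn (Matrix.of α) hdet halg ε hε
  obtain ⟨Q0, hQ0⟩ := Filter.eventually_atTop.1 hΦ
  have hnorm_pos : ∀ x : Fin n → ℝ, x ≠ 0 → 0 < euclNorm x := by
    intro x hx
    apply Real.sqrt_pos.2
    obtain ⟨i, hi⟩ := Function.ne_iff.1 hx
    exact Finset.sum_pos' (fun _ _ => sq_nonneg _) ⟨i, Finset.mem_univ _, (sq_pos_of_ne_zero hi)⟩
  have hnorm_le : ∀ (x : Fin n → ℝ) i, |x i| ≤ euclNorm x := by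
    intro x i
    apply Real.le_sqrt_of_sq_le
    rw [sq_abs]
    exact Finset.single_le_sum (f := fun i => x i ^ 2) (fun _ _ => sq_nonneg _) (Finset.mem_univ i)
  -- functionals for small vectors
  have hsmall : ∀ q : Fin n → ℤ, q ≠ 0 → ∃ ℓ : (Fin n → ℝ) →ₗ[ℝ] ℝ, ℓ ≠ 0 ∧ ℓ (zCast q) = 0 := by
    intro q hq
    obtain ⟨i, hi⟩ := Function.ne_iff.1 hq
    have : Nontrivial (Fin n) := Fin.nontrivial_iff_two_le.2 hn
    obtain ⟨j, hj⟩ := exists_ne i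
    refine ⟨(q i : ℝ) • LinearMap.proj j - (q j : ℝ) • LinearMap.proj i, ?_, ?_⟩
    · intro h
      have h1 := LinearMap.congr_fun h (Pi.single j 1)
      simp [Pi.single_eq_of_ne hj.symm] at h1
      exact hi h1
    · simp [zCast, mul_comm]
  choose! f hf0 hf using hsmall
  set B : Set (Fin n → ℤ) := Set.Icc (fun _ => -⌈Q0⌉) (fun _ => ⌈Q0⌉) with hB
  have hBf : B.Finite := Set.finite_Icc _ _
  set Ψ : Set ((Fin n → ℝ) →ₗ[ℝ] ℝ) := Φ ∪ f '' (B \ {0}) with hΨ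
  have hΨf : Ψ.Finite := hΦf.union ((hBf.subset Set.sdiff_subset).image _)
  have hΨ0 : ∀ ℓ ∈ Ψ, ℓ ≠ 0 := by
    rintro ℓ (h | ⟨q, hq, rfl⟩)
    · exact hΦ0 ℓ h
    · exact hf0 q hq.2
  have : Fintype Ψ := hΨf.fintype
  let e := Fintype.equivFin Ψ
  refine ⟨Fintype.card Ψ, fun m => Submodule.span ℝ {v | ∃ q : Fin n → ℤ, v = zCast q ∧ (e.symm m).1 v = 0}, ?_, ?_⟩
  · intro m
    refine ⟨?_, _, ?_, rfl⟩
    · intro htop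
      beta_reduce at htop
      apply hΨ0 _ (e.symm m).2
      have h1 : Submodule.span ℝ {v | ∃ q : Fin n → ℤ, v = zCast q ∧ (e.symm m).1 v = 0} ≤
          LinearMap.ker (e.symm m).1 := by
        rw [Submodule.span_le]
        rintro v ⟨q, _, hv⟩
        exact hv
      rw [htop, top_le_iff, LinearMap.ker_eq_top] at h1
      exact h1
    · rintro v ⟨q, rfl, _⟩ j
      exact ⟨(q j : ℚ), by simp [zCast]⟩
  · intro q hq hle
    have hq0 : q ≠ 0 := by
      rintro rfl
      have : (Finset.univ : Finset (Fin n)).gcd (0 : Fin n → ℤ) = 0 := Finset.gcd_eq_zero_iff.2 fun _ _ => rfl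
      rw [this] at hq
      exact zero_ne_one hq
    have hzq : zCast q ≠ 0 := by
      intro h
      apply hq0
      funext i
      have := congrFun h i
      simpa [zCast] using this
    suffices h : ∃ ℓ ∈ Ψ, ℓ (zCast q) = 0 by
      obtain ⟨ℓ, hℓ, hℓq⟩ := h
      refine ⟨e ⟨ℓ, hℓ⟩, Submodule.subset_span ⟨q, rfl, ?_⟩⟩
      rw [Equiv.symm_apply_apply]
      exact hℓq
    set Q := euclNorm (zCast q) with hQ
    have hQpos : 0 < Q := hnorm_pos _ hzq
    by_cases hbig : Q0 ≤ Q
    · have hα : ∀ i, 0 < euclNorm (α i) := fun i => hnorm_pos _ (hli.ne_zero i)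
      have hA : 0 < ∏ i, euclNorm (α i) := Finset.prod_pos fun i _ => hα i
      have hmain : ∏ i, |∑ j, (Matrix.of α) i j * (q j : ℝ)| ≤ |(Matrix.of α).det| * Q ^ (-ε) := by
        rw [Finset.prod_div_distrib, Finset.prod_mul_distrib, Finset.prod_const, Finset.card_univ,
          Fintype.card_fin, div_le_iff₀ (by positivity)] at hle
        have h1 : Q ^ (-ε) = Q ^ (-(n : ℝ) - ε) * Q ^ n := by
          rw [← Real.rpow_natCast, ← Real.rpow_add hQpos]; ring_nf
        have h2 : ∏ i, |∑ j, (Matrix.of α) i j * (q j : ℝ)| = ∏ i, |dotp (α i) (zCast q)| := rfl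
        rw [h1, h2]
        refine hle.trans (le_of_eq ?_)
        field_simp
      obtain ⟨ℓ, hℓ, hℓq⟩ := hQ0 Q hbig q hq0 (fun i => hnorm_le (zCast q) i) hmain
      exact ⟨ℓ, Or.inl hℓ, hℓq⟩
    · push Not at hbig
      refine ⟨f q, Or.inr ⟨q, ⟨?_, hq0⟩, rfl⟩, hf q hq0⟩
      have h1 : ∀ i, |q i| ≤ ⌈Q0⌉ := by
        intro i
        have h2 : |(q i : ℝ)| ≤ Q := hnorm_le (zCast q) i
        have h3 : ((|q i| : ℤ) : ℝ) ≤ (⌈Q0⌉ : ℝ) := by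
          push_cast
          exact (h2.trans hbig.le).trans (Int.le_ceil _)
        exact_mod_cast h3
      exact ⟨fun i => (abs_le.1 (h1 i)).1, fun i => (abs_le.1 (h1 i)).2⟩
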